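/- arXiv:1505.01970 — 2 statements merged into one kernel-verified Lean document; each statement's English description precedes it below -/
import Mathlib

section
/- Let n and h be integers with n < 2h and h < n. Then for every odd prime power q, ∑_{J ∈ M_h} E_d(J,n,q) = 0; equivalently, ∑_{J ∈ M_h} ∑_{f ∈ M_n} d(f)d(f+J) = q^{n+h}(n+1)^2. -/
open Polynomial

/-- The monic polynomial of degree `n` determined by its lower-order coefficients `a`.
As `a` ranges over `Fin n → F` this parameterizes the set `Mₙ` of monic polynomials of
degree `n` in `F[X]`. -/
noncomputable def mon {F : Type} [Field F] (n : ℕ) (a : Fin n → F) : F[X] :=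
  X ^ n + ∑ i : Fin n, C (a i) * X ^ (i : ℕ)

/-- `d(f)`: the number of monic divisors of `f`. -/
noncomputable def dd {F : Type} [Field F] (f : F[X]) : ℕ :=
  Nat.card {g : F[X] // g.Monic ∧ g ∣ f}

/-- The error term `E_d(J,n,q) := q⁻ⁿ ∑_{f ∈ Mₙ} d(f)d(f+J) − (n+1)²`. -/
noncomputable def Errd (F : Type) [Field F] [Fintype F] (n : ℕ) (J : F[X]) : ℝ :=
  ((Fintype.card F : ℝ) ^ n)⁻¹ *
    (∑ a : Fin n → F, (dd (mon n a) : ℝ) * (dd (mon n a + J) : ℝ)) - ((n : ℝ) + 1) ^ 2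

/-- The number of monic divisors of `f` of degree `k`. -/
noncomputable def monicDivisorCount {F : Type} [Field F] (k : ℕ) (f : F[X]) : ℕ :=
  Nat.card {g : F[X] // (g.Monic ∧ g.natDegree = k) ∧ g ∣ f}

section

variable {F : Type} [Field F]

lemma mon_eq_X_pow_add (n : ℕ) (a : Fin n → F) :
    mon n a = X ^ n + ((degreeLTEquiv F n).symm a : F[X]) := by
  simp only [mon, C_mul_X_pow_eq_monomial]
  rfl

lemma degree_degreeLTEquiv_symm_lt (n : ℕ) (a : Fin n → F) :
    ((degreeLTEquiv F n).symm a : F[X]).degree < n :=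
  mem_degreeLT.1 ((degreeLTEquiv F n).symm a).2

lemma monic_mon (n : ℕ) (a : Fin n → F) : (mon n a).Monic := by
  rw [mon_eq_X_pow_add]
  exact monic_X_pow_add (degree_degreeLTEquiv_symm_lt n a)

lemma natDegree_mon (n : ℕ) (a : Fin n → F) : (mon n a).natDegree = n := by
  rw [mon_eq_X_pow_add, natDegree_add_eq_left_of_degree_lt, natDegree_X_pow]
  rw [degree_X_pow]
  exact degree_degreeLTEquiv_symm_lt n a

instance finite_degreeLT [Finite F] (n : ℕ) : Finite (degreeLT F n) :=
  Finite.of_equiv _ (degreeLTEquiv F n).symm.toEquiv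

lemma card_degreeLT (n : ℕ) : Nat.card (degreeLT F n) = Nat.card F ^ n := by
  rw [Nat.card_congr (degreeLTEquiv F n).toEquiv, Nat.card_fun, Nat.card_fin]

instance finite_monic_natDegree_eq [Finite F] (n : ℕ) :
    Finite {p : F[X] // p.Monic ∧ p.natDegree = n} :=
  Finite.of_equiv _ (monicEquivDegreeLT n).symm

lemma card_monic_natDegree_eq (n : ℕ) :
    Nat.card {p : F[X] // p.Monic ∧ p.natDegree = n} = Nat.card F ^ n := by
  rw [Nat.card_congr (monicEquivDegreeLT n), card_degreeLT]

instance finite_monic_natDegree_eq_dvd [Finite F] (n : ℕ) (f : F[X]) :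
    Finite {p : F[X] // (p.Monic ∧ p.natDegree = n) ∧ p ∣ f} :=
  Finite.of_injective
    (fun p => (⟨p.1, p.2.1⟩ : {p : F[X] // p.Monic ∧ p.natDegree = n}))
    fun _ _ h => Subtype.ext (Subtype.mk.inj h)

lemma dd_eq_sum_monicDivisorCount [Finite F] {f : F[X]} (hf : f ≠ 0) :
    dd f = ∑ k ∈ Finset.range (f.natDegree + 1), monicDivisorCount k f := by
  rw [Finset.sum_range, dd]
  simp only [monicDivisorCount]
  rw [← Nat.card_sigma]
  exact Nat.card_congr
    { toFun := fun g => ⟨⟨g.1.natDegree, Nat.lt_succ_of_le (natDegree_le_of_dvd g.2.2 hf)⟩,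
        ⟨g.1, ⟨g.2.1, rfl⟩, g.2.2⟩⟩
      invFun := fun x => ⟨x.2.1, x.2.2.1.1, x.2.2.2⟩
      left_inv := fun _ => rfl
      right_inv := by
        rintro ⟨⟨k, hk⟩, g, hg, hd⟩
        obtain rfl : g.natDegree = k := hg.2
        rfl }

lemma monicDivisorCount_add_le [Finite F] {f : F[X]} (hf : f.Monic) {k l : ℕ}
    (h : f.natDegree = k + l) : monicDivisorCount k f ≤ monicDivisorCount l f := by
  have key (g : {g : F[X] // (g.Monic ∧ g.natDegree = k) ∧ g ∣ f}) :
      ∃ e : {g : F[X] // (g.Monic ∧ g.natDegree = l) ∧ g ∣ f}, f = g.1 * e.1 := by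
    obtain ⟨g, ⟨hg, hk⟩, e, he⟩ := g
    have hem : e.Monic := hg.of_mul_monic_left (he ▸ hf)
    refine ⟨⟨e, ⟨hem, ?_⟩, Dvd.intro_left g he.symm⟩, he⟩
    have := hg.natDegree_mul hem
    rw [← he] at this
    omega
  choose φ hφ using key
  refine Nat.card_le_card_of_injective φ fun a b hab => Subtype.ext ?_
  have hmul := (hφ a).symm.trans (hφ b)
  rw [hab] at hmul
  exact mul_right_cancel₀ (φ b).2.1.1.ne_zero hmul

lemma monicDivisorCount_symm [Finite F] {f : F[X]} (hf : f.Monic) {k l : ℕ}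
    (h : f.natDegree = k + l) : monicDivisorCount k f = monicDivisorCount l f :=
  (monicDivisorCount_add_le hf h).antisymm (monicDivisorCount_add_le hf (by omega))

lemma card_dvd_add_degreeLT {g : F[X]} (hg : g.Monic) {h : ℕ} (hgh : g.natDegree ≤ h)
    (p : F[X]) :
    Nat.card {r : degreeLT F h // g ∣ p + (r : F[X])} = Nat.card F ^ (h - g.natDegree) := by
  have hdeg : g.degree = g.natDegree := degree_eq_natDegree hg.ne_zero
  have hmod : (p %ₘ g).degree < h :=
    (degree_modByMonic_lt p hg).trans_le (by rw [hdeg]; exact_mod_cast hgh)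
  have hmul (e : degreeLT F (h - g.natDegree)) : (g * (e : F[X])).degree < h := by
    rcases eq_or_ne (e : F[X]) 0 with he | he
    · simp [he]
    · have h1 := mem_degreeLT.1 e.2
      rw [degree_mul, hdeg]
      rw [degree_eq_natDegree he] at h1 ⊢
      norm_cast at h1 ⊢
      omega
  have hdvd (e : F[X]) : p + (g * e - p %ₘ g) = g * (p /ₘ g + e) := by
    linear_combination (-1 : F[X]) * modByMonic_add_div p g
  rw [← card_degreeLT]
  symm
  refine Nat.card_eq_of_bijective
    (fun e => ⟨⟨g * e - p %ₘ g,
      mem_degreeLT.2 ((degree_sub_le _ _).trans_lt (max_lt (hmul e) hmod))⟩,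
      (hdvd e) ▸ dvd_mul_right _ _⟩) ⟨fun a b hab => ?_, ?_⟩
  · simp only [Subtype.mk.injEq, sub_left_inj] at hab
    exact Subtype.ext (mul_left_cancel₀ hg.ne_zero hab)
  · rintro ⟨⟨r, hr⟩, c, hc⟩
    have hr' := mem_degreeLT.1 hr
    simp only at hc
    have hce : g * (c - p /ₘ g) = r + p %ₘ g := by
      linear_combination (-1 : F[X]) * hc - modByMonic_add_div p g
    refine ⟨⟨c - p /ₘ g, mem_degreeLT.2 ?_⟩, ?_⟩
    · rcases eq_or_ne (c - p /ₘ g) 0 with he | he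
      · simp [he]
      · have h1 : (g * (c - p /ₘ g)).degree < h := by
          rw [hce]
          exact (degree_add_le _ _).trans_lt (max_lt hr' hmod)
        rw [degree_mul, hdeg] at h1
        rw [degree_eq_natDegree he] at h1 ⊢
        norm_cast at h1 ⊢
        omega
    · simp [hce]

lemma sum_monicDivisorCount_add [Fintype F] {k h : ℕ} (hkh : k ≤ h) (p : F[X]) :
    ∑ a : Fin h → F, monicDivisorCount k (p + ((degreeLTEquiv F h).symm a : F[X])) =
      Fintype.card F ^ h := by
  have := Fintype.ofFinite (degreeLT F h)
  have := Fintype.ofFinite {g : F[X] // g.Monic ∧ g.natDegree = k}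
  refine (Equiv.sum_comp (degreeLTEquiv F h).symm.toEquiv
    fun r : degreeLT F h => monicDivisorCount k (p + (r : F[X]))).trans ?_
  have hsub (r : degreeLT F h) : monicDivisorCount k (p + (r : F[X])) =
      Nat.card {g : {g : F[X] // g.Monic ∧ g.natDegree = k} // g.1 ∣ p + (r : F[X])} :=
    Nat.card_congr (Equiv.subtypeSubtypeEquivSubtypeInter _ fun g => g ∣ p + (r : F[X])).symm
  simp only [hsub]
  rw [← Nat.card_sigma, Nat.card_congr (β := Σ g : {g : F[X] // g.Monic ∧ g.natDegree = k},
    {r : degreeLT F h // g.1 ∣ p + (r : F[X])})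
    { toFun := fun x => ⟨x.2.1, x.1, x.2.2⟩
      invFun := fun x => ⟨x.2.1, x.1, x.2.2⟩
      left_inv := fun _ => rfl
      right_inv := fun _ => rfl }, Nat.card_sigma,
    Finset.sum_congr rfl (g := fun _ => Nat.card F ^ (h - k))
      (by rintro ⟨g, hg, rfl⟩ -; exact card_dvd_add_degreeLT hg hkh p)]
  rw [Finset.sum_const, Finset.card_univ, ← Nat.card_eq_fintype_card, card_monic_natDegree_eq,
    smul_eq_mul, ← pow_add, Nat.add_sub_cancel' hkh, Nat.card_eq_fintype_card]

/-- The sum of the divisor function over a short interval of monic polynomials. -/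
lemma sum_dd_add {n h : ℕ} [Fintype F] (hnh : n ≤ 2 * h) {p : F[X]}
    (hp : ∀ a, (p + ((degreeLTEquiv F h).symm a : F[X])).Monic)
    (hpn : ∀ a, (p + ((degreeLTEquiv F h).symm a : F[X])).natDegree = n) :
    ∑ a : Fin h → F, dd (p + ((degreeLTEquiv F h).symm a : F[X])) =
      (n + 1) * Fintype.card F ^ h := by
  simp only [fun a => dd_eq_sum_monicDivisorCount (hp a).ne_zero, hpn]
  rw [Finset.sum_comm, Finset.sum_congr rfl (g := fun _ => Fintype.card F ^ h)]
  · simp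
  · intro k hk
    rw [Finset.mem_range] at hk
    rcases le_total k h with hkh | hkh
    · exact sum_monicDivisorCount_add hkh p
    · rw [← sum_monicDivisorCount_add (show n - k ≤ h by omega) p]
      refine Finset.sum_congr rfl fun a _ => monicDivisorCount_symm (hp a) ?_
      rw [hpn]
      omega

lemma sum_dd_mon [Fintype F] (n : ℕ) :
    ∑ b : Fin n → F, dd (mon n b) = (n + 1) * Fintype.card F ^ n := by
  simp only [mon_eq_X_pow_add]
  refine sum_dd_add (by omega) (fun a => ?_) (fun a => ?_)
  · rw [← mon_eq_X_pow_add]; exact monic_mon n a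
  · rw [← mon_eq_X_pow_add]; exact natDegree_mon n a

lemma sum_dd_mon_add_mon [Fintype F] {n h : ℕ} (h1 : n ≤ 2 * h) (h2 : h < n) (b : Fin n → F) :
    ∑ a : Fin h → F, dd (mon n b + mon h a) = (n + 1) * Fintype.card F ^ h := by
  have hlt (a : Fin h → F) : (mon h a).degree < (mon n b).degree := by
    rw [degree_eq_natDegree (monic_mon h a).ne_zero, degree_eq_natDegree (monic_mon n b).ne_zero,
      natDegree_mon, natDegree_mon]
    exact_mod_cast h2
  have hsplit (a : Fin h → F) :
      mon n b + mon h a = mon n b + X ^ h + ((degreeLTEquiv F h).symm a : F[X]) := by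
    rw [mon_eq_X_pow_add h a, add_assoc]
  simp only [hsplit]
  refine sum_dd_add h1 (fun a => ?_) (fun a => ?_)
  · rw [← hsplit]; exact (monic_mon n b).add_of_left (hlt a)
  · rw [← hsplit, natDegree_add_eq_left_of_degree_lt (hlt a), natDegree_mon]

lemma sum_dd_mul_dd [Fintype F] {n h : ℕ} (h1 : n ≤ 2 * h) (h2 : h < n) :
    (∑ a : Fin h → F, ∑ b : Fin n → F, dd (mon n b) * dd (mon n b + mon h a)) =
      Fintype.card F ^ (n + h) * (n + 1) ^ 2 := by
  rw [Finset.sum_comm]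
  simp only [← Finset.mul_sum, sum_dd_mon_add_mon h1 h2]
  rw [← Finset.sum_mul, sum_dd_mon]
  ring

end

/-- Theorem 4.2 (last case): for `n < 2h` and `h < n`, for every odd prime power `q`,
`∑_{J ∈ M_h} E_d(J,n,q) = 0`; equivalently
`∑_{J ∈ M_h} ∑_{f ∈ Mₙ} d(f)d(f+J) = q^{n+h} (n+1)²`. -/
theorem divisor_sum_of_error_terms_vanishes (n h : ℕ) (h1 : n < 2 * h) (h2 : h < n)
    (F : Type) [Field F] [Fintype F] (hq : Odd (Fintype.card F)) :
    (∑ a : Fin h → F, Errd F n (mon h a)) = 0 ∧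
    (∑ a : Fin h → F, ∑ b : Fin n → F, dd (mon n b) * dd (mon n b + mon h a)) =
      Fintype.card F ^ (n + h) * (n + 1) ^ 2 := by
  have hsum := sum_dd_mul_dd (F := F) h1.le h2
  refine ⟨?_, hsum⟩
  have hq0 : (Fintype.card F : ℝ) ≠ 0 := Nat.cast_ne_zero.2 Fintype.card_ne_zero
  have hcast := congrArg (Nat.cast : ℕ → ℝ) hsum
  push_cast at hcast
  simp only [Errd, Finset.sum_sub_distrib]
  rw [← Finset.mul_sum, hcast]
  simp only [Finset.sum_const, Finset.card_univ, Fintype.card_fun, Fintype.card_fin,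
    nsmul_eq_mul, Nat.cast_pow]
  field_simp
  ring
end

section
/- Fix an integer n ≥ 2. There exists a constant C = C(n) > 0 such that for every odd prime power q and every nonzero polynomial K ∈ 𝔽_q[T] with deg K < n, |q^{−n} ∑_{f ∈ M_n} Λ(f)Λ(f+K) − 1| ≤ C·q^{−1/2}. -/
open Polynomial

open Classical in
/-- The polynomial von Mangoldt function: `Λ(f) = deg P` if `f = P^k` for a monic
irreducible polynomial `P` and integer `k ≥ 1`, and `Λ(f) = 0` otherwise. -/
noncomputable def Lam {F : Type} [Field F] (f : F[X]) : ℝ :=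
  if h : ∃ P : F[X], P.Monic ∧ Irreducible P ∧ ∃ k : ℕ, 1 ≤ k ∧ f = P ^ k
  then (h.choose.natDegree : ℝ) else 0

section Stepanov

variable {F : Type*} [Field F]

/-- If `X ^ q` divides `r + s f ^ ((q - 1) / 2)` with `r, s` of small degree, then `r = s = 0`,
unless `f` is a constant times a square. -/
lemma eq_zero_of_X_pow_card_dvd [Fintype F] {f r s : F[X]} {Q D : ℕ}
    (hQ : 2 * Q + 1 = Fintype.card F) (hf0 : f.eval 0 ≠ 0)
    (hf : ¬ ∃ (c : F) (S : F[X]), f = C c * S ^ 2)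
    (hD : f.natDegree + 2 * D ≤ Fintype.card F + 1)
    (hr : r.degree < D) (hs : s.degree < D)
    (h : X ^ Fintype.card F ∣ r + s * f ^ Q) : r = 0 ∧ s = 0 := by
  set q := Fintype.card F with hq
  have hfne : f ≠ 0 := by rintro rfl; simp at hf0
  have h1 : (X : F[X]) ^ q ∣ f ^ q - C (f.eval 0) := by
    have : (X : F[X]) ∣ f - C (f.eval 0) := by
      rw [X_dvd_iff]; simp [coeff_zero_eq_eval_zero]
    obtain ⟨w, hw⟩ := this
    have h2 := congrArg (expand F q) hw
    rw [map_sub, FiniteField.expand_card, expand_C, map_mul, expand_X] at h2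
    exact ⟨_, h2⟩
  have h2 : (X : F[X]) ^ q ∣ f * r ^ 2 - C (f.eval 0) * s ^ 2 := by
    have e : f * r ^ 2 - C (f.eval 0) * s ^ 2
        = (r + s * f ^ Q) * (f * (r - s * f ^ Q)) + (f ^ q - C (f.eval 0)) * s ^ 2 := by
      rw [← hQ]; ring
    rw [e]
    exact dvd_add (h.mul_right _) (h1.mul_right _)
  have hdeg : ∀ p : F[X], p.degree < D → (f * p ^ 2).degree < q := by
    intro p hp
    by_cases hp0 : p = 0
    · simp [hp0]
    rw [degree_lt_iff_coeff_zero] at hp ⊢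
    have hpn : p.natDegree < D := by
      by_contra hcon
      exact hp0 (leadingCoeff_eq_zero.1 (hp _ (not_lt.1 hcon)))
    intro k hk
    apply coeff_eq_zero_of_natDegree_lt
    have := natDegree_mul_le (p := f) (q := p ^ 2)
    have := natDegree_pow_le (p := p) (n := 2)
    omega
  have hdeg' : (C (f.eval 0) * s ^ 2).degree < q := by
    refine lt_of_le_of_lt ?_ (hdeg s hs)
    rw [degree_mul, degree_mul, degree_C hf0]
    gcongr
    exact zero_le_degree_iff.2 hfne
  have h3 : f * r ^ 2 = C (f.eval 0) * s ^ 2 := by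
    have h4 : f * r ^ 2 - C (f.eval 0) * s ^ 2 = 0 := by
      apply eq_zero_of_dvd_of_degree_lt h2
      rw [degree_X_pow]
      exact (degree_sub_le _ _).trans_lt (max_lt (hdeg r hr) hdeg')
    exact sub_eq_zero.1 h4
  by_cases hr0 : r = 0
  · refine ⟨hr0, ?_⟩
    rw [hr0] at h3
    simpa [hf0] using h3
  exfalso
  have hu : IsUnit (C (f.eval 0)) := isUnit_C.2 (isUnit_iff_ne_zero.2 hf0)
  have h5 : r ^ 2 ∣ s ^ 2 := by
    rw [← hu.dvd_mul_left, ← h3]; exact dvd_mul_left _ _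
  obtain ⟨w, rfl⟩ := (IsIntegrallyClosed.pow_dvd_pow_iff two_ne_zero).1 h5
  refine hf ⟨f.eval 0, w, ?_⟩
  have : r ^ 2 ≠ 0 := pow_ne_zero _ hr0
  apply mul_right_cancel₀ this
  rw [h3]; ring

lemma eq_zero_of_sum_eq_zero [Fintype F] {f : F[X]} {Q D : ℕ}
    (hQ : 2 * Q + 1 = Fintype.card F) (hf0 : f.eval 0 ≠ 0)
    (hf : ¬ ∃ (c : F) (S : F[X]), f = C c * S ^ 2)
    (hD : f.natDegree + 2 * D ≤ Fintype.card F + 1) (J : ℕ) :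
    ∀ (r s : ℕ → F[X]), (∀ j, (r j).degree < D) → (∀ j, (s j).degree < D) →
      ∑ j ∈ Finset.range J, (r j + s j * f ^ Q) * X ^ (j * Fintype.card F) = 0 →
      ∀ j < J, r j = 0 ∧ s j = 0 := by
  induction J with
  | zero => intro r s _ _ _ j hj; omega
  | succ J ih =>
    intro r s hr hs h
    rw [Finset.sum_range_succ'] at h
    have e : ∑ j ∈ Finset.range J, (r (j + 1) + s (j + 1) * f ^ Q) *
          X ^ ((j + 1) * Fintype.card F)
        = X ^ Fintype.card F * ∑ j ∈ Finset.range J, (r (j + 1) + s (j + 1) * f ^ Q) *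
          X ^ (j * Fintype.card F) := by
      rw [Finset.mul_sum]; refine Finset.sum_congr rfl fun j _ => ?_; ring
    rw [e] at h
    have h0 : r 0 = 0 ∧ s 0 = 0 := by
      refine eq_zero_of_X_pow_card_dvd hQ hf0 hf hD (hr 0) (hs 0) ?_
      refine ⟨-∑ j ∈ Finset.range J, (r (j + 1) + s (j + 1) * f ^ Q) *
          X ^ (j * Fintype.card F), ?_⟩
      simp only [zero_mul, pow_zero, mul_one] at h
      linear_combination h
    rw [h0.1, h0.2] at h
    simp only [zero_mul, add_zero, mul_eq_zero, pow_eq_zero_iff', X_ne_zero, false_and,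
      false_or] at h
    intro j hj
    cases j with
    | zero => exact h0
    | succ j =>
      exact ih (fun j => r (j + 1)) (fun j => s (j + 1)) (fun j => hr _) (fun j => hs _) h j
        (by omega)

/-- The Hasse derivatives of a power `f ^ N` are divisible by high powers of `f`. -/
lemma exists_hasseDeriv_pow (f : F[X]) (N k : ℕ) (hk : k ≤ N) :
    ∃ c : F[X], hasseDeriv k (f ^ N) = f ^ (N - k) * c ∧ c.natDegree ≤ k * f.natDegree := by
  by_cases hf : f = 0
  · subst hf
    by_cases hN : N = 0
    · subst hN; obtain rfl : k = 0 := by omega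
      exact ⟨1, by simp⟩
    · exact ⟨0, by simp [hN]⟩
  have hdvd : ∀ N k, k ≤ N → f ^ (N - k) ∣ hasseDeriv k (f ^ N) := by
    intro N
    induction N with
    | zero => intro k hk; simp
    | succ N ih =>
      intro k hk
      rw [pow_succ, hasseDeriv_mul]
      refine Finset.dvd_sum fun ij hij => ?_
      rw [Finset.HasAntidiagonal.mem_antidiagonal] at hij
      by_cases h0 : ij.2 = 0
      · rw [h0, hasseDeriv_zero']
        by_cases h1 : ij.1 ≤ N
        · have e : N + 1 - k = N - ij.1 + 1 := by omega
          rw [e, pow_succ]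
          exact mul_dvd_mul (ih ij.1 h1) dvd_rfl
        · have : N + 1 - k = 0 := by omega
          rw [this]; simp
      · refine (pow_dvd_pow f ?_).trans ((ih ij.1 (by omega)).mul_right _)
        omega
  obtain ⟨c, hc⟩ := hdvd N k hk
  refine ⟨c, hc, ?_⟩
  by_cases hc0 : c = 0
  · simp [hc0]
  have h1 := congrArg natDegree hc
  rw [natDegree_mul (pow_ne_zero _ hf) hc0, natDegree_pow] at h1
  have h2 := natDegree_hasseDeriv_le (f ^ N) k
  rw [natDegree_pow] at h2
  obtain ⟨e, rfl⟩ := Nat.exists_eq_add_of_le hk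
  rw [Nat.add_sub_cancel_left] at h1
  have : (k + e) * f.natDegree = k * f.natDegree + e * f.natDegree := by ring
  omega

/-- The Hasse derivative of `f ^ N * h` is `f ^ (N - k)` times a linear operator applied to `h`. -/
lemma exists_hasseDeriv_pow_mul (f : F[X]) (N k : ℕ) (hk : k ≤ N) :
    ∃ L : F[X] →ₗ[F] F[X], (∀ h, hasseDeriv k (f ^ N * h) = f ^ (N - k) * L h) ∧
      ∀ h, (L h).natDegree ≤ h.natDegree + k * f.natDegree := by
  choose! c hc hcd using exists_hasseDeriv_pow f N
  refine ⟨∑ ij ∈ Finset.HasAntidiagonal.antidiagonal k,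
    (LinearMap.mulLeft F (c ij.1 * f ^ ij.2)).comp (hasseDeriv ij.2), fun h => ?_, fun h => ?_⟩
  · rw [hasseDeriv_mul, LinearMap.sum_apply, Finset.mul_sum]
    refine Finset.sum_congr rfl fun ij hij => ?_
    rw [Finset.HasAntidiagonal.mem_antidiagonal] at hij
    rw [hc ij.1 (by omega), LinearMap.comp_apply, LinearMap.mulLeft_apply]
    have : N - ij.1 = N - k + ij.2 := by omega
    rw [this]; ring
  · rw [LinearMap.sum_apply]
    refine natDegree_sum_le_of_forall_le _ _ fun ij hij => ?_
    rw [Finset.HasAntidiagonal.mem_antidiagonal] at hij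
    rw [LinearMap.comp_apply, LinearMap.mulLeft_apply]
    have h1 := natDegree_mul_le (p := c ij.1 * f ^ ij.2) (q := hasseDeriv ij.2 h)
    have h2 := natDegree_mul_le (p := c ij.1) (q := f ^ ij.2)
    have h3 := natDegree_pow_le (p := f) (n := ij.2)
    have h4 := hcd ij.1 (by omega)
    have h5 := natDegree_hasseDeriv_le h ij.2
    have h6 : k * f.natDegree = ij.1 * f.natDegree + ij.2 * f.natDegree := by rw [← hij]; ring
    omega

end Stepanov

section Stepanov

variable {F : Type*} [Field F]

/-- The linear system at the heart of Stepanov's method has a nontrivial solution. -/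
lemma exists_stepanov_system {M D J l : ℕ} (L L' : ℕ → F[X] →ₗ[F] F[X])
    (hL : ∀ k < l, ∀ h, (L k h).natDegree ≤ h.natDegree + k * M)
    (hL' : ∀ k < l, ∀ h, (L' k h).natDegree ≤ h.natDegree + k * M)
    (hlt : l * (D + l * M + J) < 2 * (J * D)) :
    ∃ r s : ℕ → F[X], (∀ j, (r j).degree < D) ∧ (∀ j, (s j).degree < D) ∧
      (∃ j < J, r j ≠ 0 ∨ s j ≠ 0) ∧
      ∀ k < l, ∑ j ∈ Finset.range J, (L k (r j) + L' k (s j)) * X ^ j = 0 := by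
  set B := D + l * M + J with hB
  let V := (Fin J → degreeLT F D) × (Fin J → degreeLT F D)
  let E : ℕ → V →ₗ[F] F[X] := fun k => ∑ j : Fin J,
    (LinearMap.mulRight F (X ^ (j : ℕ))).comp
      ((L k).comp ((degreeLT F D).subtype.comp ((LinearMap.proj j).comp (LinearMap.fst F _ _))) +
       (L' k).comp ((degreeLT F D).subtype.comp ((LinearMap.proj j).comp (LinearMap.snd F _ _))))
  have hE : ∀ k v, E k v = ∑ j : Fin J, (L k (v.1 j) + L' k (v.2 j)) * X ^ (j : ℕ) := by
    intro k v
    simp only [E, LinearMap.sum_apply]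
    rfl
  have hDn : ∀ p : degreeLT F D, (p : F[X]) ≠ 0 → (p : F[X]).natDegree < D := by
    intro p hp
    exact (natDegree_lt_iff_degree_lt hp).2 (mem_degreeLT.1 p.2)
  have hmem : ∀ k < l, ∀ v, E k v ∈ degreeLT F B := by
    intro k hk v
    rw [hE]
    refine Submodule.sum_mem _ fun j _ => ?_
    rw [mem_degreeLT]
    have hkM : k * M ≤ l * M := by gcongr
    have key : ∀ (T : F[X] →ₗ[F] F[X]), (∀ h, (T h).natDegree ≤ h.natDegree + k * M) →
        ∀ p : degreeLT F D, (T p * X ^ (j : ℕ)).degree < (B : WithBot ℕ) := by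
      intro T hT p
      by_cases hp : (p : F[X]) = 0
      · simp [hp]
      by_cases hT0 : T p * X ^ (j : ℕ) = 0
      · rw [hT0]; simp
      rw [← natDegree_lt_iff_degree_lt hT0]
      have h1 := hT p
      have h2 := hDn p hp
      have h3 := natDegree_mul_le (p := T p) (q := X ^ (j : ℕ))
      rw [natDegree_X_pow] at h3
      have := j.2
      omega
    rw [add_mul]
    exact (degree_add_le _ _).trans_lt (max_lt (key _ (hL k hk) _) (key _ (hL' k hk) _))
  let φ : V →ₗ[F] (Fin l → degreeLT F B) :=
    LinearMap.pi fun k => (E k).codRestrict (degreeLT F B) (hmem k k.2)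
  have : FiniteDimensional F (degreeLT F D) := (degreeLTEquiv F D).symm.finiteDimensional
  have : FiniteDimensional F (degreeLT F B) := (degreeLTEquiv F B).symm.finiteDimensional
  have hfr : Module.finrank F (Fin l → degreeLT F B) < Module.finrank F V := by
    rw [Module.finrank_prod, Module.finrank_pi_fintype, Module.finrank_pi_fintype,
      (degreeLTEquiv F D).finrank_eq, (degreeLTEquiv F B).finrank_eq]
    simp only [Module.finrank_fin_fun, Finset.sum_const, Finset.card_univ, Fintype.card_fin,
      smul_eq_mul]
    omega
  obtain ⟨v, hv, hv0⟩ := (Submodule.ne_bot_iff _).1 (LinearMap.ker_ne_bot_of_finrank_lt (f := φ) hfr)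
  have hφ : ∀ k < l, E k v = 0 := by
    intro k hk
    have := congrFun (LinearMap.mem_ker.1 hv) ⟨k, hk⟩
    have h2 : E k v = ((0 : degreeLT F B) : F[X]) := congrArg Subtype.val this
    simpa using h2
  refine ⟨fun j => if h : j < J then v.1 ⟨j, h⟩ else 0, fun j => if h : j < J then v.2 ⟨j, h⟩ else 0,
    fun j => ?_, fun j => ?_, ?_, fun k hk => ?_⟩
  · dsimp only
    split_ifs
    · exact mem_degreeLT.1 (Subtype.prop _)
    · simp
  · dsimp only
    split_ifs
    · exact mem_degreeLT.1 (Subtype.prop _)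
    · simp
  · by_contra! hcon
    apply hv0
    refine Prod.ext (funext fun j => Subtype.ext ?_) (funext fun j => Subtype.ext ?_)
    · simpa using (hcon j j.2).1
    · simpa using (hcon j j.2).2
  · rw [Finset.sum_range, ← hφ k hk, hE]
    simp

open Classical in
lemma stepanov_count [Fintype F] {f : F[X]} {M Q D J l : ℕ}
    (hQ : 2 * Q + 1 = Fintype.card F) (hf0 : f.eval 0 ≠ 0) (hM : f.natDegree ≤ M)
    (hf : ¬ ∃ (c : F) (S : F[X]), f = C c * S ^ 2)
    (hD : M + 2 * D ≤ Fintype.card F + 1)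
    (hl : l ≤ Fintype.card F) (hlt : l * (D + l * M + J) < 2 * (J * D)) (a : F) :
    l * (Finset.univ.filter fun x : F => f.eval x = 0 ∨ f.eval x ^ Q = a).card ≤
      l * M + D + Q * M + J * Fintype.card F := by
  set q := Fintype.card F with hq
  choose! L hL hLd using exists_hasseDeriv_pow_mul f
  have hLM : ∀ N k, k ≤ N → ∀ h, (L N k h).natDegree ≤ h.natDegree + k * M := by
    intro N k hk h
    refine (hLd N k hk h).trans ?_
    gcongr
  obtain ⟨r, s, hr, hs, hne, hE⟩ := exists_stepanov_system (M := M) (D := D) (J := J) (l := l)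
    (fun k => L l k) (fun k => a • L (l + Q) k) (fun k hk => hLM l k hk.le)
    (fun k hk h => (natDegree_smul_le _ _).trans (hLM (l + Q) k (by omega) h)) hlt
  set G0 := ∑ j ∈ Finset.range J, (r j + s j * f ^ Q) * X ^ (j * q) with hG0
  have hG0ne : G0 ≠ 0 := by
    intro h0
    obtain ⟨j, hj, hj'⟩ := hne
    have := eq_zero_of_sum_eq_zero hQ hf0 hf (by omega) J r s hr hs h0 j hj
    tauto
  have hfne : f ≠ 0 := by rintro rfl; simp at hf0
  set G := f ^ l * G0 with hG
  have hGne : G ≠ 0 := mul_ne_zero (pow_ne_zero _ hfne) hG0ne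
  set T := Finset.univ.filter fun x : F => f.eval x = 0 ∨ f.eval x ^ Q = a with hT
  have hdvd : ∀ x ∈ T, (X - C x) ^ l ∣ G := by
    intro x hx
    rw [X_sub_C_pow_dvd_iff, ← taylor_apply, X_pow_dvd_iff]
    intro k hk
    have hpow : ∀ j, taylor x (X ^ (j * q)) = (X ^ q + C x) ^ j := by
      intro j
      rw [taylor_X_pow, mul_comm, pow_mul, hq, ← FiniteField.expand_card, map_add, expand_X,
        expand_C]
    have hdv : ∀ j, (X : F[X]) ^ q ∣ (X ^ q + C x) ^ j - C (x ^ j) := by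
      intro j
      rw [C_pow]
      refine dvd_trans ?_ (sub_dvd_pow_sub_pow _ _ j)
      simp
    have hcoeff : ∀ (A : F[X]) j, (taylor x (A * X ^ (j * q))).coeff k
        = (hasseDeriv k A).eval x * x ^ j := by
      intro A j
      obtain ⟨w, hw⟩ := hdv j
      rw [taylor_mul, hpow, eq_add_of_sub_eq hw, mul_add, coeff_add, coeff_mul_C, taylor_coeff]
      have : (taylor x A * (X ^ q * w)).coeff k = 0 := by
        rw [mul_left_comm, coeff_X_pow_mul', if_neg (by omega)]
      rw [this, zero_add]
    have hGs : G = ∑ j ∈ Finset.range J,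
        (f ^ l * r j * X ^ (j * q) + f ^ (l + Q) * s j * X ^ (j * q)) := by
      rw [hG, hG0, Finset.mul_sum]
      refine Finset.sum_congr rfl fun j _ => ?_
      ring
    have hval : (taylor x G).coeff k = (f.eval x) ^ (l - k) * ∑ j ∈ Finset.range J,
        ((L l k (r j)).eval x + f.eval x ^ Q * (L (l + Q) k (s j)).eval x) * x ^ j := by
      rw [hGs, map_sum, finsetSum_coeff, Finset.mul_sum]
      refine Finset.sum_congr rfl fun j _ => ?_
      rw [map_add, coeff_add, hcoeff, hcoeff, hL l k hk.le, hL (l + Q) k (by omega)]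
      have : l + Q - k = l - k + Q := by omega
      rw [this]
      simp only [eval_mul, eval_pow]
      ring
    rw [hval]
    rcases (Finset.mem_filter.1 hx).2 with h0 | h1
    · rw [h0, zero_pow (by omega), zero_mul]
    · have h2 := congrArg (eval x) (hE k hk)
      rw [h1]
      simp only [eval_finsetSum, eval_mul, eval_add, eval_pow, eval_X, LinearMap.smul_apply,
        eval_smul, smul_eq_mul, eval_zero] at h2
      rw [h2, mul_zero]
  have hprod : ∏ x ∈ T, (X - C x) ^ l ∣ G := by
    refine Finset.prod_dvd_of_coprime ?_ hdvd
    intro x _ y _ hxy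
    exact (pairwise_coprime_X_sub_C Function.injective_id hxy).pow
  have h1 := natDegree_le_of_dvd hprod hGne
  rw [natDegree_prod _ _ (fun x _ => pow_ne_zero _ (X_sub_C_ne_zero x))] at h1
  simp only [natDegree_pow, natDegree_X_sub_C, mul_one, Finset.sum_const, smul_eq_mul] at h1
  rw [mul_comm]
  refine h1.trans ?_
  have hdeg : ∀ p : F[X], p.degree < D → p.natDegree ≤ D := by
    intro p hp
    exact natDegree_le_of_degree_le hp.le
  have h2 : G0.natDegree ≤ D + Q * M + J * q := by
    refine natDegree_sum_le_of_forall_le _ _ fun j hj => ?_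
    rw [Finset.mem_range] at hj
    have h3 := natDegree_mul_le (p := r j + s j * f ^ Q) (q := X ^ (j * q))
    rw [natDegree_X_pow] at h3
    have h4 := natDegree_add_le (r j) (s j * f ^ Q)
    have h5 := natDegree_mul_le (p := s j) (q := f ^ Q)
    have h6 := natDegree_pow_le (p := f) (n := Q)
    have h7 := hdeg _ (hr j)
    have h8 := hdeg _ (hs j)
    have h9 : Q * f.natDegree ≤ Q * M := by gcongr
    have h10 : j * q ≤ J * q := by gcongr
    have h11 := max_le (a := (r j).natDegree) (b := (s j * f ^ Q).natDegree) (c := D + Q * M)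
      (by omega) (by omega)
    omega
  have h3 := natDegree_mul_le (p := f ^ l) (q := G0)
  rw [← hG] at h3
  have h4 := natDegree_pow_le (p := f) (n := l)
  have h5 : l * f.natDegree ≤ l * M := by gcongr
  omega

end Stepanov

section QuadraticCharacter

variable {F : Type} [Field F] [Fintype F]

open Classical in
/-- The quadratic character of a finite field with real values. -/
noncomputable def qchi (x : F) : ℝ := (quadraticChar F x : ℤ)

lemma qchi_zero : qchi (0 : F) = 0 := by simp [qchi]

lemma qchi_one : qchi (1 : F) = 1 := by simp [qchi]

lemma qchi_mul (x y : F) : qchi (x * y) = qchi x * qchi y := by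
  classical
  unfold qchi
  rw [map_mul, Int.cast_mul]

lemma qchi_pow (x : F) (k : ℕ) : qchi (x ^ k) = qchi x ^ k := by
  classical
  unfold qchi
  rw [map_pow, Int.cast_pow]

lemma qchi_sq {x : F} (hx : x ≠ 0) : qchi x ^ 2 = 1 := by
  classical
  unfold qchi
  exact_mod_cast quadraticChar_sq_one hx

lemma abs_qchi {x : F} (hx : x ≠ 0) : |qchi x| = 1 := by
  rw [← abs_one, ← sq_eq_sq_iff_abs_eq_abs, one_pow, qchi_sq hx]

lemma abs_qchi_le (x : F) : |qchi x| ≤ 1 := by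
  by_cases hx : x = 0
  · simp [hx, qchi_zero]
  · exact (abs_qchi hx).le

lemma qchi_eq_zero_iff (x : F) : qchi x = 0 ↔ x = 0 := by
  classical
  unfold qchi
  rw [Int.cast_eq_zero, quadraticChar_eq_zero_iff]

lemma qchi_eq (hodd : Odd (Fintype.card F)) {x : F} (hx : x ≠ 0) :
    (x ^ (Fintype.card F / 2) = 1 ∧ qchi x = 1) ∨
      (x ^ (Fintype.card F / 2) = -1 ∧ qchi x = -1) := by
  classical
  have hc : ringChar F ≠ 2 := by
    intro h
    have h1 := FiniteField.even_card_iff_char_two.1 h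
    have := Nat.odd_iff.1 hodd
    omega
  unfold qchi
  have h1 := quadraticChar_eq_pow_of_char_ne_two' hc x
  rcases quadraticChar_dichotomy hx with h | h <;> rw [h] at h1 ⊢ <;> simp [← h1]


lemma stepanov_parameters {q u M D : ℕ} (hu1 : u * u ≤ q) (hu3 : 8 * (M + 1) ≤ u)
    (hD2 : q ≤ M + 2 * D + 1) :
    2 * u * (D + 2 * u * M + (u + 8 * (M + 1))) < 2 * ((u + 8 * (M + 1)) * D) := by
  have h1 : 8 * (M + 1) * u ≤ q := (Nat.mul_le_mul_right u hu3).trans hu1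
  have h2 : u * u * M ≤ q * M := Nat.mul_le_mul_right M hu1
  have h3 : 8 * (M + 1) * q ≤ 8 * (M + 1) * (M + 1) + 16 * ((M + 1) * D) := by
    calc 8 * (M + 1) * q ≤ 8 * (M + 1) * (M + 2 * D + 1) := Nat.mul_le_mul_left _ hD2
      _ = _ := by ring
  have h4 : 8 * (M + 1) * (M + 1) ≤ q := by
    refine le_trans ?_ h1
    exact Nat.mul_le_mul_left _ (by omega)
  have h5 : 0 < q := lt_of_lt_of_le (by positivity) h4
  nlinarith

lemma stepanov_bound {q u M D Q s : ℕ} (hQ : q = 2 * Q + 1)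
    (hu2 : q ≤ u * u + 2 * u) (hu3 : 8 * (M + 1) ≤ u) (hD1 : M + 2 * D ≤ q)
    (h : 2 * u * s ≤ 2 * u * M + D + Q * M + (u + 8 * (M + 1)) * q) :
    2 * s ≤ q + 20 * (M + 1) * u := by
  have e1 : 2 * (Q * M) ≤ q * M := by rw [hQ]; nlinarith
  have h1 : 4 * u * s ≤ 2 * u * q + 4 * u * M + 17 * (M + 1) * q := by nlinarith
  have h2 : 17 * (M + 1) * q ≤ 22 * (M + 1) * (u * u) := by
    have : 17 * q ≤ 22 * (u * u) := by nlinarith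
    calc 17 * (M + 1) * q = (M + 1) * (17 * q) := by ring
      _ ≤ (M + 1) * (22 * (u * u)) := Nat.mul_le_mul_left _ this
      _ = _ := by ring
  have h3 : 2 * u * (2 * s) ≤ 2 * u * (q + 2 * M + 11 * (M + 1) * u) := by nlinarith
  have h4 := Nat.le_of_mul_le_mul_left h3 (by omega)
  have h5 : 2 * M ≤ 9 * (M + 1) * u := by nlinarith
  nlinarith

open Classical in
lemma abs_sum_qchi_eval_le_of_large (hodd : Odd (Fintype.card F)) {f : F[X]} {M : ℕ}
    (hf0 : f.eval 0 ≠ 0) (hM : f.natDegree ≤ M)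
    (hf : ¬ ∃ (c : F) (S : F[X]), f = C c * S ^ 2)
    (hq : 64 * (M + 1) ^ 2 ≤ Fintype.card F) :
    |∑ t, qchi (f.eval t)| ≤ 20 * (M + 1) * √(Fintype.card F) := by
  set q := Fintype.card F with hqd
  obtain ⟨Q, hQ⟩ := hodd
  have hQ2 : q / 2 = Q := by omega
  set u := Nat.sqrt q with hu
  have hu1 : u * u ≤ q := Nat.sqrt_le q
  have hu2 : q ≤ u * u + 2 * u := by have := Nat.sqrt_le_add q; rw [← hu] at this; omega
  have hu3 : 8 * (M + 1) ≤ u := by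
    rw [hu, Nat.le_sqrt]
    calc _ = 64 * (M + 1) ^ 2 := by ring
      _ ≤ q := hq
  have hMq : M + 1 ≤ q := by nlinarith
  set D := (q - M) / 2 with hD
  have hD1 : M + 2 * D ≤ q := by omega
  have hD2 : q ≤ M + 2 * D + 1 := by omega
  have key : ∀ a : F,
      ∑ x : F, ((if f.eval x = 0 ∨ f.eval x ^ Q = a then 2 else 0) - 1 : ℝ) ≤
        20 * (M + 1) * √q := by
    intro a
    have h := stepanov_count (M := M) (Q := Q) (D := D) (J := u + 8 * (M + 1)) (l := 2 * u)
      hQ.symm hf0 hM hf (by omega) (by rw [← hqd]; nlinarith)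
      (stepanov_parameters hu1 hu3 hD2) a
    have h2 := stepanov_bound hQ hu2 hu3 hD1 h
    rw [Finset.sum_sub_distrib, ← Finset.sum_filter, Finset.sum_const, Finset.sum_const,
      Finset.card_univ, ← hqd, nsmul_eq_mul, nsmul_eq_mul]
    have h3 : (2 * (Finset.univ.filter fun x : F => f.eval x = 0 ∨ f.eval x ^ Q = a).card : ℝ)
      ≤ q + 20 * (M + 1) * u := by exact_mod_cast h2
    have h4 : (u : ℝ) ≤ √q := Real.nat_sqrt_le_real_sqrt
    have h5 : 20 * ((M : ℝ) + 1) * u ≤ 20 * (M + 1) * √q := by gcongr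
    linarith
  rw [abs_le']
  constructor
  · refine le_trans (Finset.sum_le_sum fun x _ => ?_) (key 1)
    by_cases h0 : f.eval x = 0
    · simp [h0, qchi_zero]
    · rcases qchi_eq ⟨Q, hQ⟩ h0 with ⟨h1, h2⟩ | ⟨h1, h2⟩
      all_goals rw [← hqd, hQ2] at h1
      · rw [h2, h1]; simp; norm_num
      · rw [h2]; split_ifs <;> norm_num
  · rw [← Finset.sum_neg_distrib]
    refine le_trans (Finset.sum_le_sum fun x _ => ?_) (key (-1))
    by_cases h0 : f.eval x = 0
    · simp [h0, qchi_zero]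
    · rcases qchi_eq ⟨Q, hQ⟩ h0 with ⟨h1, h2⟩ | ⟨h1, h2⟩
      all_goals rw [← hqd, hQ2] at h1
      · rw [h2]; split_ifs <;> norm_num
      · rw [h2, h1]; simp; norm_num

lemma abs_sum_qchi_le {ι : Type*} [Fintype ι] (f : ι → F) :
    |∑ t, qchi (f t)| ≤ Fintype.card ι := by
  refine (Finset.abs_sum_le_sum_abs _ _).trans ?_
  refine (Finset.sum_le_sum fun x _ => abs_qchi_le (f x)).trans ?_
  simp

/-- Weil's bound for quadratic character sums, with an explicit but crude constant. -/
theorem abs_sum_qchi_eval_le (hodd : Odd (Fintype.card F)) {f : F[X]} {M : ℕ}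
    (hM : f.natDegree ≤ M) (hf : ¬ ∃ (c : F) (S : F[X]), f = C c * S ^ 2) :
    |∑ t, qchi (f.eval t)| ≤ 20 * (M + 1) * √(Fintype.card F) := by
  by_cases hq : 64 * (M + 1) ^ 2 ≤ Fintype.card F
  · by_cases hx : ∃ x, f.eval x ≠ 0
    · obtain ⟨x, hx⟩ := hx
      have h := abs_sum_qchi_eval_le_of_large hodd (f := f.comp (X + C x)) (M := M)
        (by simpa using hx) (by rwa [natDegree_comp, natDegree_X_add_C, mul_one]) ?_ hq
      · refine le_of_eq_of_le (congrArg _ ?_) h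
        refine (Fintype.sum_equiv (Equiv.addRight x) _ _ fun t => ?_).symm
        simp
      · rintro ⟨c, S, h⟩
        refine hf ⟨c, S.comp (X - C x), ?_⟩
        have := congrArg (fun p => p.comp (X - C x)) h
        simpa [comp_assoc] using this
    · push Not at hx
      simp only [hx, qchi_zero, Finset.sum_const_zero, abs_zero]
      positivity
  · refine (abs_sum_qchi_le _).trans ?_
    set q := Fintype.card F
    have h1 : (q : ℝ) ≤ (8 * (M + 1)) ^ 2 := by
      have : q ≤ (8 * (M + 1)) ^ 2 := by linarith
      exact_mod_cast this
    have h2 : √(q : ℝ) ≤ 8 * (M + 1) := by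
      rw [Real.sqrt_le_left (by positivity)]; exact h1
    calc (q : ℝ) = √q * √q := (Real.mul_self_sqrt (by positivity)).symm
      _ ≤ 20 * (M + 1) * √q := by
        gcongr
        linarith [(Nat.cast_nonneg M : (0 : ℝ) ≤ M)]

end QuadraticCharacter

section FormalSquareRoot

/-- The coefficients of the formal square root of `1 + w 1 * X + w 2 * X ^ 2 + ...`, where
`half` is an inverse of `2`. -/
def sqrtCoeff {R : Type*} [CommRing R] (half : R) (w : ℕ → R) : ℕ → R
  | 0 => 1
  | k + 1 => half * (w (k + 1) - ∑ i : Fin k, sqrtCoeff half w (i + 1) * sqrtCoeff half w (k - i))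

variable {R S : Type*} [CommRing R] [CommRing S]

lemma map_sqrtCoeff (φ : R →+* S) (half : R) (w : ℕ → R) (k : ℕ) :
    φ (sqrtCoeff half w k) = sqrtCoeff (φ half) (fun n => φ (w n)) k := by
  induction k using Nat.strong_induction_on with
  | _ k ih =>
    cases k with
    | zero => simp [sqrtCoeff]
    | succ k =>
      rw [sqrtCoeff, sqrtCoeff, map_mul, map_sub, map_sum]
      congr 2
      refine Finset.sum_congr rfl fun i _ => ?_
      rw [map_mul, ih _ (by omega), ih _ (by omega)]

lemma sum_sqrtCoeff_mul {half : R} (hh : 2 * half = 1) (w : ℕ → R) (n : ℕ) :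
    ∑ ij ∈ Finset.HasAntidiagonal.antidiagonal n, sqrtCoeff half w ij.1 * sqrtCoeff half w ij.2
      = if n = 0 then 1 else w n := by
  cases n with
  | zero => simp [sqrtCoeff]
  | succ k =>
    rw [Finset.Nat.sum_antidiagonal_eq_sum_range_succ
      (fun i j => sqrtCoeff half w i * sqrtCoeff half w j), Finset.sum_range_succ,
      Finset.sum_range_succ', if_neg (by omega), Nat.sub_self, Nat.sub_zero]
    have h0 : sqrtCoeff half w 0 = 1 := by rw [sqrtCoeff]
    have h1 : ∑ i ∈ Finset.range k, sqrtCoeff half w (i + 1) * sqrtCoeff half w (k + 1 - (i + 1))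
        = ∑ i : Fin k, sqrtCoeff half w (i + 1) * sqrtCoeff half w (k - i) := by
      rw [Finset.sum_range]
      refine Finset.sum_congr rfl fun i _ => ?_
      rw [Nat.add_sub_add_right]
    rw [h1, h0, sqrtCoeff]
    linear_combination (w (k + 1) - ∑ i : Fin k, sqrtCoeff half w (i + 1) *
      sqrtCoeff half w (k - i)) * hh

lemma totalDegree_sqrtCoeff_le {σ : Type*} {half : R} {w : ℕ → MvPolynomial σ R} {B : ℕ}
    (hw : ∀ n ≠ 0, (w n).totalDegree ≤ n * B) (k : ℕ) :
    (sqrtCoeff (MvPolynomial.C half) w k).totalDegree ≤ k * B := by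
  induction k using Nat.strong_induction_on with
  | _ k ih =>
    cases k with
    | zero => simp [sqrtCoeff]
    | succ k =>
      rw [sqrtCoeff]
      refine (MvPolynomial.totalDegree_mul _ _).trans ?_
      rw [MvPolynomial.totalDegree_C, zero_add]
      refine (MvPolynomial.totalDegree_sub _ _).trans (max_le (hw _ (by omega)) ?_)
      refine MvPolynomial.totalDegree_finsetSum_le fun i _ => ?_
      refine (MvPolynomial.totalDegree_mul _ _).trans ?_
      refine (add_le_add (ih _ (by omega)) (ih _ (by omega))).trans ?_
      rw [← add_mul]
      exact Nat.mul_le_mul_right B (by omega)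

/-- The coefficients of `P (h X) / h`, where `h` is the constant coefficient of `P`. -/
noncomputable def normCoeff (P : R[X]) (n : ℕ) : R := P.coeff n * P.coeff 0 ^ (n - 1)

lemma normCoeff_map (φ : R →+* S) (P : R[X]) (n : ℕ) :
    normCoeff (P.map φ) n = φ (normCoeff P n) := by
  simp [normCoeff]

lemma coeff_comp_C_mul_X (P : R[X]) (n : ℕ) :
    (P.comp (C (P.coeff 0) * X)).coeff n = P.coeff 0 * if n = 0 then 1 else normCoeff P n := by
  rw [comp_C_mul_X_coeff]
  split_ifs with h
  · simp [h]
  · rw [normCoeff]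
    obtain ⟨m, rfl⟩ := Nat.exists_eq_succ_of_ne_zero h
    simp only [Nat.succ_eq_add_one, Nat.add_sub_cancel]
    ring

variable {F : Type*} [Field F]

lemma sqrtCoeff_eq_zero_of_square {P T : F[X]} {c half : F} {M k : ℕ} (hh : 2 * half = 1)
    (hP : P = C c * T ^ 2) (hM : P.natDegree ≤ M) (h0 : P.coeff 0 ≠ 0) (hk : M < 2 * k) :
    sqrtCoeff half (normCoeff P) k = 0 := by
  have hP0 : P.coeff 0 = c * T.coeff 0 ^ 2 := by
    rw [coeff_zero_eq_eval_zero, coeff_zero_eq_eval_zero, hP]; simp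
  have hT0 : T.coeff 0 ≠ 0 := by intro h; simp [hP0, h] at h0
  have hc : c ≠ 0 := by intro h; simp [hP0, h] at h0
  set Y : F[X] := C (T.coeff 0)⁻¹ * T.comp (C (P.coeff 0) * X) with hY
  have hYsq : C (P.coeff 0) * Y ^ 2 = P.comp (C (P.coeff 0) * X) := by
    have e : P.comp (C (P.coeff 0) * X) = C c * (T.comp (C (P.coeff 0) * X)) ^ 2 := by
      conv_lhs => rw [hP]
      rw [mul_comp, pow_comp, C_comp, ← hP]
    rw [e, hY, mul_pow, ← mul_assoc, ← C_pow, ← C_mul]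
    congr 2
    rw [hP0]; field_simp
  set z : PowerSeries F := PowerSeries.mk (sqrtCoeff half (normCoeff P)) with hz
  have hzY : z ^ 2 = (Y : PowerSeries F) ^ 2 := by
    ext n
    have e1 : PowerSeries.coeff n (z ^ 2) = if n = 0 then 1 else normCoeff P n := by
      rw [pow_two, PowerSeries.coeff_mul, ← sum_sqrtCoeff_mul hh (normCoeff P) n]
      simp [hz]
    have e2 : PowerSeries.coeff n ((Y : PowerSeries F) ^ 2) = (Y ^ 2).coeff n := by
      rw [← Polynomial.coe_pow, Polynomial.coeff_coe]
    rw [e1, e2]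
    have := congrArg (fun p => p.coeff n) hYsq
    simp only [coeff_C_mul, coeff_comp_C_mul_X] at this
    exact (mul_left_cancel₀ h0 this).symm
  have h2 : (2 : F) ≠ 0 := by rintro h; simp [h] at hh
  have hzY' : z = Y := by
    rcases sq_eq_sq_iff_eq_or_eq_neg.1 hzY with h | h
    · exact h
    · exfalso
      have := congrArg (PowerSeries.coeff 0) h
      rw [hz, PowerSeries.coeff_mk, map_neg, Polynomial.coeff_coe, hY, coeff_C_mul,
        comp_C_mul_X_coeff, sqrtCoeff] at this
      simp only [pow_zero, mul_one, inv_mul_cancel₀ hT0] at this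
      apply h2
      linear_combination this
  have := congrArg (PowerSeries.coeff k) hzY'
  rw [hz, PowerSeries.coeff_mk, Polynomial.coeff_coe, hY, coeff_C_mul, comp_C_mul_X_coeff] at this
  rw [this]
  have hd : T.coeff k = 0 := by
    apply coeff_eq_zero_of_natDegree_lt
    have : P.natDegree = 2 * T.natDegree := by rw [hP, natDegree_C_mul hc, natDegree_pow]
    omega
  rw [hd]; simp

lemma exists_sqrtCoeff_ne_zero {P : F[X]} {half : F} {M : ℕ} (hh : 2 * half = 1)
    (hM : P.natDegree ≤ M) (h0 : P.coeff 0 ≠ 0) {t : F} (ht : P.eval t = 0)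
    (ht' : P.derivative.eval t ≠ 0) :
    ∃ k ≤ M, M < 2 * k ∧ sqrtCoeff half (normCoeff P) k ≠ 0 := by
  by_contra! hcon
  set s : F[X] := ∑ k ∈ Finset.range (M / 2 + 1), C (sqrtCoeff half (normCoeff P) k) * X ^ k with hs
  have hsc : ∀ n, s.coeff n = if n < M / 2 + 1 then sqrtCoeff half (normCoeff P) n else 0 := by
    intro n
    simp [hs, coeff_X_pow]
  have hsc' : ∀ n ≤ M, s.coeff n = sqrtCoeff half (normCoeff P) n := by
    intro n hn
    rw [hsc]
    split_ifs with h
    · rfl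
    · exact (hcon n hn (by omega)).symm
  have hsd : s.natDegree ≤ M / 2 := by
    rw [natDegree_le_iff_coeff_eq_zero]
    intro n hn
    rw [hsc, if_neg (by omega)]
  have key : C (P.coeff 0) * s ^ 2 = P.comp (C (P.coeff 0) * X) := by
    ext n
    rw [coeff_C_mul]
    by_cases hn : n ≤ M
    · rw [coeff_comp_C_mul_X, ← sum_sqrtCoeff_mul hh, pow_two, coeff_mul]
      congr 1
      refine Finset.sum_congr rfl fun ij hij => ?_
      rw [Finset.HasAntidiagonal.mem_antidiagonal] at hij
      rw [hsc' _ (by omega), hsc' _ (by omega)]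
    · have := natDegree_pow_le (p := s) (n := 2)
      rw [comp_C_mul_X_coeff, coeff_eq_zero_of_natDegree_lt (p := P) (n := n) (by omega),
        coeff_eq_zero_of_natDegree_lt (p := s ^ 2) (by omega), mul_zero, zero_mul]
  have e1 := congrArg (eval (t / P.coeff 0)) key
  have e2 := congrArg (fun p => eval (t / P.coeff 0) (derivative p)) key
  have e3 : P.coeff 0 * (t / P.coeff 0) = t := by field_simp
  simp only [eval_mul, eval_C, eval_pow, eval_comp, eval_X, e3, ht] at e1
  have e4 : eval (t / P.coeff 0) s = 0 := by simpa [h0] using e1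
  simp [derivative_comp, derivative_pow, e3, e4, ht', h0] at e2

end FormalSquareRoot

section Counting

variable {F : Type} [Field F] [Fintype F] {τ : Type} [Fintype τ]

open Classical in
/-- The Schwartz–Zippel bound for the number of zeros of a polynomial over a finite field. -/
lemma card_zeros_mul_le {P : MvPolynomial τ F} {B : ℕ} (hP : P ≠ 0) (hB : P.totalDegree ≤ B) :
    (Finset.univ.filter fun a : τ → F => MvPolynomial.eval a P = 0).card * Fintype.card F ≤
      B * Fintype.card F ^ Fintype.card τ := by
  set n := Fintype.card τ with hn
  let e : τ ≃ Fin n := Fintype.equivFin τ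
  set P' := MvPolynomial.renameEquiv F e P with hP'
  have hne : P' ≠ 0 := by rwa [hP', EmbeddingLike.map_ne_zero_iff]
  have h := MvPolynomial.schwartz_zippel_totalDegree hne Finset.univ
  rw [Fintype.piFinset_univ, hP', MvPolynomial.totalDegree_renameEquiv, Finset.card_univ] at h
  have hcard : (Finset.univ.filter fun f : Fin n → F => MvPolynomial.eval f P' = 0).card
      = (Finset.univ.filter fun a : τ → F => MvPolynomial.eval a P = 0).card := by
    refine Finset.card_equiv (e.arrowCongr (Equiv.refl F)).symm fun f => ?_
    simp only [Finset.mem_filter, Finset.mem_univ, true_and]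
    rw [hP', MvPolynomial.renameEquiv_apply, MvPolynomial.eval_rename]
    rfl
  rw [← hP', hcard] at h
  set q := Fintype.card F
  have hq : (0 : ℚ≥0) < q := by exact_mod_cast Fintype.card_pos
  rw [div_le_div_iff₀ (by positivity) hq] at h
  have h' : (Finset.univ.filter fun a : τ → F => MvPolynomial.eval a P = 0).card * q ≤
    P.totalDegree * q ^ n := by exact_mod_cast h
  exact h'.trans (Nat.mul_le_mul_right _ hB)


open Classical in
lemma abs_sum_qchi_eval_map_le_of_coeff_zero (hodd : Odd (Fintype.card F))
    {H : (MvPolynomial τ F)[X]}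
    {M B : ℕ} (hM : H.natDegree ≤ M) (hB : ∀ i, (H.coeff i).totalDegree ≤ B)
    {E : Type*} [Field E] [Algebra F E] (a₀ : τ → E) (t₀ : E)
    (h0 : (H.map (MvPolynomial.aeval a₀).toRingHom).coeff 0 ≠ 0)
    (hroot : (H.map (MvPolynomial.aeval a₀).toRingHom).eval t₀ = 0)
    (hsimple : (H.map (MvPolynomial.aeval a₀).toRingHom).derivative.eval t₀ ≠ 0) :
    |∑ a : τ → F, ∑ t : F, qchi ((H.map (MvPolynomial.eval a)).eval t)| ≤
      (M + 1) * (20 + B) * Fintype.card F ^ Fintype.card τ * √(Fintype.card F) := by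
  set q := Fintype.card F with hq
  have hq1 : (1 : ℝ) ≤ √q := by
    rw [Real.one_le_sqrt]
    exact_mod_cast Fintype.card_pos
  have h2 : (2 : F) ≠ 0 := by
    refine Ring.two_ne_zero fun h => ?_
    have h1 := FiniteField.even_card_iff_char_two.1 h
    have := Nat.odd_iff.1 hodd
    omega
  have hhalf : 2 * (2 : F)⁻¹ = 1 := mul_inv_cancel₀ h2
  have hhalfE : 2 * (algebraMap F E 2⁻¹) = 1 := by
    rw [← map_ofNat (algebraMap F E) 2, ← map_mul, hhalf, map_one]
  obtain ⟨k, hkM, hMk, hk⟩ := exists_sqrtCoeff_ne_zero hhalfE (natDegree_map_le.trans hM) h0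
    hroot hsimple
  set N : MvPolynomial τ F := H.coeff 0 * sqrtCoeff (MvPolynomial.C 2⁻¹) (normCoeff H) k with hN
  have hN0 : N ≠ 0 := by
    intro h
    have h3 : (MvPolynomial.aeval a₀).toRingHom N = algebraMap F E 0 := by rw [h]; simp
    rw [hN, map_mul, map_sqrtCoeff, ← coeff_map, map_zero, mul_eq_zero] at h3
    refine h3.elim h0 fun h4 => hk ?_
    rw [← h4]
    congr 1
    · simp
    · funext n
      rw [normCoeff_map]
  have hNd : N.totalDegree ≤ (M + 1) * B := by
    refine (MvPolynomial.totalDegree_mul _ _).trans ?_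
    have h1 : (sqrtCoeff (MvPolynomial.C 2⁻¹) (normCoeff H) k).totalDegree ≤ k * B := by
      refine totalDegree_sqrtCoeff_le (fun n hn => ?_) k
      refine (MvPolynomial.totalDegree_mul _ _).trans ?_
      have h1 := MvPolynomial.totalDegree_pow (H.coeff 0) (n - 1)
      have h2 : (n - 1) * (H.coeff 0).totalDegree ≤ (n - 1) * B := Nat.mul_le_mul_left _ (hB 0)
      have h3 := hB n
      obtain ⟨m, rfl⟩ := Nat.exists_eq_succ_of_ne_zero hn
      rw [Nat.succ_eq_add_one, Nat.add_sub_cancel] at *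
      linarith
    have h2 : k * B ≤ M * B := Nat.mul_le_mul_right B hkM
    have h3 := hB 0
    linarith
  have hgood : ∀ a : τ → F, MvPolynomial.eval a N ≠ 0 →
      |∑ t : F, qchi ((H.map (MvPolynomial.eval a)).eval t)| ≤ 20 * (M + 1) * √q := by
    intro a ha
    refine abs_sum_qchi_eval_le hodd (natDegree_map_le.trans hM) ?_
    rintro ⟨c, T, hT⟩
    rw [hN, map_mul, map_sqrtCoeff, mul_ne_zero_iff, ← coeff_map] at ha
    refine ha.2 ?_
    have h5 := sqrtCoeff_eq_zero_of_square (half := (2 : F)⁻¹) hhalf hT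
      (natDegree_map_le.trans hM) ha.1 hMk
    rw [← h5]
    congr 1
    · simp
    · funext n
      rw [normCoeff_map]
  have hcount := card_zeros_mul_le hN0 hNd
  set Z := Finset.univ.filter fun a : τ → F => MvPolynomial.eval a N = 0 with hZ
  have hcount' : (Z.card : ℝ) * q ≤ (M + 1) * B * q ^ Fintype.card τ := by exact_mod_cast hcount
  refine (Finset.abs_sum_le_sum_abs _ _).trans ?_
  have hle : ∀ a : τ → F, |∑ t : F, qchi ((H.map (MvPolynomial.eval a)).eval t)| ≤
      20 * (M + 1) * √q + if MvPolynomial.eval a N = 0 then (q : ℝ) else 0 := by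
    intro a
    split_ifs with h
    · refine (abs_sum_qchi_le _).trans ?_
      rw [← hq]
      have : (0 : ℝ) ≤ 20 * (M + 1) * √q := by positivity
      linarith
    · simpa using hgood a h
  refine (Finset.sum_le_sum fun a _ => hle a).trans ?_
  rw [Finset.sum_add_distrib, ← Finset.sum_filter, Finset.sum_const, Finset.sum_const,
    Finset.card_univ, Fintype.card_fun, ← hq, nsmul_eq_mul, nsmul_eq_mul, Nat.cast_pow, ← hZ]
  calc (q : ℝ) ^ Fintype.card τ * (20 * (M + 1) * √q) + Z.card * q
      ≤ (q : ℝ) ^ Fintype.card τ * (20 * (M + 1) * √q) + (M + 1) * B * q ^ Fintype.card τ * √q := by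
        refine add_le_add_right (hcount'.trans ?_) _
        exact le_mul_of_one_le_right (by positivity) hq1
    _ = _ := by ring

open Classical in
/-- A bound for multivariate quadratic character sums in which it suffices that the
argument, as a polynomial in its last variable, acquires a simple root for some values (in an
extension field) of the other variables. -/
theorem abs_sum_qchi_eval_map_le (hodd : Odd (Fintype.card F)) {H : (MvPolynomial τ F)[X]}
    {M B : ℕ} (hM : H.natDegree ≤ M) (hB : ∀ i, (H.coeff i).totalDegree ≤ B)
    {E : Type*} [Field E] [Algebra F E] (a₀ : τ → E) (t₀ : E)
    (hroot : (H.map (MvPolynomial.aeval a₀).toRingHom).eval t₀ = 0)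
    (hsimple : (H.map (MvPolynomial.aeval a₀).toRingHom).derivative.eval t₀ ≠ 0) :
    |∑ a : τ → F, ∑ t : F, qchi ((H.map (MvPolynomial.eval a)).eval t)| ≤
      (M + 1) * (20 + B) * Fintype.card F ^ Fintype.card τ * √(Fintype.card F) := by
  set q := Fintype.card F with hq
  have hq1 : (1 : ℝ) ≤ √q := by
    rw [Real.one_le_sqrt]
    exact_mod_cast Fintype.card_pos
  have hqq : √(q : ℝ) * √q = q := Real.mul_self_sqrt (by positivity)
  by_cases hqM : q ≤ M
  · refine (Finset.abs_sum_le_sum_abs _ _).trans ?_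
    refine (Finset.sum_le_sum fun a _ => abs_sum_qchi_le _).trans ?_
    rw [Finset.sum_const, nsmul_eq_mul, Finset.card_univ, Fintype.card_fun, ← hq, Nat.cast_pow]
    have h1 : √(q : ℝ) ≤ (M + 1) * (20 + B) := by
      calc √(q : ℝ) ≤ q := by nlinarith
        _ ≤ M := by exact_mod_cast hqM
        _ ≤ (M + 1) * (20 + B) := by
          have : (0 : ℝ) ≤ M := by positivity
          have : (0 : ℝ) ≤ B := by positivity
          nlinarith
    calc (q : ℝ) ^ Fintype.card τ * q = √q * (q ^ Fintype.card τ * √q) := by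
          rw [← mul_assoc, mul_comm _ ((q : ℝ) ^ _), mul_assoc, hqq]
      _ ≤ (M + 1) * (20 + B) * (q ^ Fintype.card τ * √q) := by gcongr
      _ = _ := by ring
  set P₀ := H.map (MvPolynomial.aeval a₀).toRingHom with hP₀
  have hP₀ne : P₀ ≠ 0 := by intro h; simp [h] at hsimple
  have hP₀d : P₀.natDegree ≤ M := natDegree_map_le.trans hM
  -- shift so that the constant coefficient is nonzero
  obtain ⟨s, hs⟩ : ∃ s : F, P₀.eval (algebraMap F E s) ≠ 0 := by
    by_contra! hcon
    have h1 : (Finset.univ.image (algebraMap F E)).card ≤ P₀.natDegree := by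
      refine card_le_degree_of_subset_roots fun x hx => ?_
      obtain ⟨y, -, rfl⟩ := Finset.mem_image.1 hx
      exact (mem_roots hP₀ne).2 (hcon y)
    rw [Finset.card_image_of_injective _ (algebraMap F E).injective, Finset.card_univ] at h1
    omega
  set H' := H.comp (X + C (MvPolynomial.C s)) with hH'
  have hH'map : H'.map (MvPolynomial.aeval a₀).toRingHom = P₀.comp (X + C (algebraMap F E s)) := by
    rw [hH', map_comp, hP₀]
    simp
  have hH'd : H'.natDegree ≤ M := by
    rw [hH', natDegree_comp, natDegree_X_add_C, mul_one]; exact hM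
  have hH'B : ∀ i, (H'.coeff i).totalDegree ≤ B := by
    intro i
    rw [hH', ← taylor_apply, taylor_coeff, eval_eq_sum]
    refine MvPolynomial.totalDegree_finsetSum_le fun j _ => ?_
    dsimp only
    rw [hasseDeriv_coeff, ← MvPolynomial.C_pow, ← map_natCast (MvPolynomial.C (R := F) (σ := τ)),
      mul_comm, ← mul_assoc, ← MvPolynomial.C_mul]
    refine (MvPolynomial.totalDegree_mul _ _).trans ?_
    rw [MvPolynomial.totalDegree_C, zero_add]
    exact hB _
  have := abs_sum_qchi_eval_map_le_of_coeff_zero hodd hH'd hH'B a₀ (t₀ - algebraMap F E s)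
    (by rw [hH'map, coeff_zero_eq_eval_zero]; simpa using hs)
    (by rw [hH'map]; simpa using hroot)
    (by rw [hH'map, derivative_comp]; simpa using hsimple)
  refine le_of_eq_of_le (congrArg _ (Finset.sum_congr rfl fun a _ => ?_)) this
  refine (Fintype.sum_equiv (Equiv.addRight s) _ _ fun t => ?_).symm
  rw [hH', map_comp]
  simp

end Counting

section Universal

variable {τ κ : Type}

lemma totalDegree_aeval_le {σ F : Type} [Field F] (g : σ → MvPolynomial τ F)
    (hg : ∀ i, (g i).totalDegree ≤ 1) (P : MvPolynomial σ ℤ) :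
    (MvPolynomial.aeval g P).totalDegree ≤ P.totalDegree := by
  rw [MvPolynomial.aeval_def, MvPolynomial.eval₂_eq]
  refine MvPolynomial.totalDegree_finsetSum_le fun d hd => ?_
  refine (MvPolynomial.totalDegree_mul _ _).trans ?_
  have h1 : (algebraMap ℤ (MvPolynomial τ F) (P.coeff d)).totalDegree = 0 := by
    rw [eq_intCast, ← map_intCast (MvPolynomial.C (R := F) (σ := τ)), MvPolynomial.totalDegree_C]
  rw [h1, zero_add]
  refine (MvPolynomial.totalDegree_finsetProd _ _).trans ?_
  refine le_trans ?_ (MvPolynomial.le_totalDegree hd)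
  refine Finset.sum_le_sum fun i _ => ?_
  refine (MvPolynomial.totalDegree_pow _ _).trans ?_
  exact (Nat.mul_le_mul_left _ (hg i)).trans (mul_one _).le

/-- Specialization of the last variable of a polynomial to `t` and of the others to `a`. -/
noncomputable def spec {σ S : Type*} [CommRing S] (a : σ → S) (t : S) :
    (MvPolynomial σ ℤ)[X] →+* S :=
  eval₂RingHom (MvPolynomial.aeval a).toRingHom t

/-- Partial specialization. -/
noncomputable def partialSpec {F : Type*} [CommRing F] (k : κ → F) :
    MvPolynomial (τ ⊕ κ) ℤ →+* MvPolynomial τ F :=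
  (MvPolynomial.aeval (Sum.elim MvPolynomial.X fun i => MvPolynomial.C (k i))).toRingHom

lemma eval_map_partialSpec {F S : Type*} [CommRing F] [CommRing S] [Algebra F S] (k : κ → F)
    (a : τ → S) (t : S) (H : (MvPolynomial (τ ⊕ κ) ℤ)[X]) :
    ((H.map (partialSpec k)).map (MvPolynomial.aeval a).toRingHom).eval t =
      spec (Sum.elim a fun i => algebraMap F S (k i)) t H := by
  rw [map_map, eval_map, spec, coe_eval₂RingHom]
  congr 1
  refine MvPolynomial.ringHom_ext' (RingHom.ext_int _ _) fun i => ?_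
  cases i <;> simp [partialSpec]

lemma totalDegree_partialSpec_le {F : Type} [Field F] (k : κ → F) (P : MvPolynomial (τ ⊕ κ) ℤ) :
    (partialSpec k P).totalDegree ≤ P.totalDegree := by
  refine totalDegree_aeval_le _ (fun i => ?_) P
  cases i <;> simp

open Classical in
lemma exists_card_zeros_mul_le [Fintype τ] [DecidableEq τ] (P : MvPolynomial (τ ⊕ κ) ℤ) :
    ∃ B : ℕ, ∀ (F : Type) [Field F] [Fintype F] (k : κ → F) (E : Type) [Field E] [Algebra F E]
      (a₀ : τ → E), MvPolynomial.aeval (Sum.elim a₀ fun i => algebraMap F E (k i)) P ≠ 0 →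
      (Finset.univ.filter fun a : τ → F => MvPolynomial.aeval (Sum.elim a k) P = 0).card *
        Fintype.card F ≤ B * Fintype.card F ^ Fintype.card τ := by
  refine ⟨P.totalDegree, fun F _ _ k E _ _ a₀ h => ?_⟩
  have key : ∀ (S : Type) [CommRing S] [Algebra F S] (a : τ → S),
      MvPolynomial.aeval a (partialSpec k P) =
        MvPolynomial.aeval (Sum.elim a fun i => algebraMap F S (k i)) P := by
    intro S _ _ a
    have : (MvPolynomial.aeval a).toRingHom.comp (partialSpec k) =
        (MvPolynomial.aeval (Sum.elim a fun i => algebraMap F S (k i))).toRingHom := by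
      refine MvPolynomial.ringHom_ext' (RingHom.ext_int _ _) fun i => ?_
      cases i <;> simp [partialSpec]
    exact DFunLike.congr_fun this P
  refine le_of_eq_of_le ?_ (card_zeros_mul_le (P := partialSpec k P) ?_
    (totalDegree_partialSpec_le k P))
  · congr 3
    · funext a
      have := key F a
      simp only [Algebra.algebraMap_self, RingHom.id_apply] at this
      rw [← this]
      rfl
    · exact congrArg (@Finset.univ _) (Subsingleton.elim _ _)
  · intro h0
    apply h
    rw [← key, h0, map_zero]

/-- The bound for character sums of specializations of a fixed polynomial; the simple root condition
is expressed with dual numbers. -/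
theorem exists_abs_sum_qchi_spec_le [Fintype τ] [DecidableEq τ] (H : (MvPolynomial (τ ⊕ κ) ℤ)[X]) :
    ∃ B : ℝ, 0 ≤ B ∧ ∀ (F : Type) [Field F] [Fintype F], Odd (Fintype.card F) →
      ∀ (k : κ → F) (E : Type) [Field E] [Algebra F E] (a₀ : τ → E) (t₀ : E) (z : E), z ≠ 0 →
      spec (Sum.elim (fun i => TrivSqZeroExt.inl (a₀ i))
        fun i => TrivSqZeroExt.inl (algebraMap F E (k i)))
        (TrivSqZeroExt.inl t₀ + DualNumber.eps : DualNumber E) H = TrivSqZeroExt.inr z →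
      |∑ a : τ → F, ∑ t : F, qchi (spec (Sum.elim a k) t H)| ≤
        B * Fintype.card F ^ Fintype.card τ * √(Fintype.card F) := by
  set M := H.natDegree
  set B := H.support.sup fun i => (H.coeff i).totalDegree with hB
  refine ⟨(M + 1) * (20 + B), by positivity, fun F _ _ hodd k E _ _ a₀ t₀ z hz h => ?_⟩
  set P₀ : E[X] := (H.map (partialSpec k)).map (MvPolynomial.aeval a₀).toRingHom with hP₀
  have hdual : TrivSqZeroExt.inl (P₀.eval t₀) + TrivSqZeroExt.inr (P₀.derivative.eval t₀) =
      (TrivSqZeroExt.inr z : DualNumber E) := by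
    have h2 := Polynomial.aeval_add_of_sq_eq_zero P₀ (TrivSqZeroExt.inl t₀ : DualNumber E)
      DualNumber.eps (by rw [pow_two, DualNumber.eps_mul_eps])
    have h3 : aeval (TrivSqZeroExt.inl t₀ + DualNumber.eps : DualNumber E) P₀ =
        TrivSqZeroExt.inr z := by
      rw [← h, ← eval_map_algebraMap, hP₀, map_map, map_map, eval_map, spec, coe_eval₂RingHom]
      congr 1
      refine MvPolynomial.ringHom_ext' (RingHom.ext_int _ _) fun i => ?_
      cases i <;> simp [partialSpec, TrivSqZeroExt.algebraMap_eq_inl]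
    rw [← h3, h2]
    have h4 : ∀ p : E[X], aeval (TrivSqZeroExt.inl t₀ : DualNumber E) p =
        TrivSqZeroExt.inl (p.eval t₀) := by
      intro p
      exact aeval_algebraMap_apply_eq_algebraMap_eval t₀ p
    rw [h4, h4, DualNumber.eps, TrivSqZeroExt.inl_mul_inr, smul_eq_mul, mul_one]
  have hfst := congrArg TrivSqZeroExt.fst hdual
  have hsnd := congrArg TrivSqZeroExt.snd hdual
  simp at hfst hsnd
  have := abs_sum_qchi_eval_map_le hodd (H := H.map (partialSpec k)) (M := M) (B := B)
    natDegree_map_le (fun i => ?_) a₀ t₀ hfst (hsnd ▸ hz)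
  · refine le_of_eq_of_le (congrArg _ ?_) this
    refine Finset.sum_congr (congrArg (@Finset.univ _) (Subsingleton.elim _ _)) fun a _ =>
      Finset.sum_congr rfl fun t _ => ?_
    have := eval_map_partialSpec (S := F) k a t H
    simp only [Algebra.algebraMap_self, RingHom.id_apply] at this
    rw [← this]
    rfl
  · rw [coeff_map]
    refine (totalDegree_partialSpec_le k _).trans ?_
    by_cases hi : i ∈ H.support
    · exact Finset.le_sup (f := fun i => (H.coeff i).totalDegree) hi
    · rw [notMem_support_iff.1 hi]; simp

end Universal

section Discriminant

/-- The discriminant of a monic polynomial, as a polynomial in the coefficients. -/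
noncomputable def dsc {R : Type*} [CommRing R] (n : ℕ) (f : R[X]) : R :=
  (-1) ^ (n * (n - 1) / 2) * resultant f (derivative f) n (n - 1)

variable {R S : Type*} [CommRing R] [CommRing S]

lemma map_dsc (φ : R →+* S) (n : ℕ) (f : R[X]) : φ (dsc n f) = dsc n (f.map φ) := by
  rw [dsc, dsc, derivative_map, resultant_map_map]
  simp only [map_mul, map_pow, map_neg, map_one]

lemma resultant_eq_of_natDegree_le {f g : R[X]} (hf : f.Monic) {N : ℕ} (hN : g.natDegree ≤ N) :
    resultant f g f.natDegree N = resultant f g := by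
  obtain ⟨k, rfl⟩ := Nat.exists_eq_add_of_le hN
  rw [resultant_add_right_deg _ _ _ _ _ le_rfl, coeff_natDegree, hf.leadingCoeff, one_pow, one_mul]

lemma resultant_mul_right' {f g₁ g₂ : R[X]} (hf : f.Monic) :
    resultant f (g₁ * g₂) = resultant f g₁ * resultant f g₂ := by
  rw [← resultant_mul_right _ _ _ _ le_rfl, ← resultant_eq_of_natDegree_le hf natDegree_mul_le]

lemma resultant_add_mul_right' {f g p : R[X]} (hf : f.Monic) :
    resultant f (g + f * p) = resultant f g := by
  set N := (g + f * p).natDegree + g.natDegree + (p.natDegree + f.natDegree) with hN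
  rw [← resultant_eq_of_natDegree_le hf (N := N) (by omega),
    resultant_add_mul_right _ _ _ _ _ (by omega) le_rfl,
    resultant_eq_of_natDegree_le hf (by omega)]

lemma resultant_mul_left' {f₁ f₂ g : R[X]} (h₁ : f₁.Monic) (h₂ : f₂.Monic) :
    resultant (f₁ * f₂) g = resultant f₁ g * resultant f₂ g := by
  rw [← resultant_mul_left _ _ _ _ le_rfl, h₁.natDegree_mul h₂]

lemma dsc_eq {f : R[X]} (hf : f.Monic) :
    dsc f.natDegree f = (-1) ^ (f.natDegree * (f.natDegree - 1) / 2) * resultant f (derivative f) := by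
  rw [dsc, resultant_eq_of_natDegree_le hf (natDegree_derivative_le f)]

lemma triangle_add (m n : ℕ) : (m + n) * (m + n - 1) / 2 =
    m * (m - 1) / 2 + n * (n - 1) / 2 + m * n := by
  have h : ∀ k : ℕ, 2 * (k * (k - 1) / 2) = k * (k - 1) := fun k =>
    Nat.mul_div_cancel' (Nat.even_mul_pred_self k).two_dvd
  have h1 := h m
  have h2 := h n
  have h3 := h (m + n)
  have h4 : (m + n) * (m + n - 1) = m * (m - 1) + n * (n - 1) + 2 * (m * n) := by
    cases m with
    | zero => simp
    | succ m =>
      cases n with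
      | zero => simp
      | succ n =>
        have e : m + 1 + (n + 1) - 1 = m + n + 1 := by omega
        rw [e, Nat.add_sub_cancel, Nat.add_sub_cancel]; ring
  omega

lemma dsc_mul {f g : R[X]} (hf : f.Monic) (hg : g.Monic) :
    dsc (f.natDegree + g.natDegree) (f * g) =
      dsc f.natDegree f * dsc g.natDegree g * resultant f g ^ 2 := by
  rw [← hf.natDegree_mul hg, dsc_eq (hf.mul hg), dsc_eq hf, dsc_eq hg, derivative_mul,
    resultant_mul_left' hf hg, resultant_add_mul_right' hf, add_comm, mul_comm (derivative f) g,
    resultant_add_mul_right' hg, resultant_mul_right' hf, resultant_mul_right' hg,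
    hf.natDegree_mul hg, triangle_add, resultant_comm g f, pow_add, pow_add]
  have : ((-1 : R) ^ (f.natDegree * g.natDegree)) * (-1) ^ (g.natDegree * f.natDegree) = 1 := by
    rw [mul_comm g.natDegree, ← mul_pow]; simp
  linear_combination (-1) ^ (f.natDegree * (f.natDegree - 1) / 2) *
    (-1) ^ (g.natDegree * (g.natDegree - 1) / 2) * resultant f (derivative f) *
    resultant g (derivative g) * resultant f g ^ 2 * this

lemma isUnit_dsc_iff {f : R[X]} (hf : f.Monic) : IsUnit (dsc f.natDegree f) ↔ f.Separable := by
  rw [dsc_eq hf, IsUnit.mul_iff, isUnit_resultant_iff_isCoprime hf]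
  exact and_iff_right (isUnit_one.neg.pow _)

lemma dsc_X_sub_C (r : R) : dsc 1 (X - C r) = 1 := by
  simp [dsc]

lemma dsc_prod_X_sub_C {n : ℕ} (r : Fin n → R) :
    dsc n (∏ i, (X - C (r i))) = (∏ i, ∏ j ∈ Finset.Ioi i, (r j - r i)) ^ 2 := by
  nontriviality R
  induction n with
  | zero => simp [dsc]
  | succ n ih =>
    have hm : (∏ i : Fin n, (X - C (r i.succ))).Monic := monic_prod_of_monic _ _ fun i _ => monic_X_sub_C _
    have hd : (∏ i : Fin n, (X - C (r i.succ))).natDegree = n := by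
      rw [natDegree_prod_of_monic _ _ fun i _ => monic_X_sub_C _]; simp
    have h := dsc_mul (monic_X_sub_C (r 0)) hm
    rw [natDegree_X_sub_C, hd, dsc_X_sub_C, ih fun i => r i.succ] at h
    rw [add_comm 1 n] at h
    rw [Fin.prod_univ_succ, h, Fin.prod_univ_succ, Fin.prod_Ioi_zero]
    have h1 := resultant_X_sub_C_left (∏ i : Fin n, (X - C (r i.succ))) n (r 0) hd.le
    rw [h1, eval_prod, one_mul, mul_comm, mul_pow]
    congr 1
    · rw [← Finset.prod_pow, ← Finset.prod_pow]
      refine Finset.prod_congr rfl fun i _ => ?_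
      rw [eval_sub, eval_X, eval_C]; ring
    · congr 1
      refine Finset.prod_congr rfl fun i _ => ?_
      rw [Fin.prod_Ioi_succ]

lemma dsc_two {f : R[X]} (hf : f.Monic) (h2 : f.natDegree = 2) :
    dsc 2 f = f.coeff 1 ^ 2 - 4 * f.coeff 0 := by
  nontriviality R
  have hd : f.degree = 2 := by rw [degree_eq_natDegree hf.ne_zero, h2]; rfl
  have h := resultant_deriv (f := f) (by rw [hd]; norm_num)
  rw [h2, discr_of_degree_eq_two hd, hf.leadingCoeff] at h
  rw [dsc, h]
  have : f.coeff 2 = 1 := by rw [← h2]; exact hf.coeff_natDegree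
  rw [this]
  norm_num

end Discriminant

section Pellet

variable {F : Type} [Field F] [Fintype F]

lemma neg_one_ne_one_of_odd_card (hodd : Odd (Fintype.card F)) : (-1 : F) ≠ 1 := by
  have : ringChar F ≠ 2 := by
    intro h
    have := FiniteField.even_card_iff_char_two.mp h
    have := Nat.odd_iff.mp hodd
    omega
  exact Ring.neg_one_ne_one_of_char_ne_two this

open FiniteField in
lemma dsc_pow_of_irreducible (hodd : Odd (Fintype.card F)) {P : F[X]} (hP : P.Monic)
    (hi : Irreducible P) :
    dsc P.natDegree P ^ (Fintype.card F / 2) = (-1) ^ (P.natDegree - 1) ∧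
      dsc P.natDegree P ≠ 0 := by
  classical
  have : Fact (Irreducible P) := ⟨hi⟩
  let L := AdjoinRoot P
  let pb := AdjoinRoot.powerBasis hi.ne_zero
  have : FiniteDimensional F L := pb.finite
  have : Finite L := Module.finite_of_finite F
  have : Fintype L := Fintype.ofFinite L
  have hfr : Module.finrank F L = P.natDegree := by
    rw [pb.finrank]; exact AdjoinRoot.powerBasis_dim hi.ne_zero
  obtain ⟨m, hm⟩ : ∃ m, P.natDegree = m + 1 := Nat.exists_eq_succ_of_ne_zero hi.natDegree_pos.ne'
  let φ := frobeniusAlgEquivOfAlgebraic F L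
  have hφ : ∀ y : L, φ y = y ^ Fintype.card F := fun y => rfl
  have hφn : φ ^ (m + 1) = 1 := by
    rw [← hm, ← hfr, ← orderOf_frobeniusAlgEquivOfAlgebraic F L]
    exact pow_orderOf_eq_one φ
  let x : L := AdjoinRoot.root P
  let r : Fin (m + 1) → L := fun i => (φ ^ (i : ℕ)) x
  have hinj : Function.Injective r := by
    intro i j hij
    have h1 : ((φ ^ (i : ℕ) : Gal(L/F)) : L →ₐ[F] L) = (φ ^ (j : ℕ) : Gal(L/F)) :=
      AdjoinRoot.algHom_ext hij
    have h2 : φ ^ (i : ℕ) = φ ^ (j : ℕ) := by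
      ext y; exact congrArg (fun f : L →ₐ[F] L => f y) h1
    have h3 := pow_injOn_Iio_orderOf (x := φ)
    have ho : orderOf φ = m + 1 := by
      rw [← hm, ← hfr]; exact orderOf_frobeniusAlgEquivOfAlgebraic F L
    rw [ho] at h3
    exact Fin.ext (h3 i.2 j.2 h2)
  have hroot : ∀ i, (P.map (algebraMap F L)).IsRoot (r i) := by
    intro i
    rw [IsRoot, eval_map_algebraMap, aeval_algHom_apply (φ ^ (i : ℕ)) x P,
      AdjoinRoot.aeval_eq, AdjoinRoot.mk_self, map_zero]
  have hprod : P.map (algebraMap F L) = ∏ i, (X - C (r i)) := by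
    have hmon : (∏ i, (X - C (r i))).Monic := monic_prod_of_monic _ _ fun i _ => monic_X_sub_C (r i)
    apply eq_of_monic_of_dvd_of_natDegree_le hmon (hP.map _)
    · refine Finset.prod_dvd_of_coprime (fun i _ j _ hij => ?_) fun i _ => dvd_iff_isRoot.mpr (hroot i)
      exact pairwise_coprime_X_sub_C hinj hij
    · rw [natDegree_map, natDegree_prod_of_monic _ _ fun i _ => monic_X_sub_C _]
      simp [hm]
  set δ := (Matrix.vandermonde r).det with hδ
  have hδ0 : δ ≠ 0 := Matrix.det_vandermonde_ne_zero_iff.mpr hinj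
  have hd : algebraMap F L (dsc P.natDegree P) = δ ^ 2 := by
    rw [map_dsc, hprod, hm, dsc_prod_X_sub_C, hδ, Matrix.det_vandermonde]
  have hrot : ∀ i, φ (r i) = r (finRotate _ i) := by
    intro i
    have h0 : φ (r i) = (φ ^ ((i : ℕ) + 1)) x := by rw [pow_succ']; rfl
    rw [h0]
    by_cases hl : i = Fin.last m
    · subst hl
      rw [finRotate_last]
      show (φ ^ (m + 1)) x = (φ ^ 0) x
      rw [hφn, pow_zero]
    · show _ = (φ ^ ((finRotate (m + 1) i : Fin (m + 1)) : ℕ)) x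
      rw [coe_finRotate_of_ne_last hl]
  have hδq : δ ^ Fintype.card F = (-1) ^ m * δ := by
    rw [← hφ, hδ, AlgEquiv.map_det]
    have : φ.mapMatrix (Matrix.vandermonde r) = (Matrix.vandermonde r).submatrix (finRotate (m + 1)) id := by
      ext i j
      simp [Matrix.vandermonde_apply, hrot]
    rw [this, Matrix.det_permute, sign_finRotate]
    simp
  refine ⟨?_, fun h => ?_⟩
  · apply (algebraMap F L).injective
    rw [map_pow, hd, map_pow, map_neg, map_one, hm, Nat.add_sub_cancel, ← pow_mul]
    apply mul_right_cancel₀ hδ0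
    rw [← hδq, ← pow_succ, Nat.two_mul_div_two_add_one_of_odd hodd]
  · rw [h, map_zero] at hd
    exact hδ0 (pow_eq_zero_iff two_ne_zero |>.mp hd.symm)

lemma qchi_dsc_of_irreducible (hodd : Odd (Fintype.card F)) {P : F[X]} (hP : P.Monic)
    (hi : Irreducible P) : qchi (dsc P.natDegree P) = (-1) ^ (P.natDegree - 1) := by
  obtain ⟨h, h0⟩ := dsc_pow_of_irreducible hodd hP hi
  have hne := neg_one_ne_one_of_odd_card hodd
  rcases qchi_eq hodd h0 with ⟨h1, h2⟩ | ⟨h1, h2⟩ <;> rw [h2] <;> rw [h] at h1 <;>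
  rcases Nat.even_or_odd (P.natDegree - 1) with he | he
  · rw [he.neg_one_pow]
  · rw [he.neg_one_pow] at h1; exact absurd h1 hne
  · rw [he.neg_one_pow] at h1; exact absurd h1.symm hne
  · rw [he.neg_one_pow]

end Pellet

section Moebius

variable {F : Type} [Field F] [Fintype F]

/-- The Möbius function of a monic polynomial, by Pellet's formula. -/
noncomputable def polyMu (f : F[X]) : ℝ := (-1) ^ f.natDegree * qchi (dsc f.natDegree f)

lemma polyMu_one : polyMu (1 : F[X]) = 1 := by
  simp [polyMu, dsc, qchi_one]

lemma polyMu_mul {f g : F[X]} (hf : f.Monic) (hg : g.Monic) (h : IsCoprime f g) :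
    polyMu (f * g) = polyMu f * polyMu g := by
  have h0 : resultant f g ≠ 0 := resultant_ne_zero _ _ h
  rw [polyMu, polyMu, polyMu, hf.natDegree_mul hg, dsc_mul hf hg, qchi_mul, qchi_mul, qchi_pow,
    qchi_sq h0]
  ring

lemma polyMu_irreducible (hodd : Odd (Fintype.card F)) {P : F[X]} (hP : P.Monic)
    (hi : Irreducible P) : polyMu P = -1 := by
  rw [polyMu, qchi_dsc_of_irreducible hodd hP hi, ← pow_add]
  refine Odd.neg_one_pow ?_
  have := hi.natDegree_pos
  exact ⟨P.natDegree - 1, by omega⟩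

lemma polyMu_eq_zero_iff {f : F[X]} (hf : f.Monic) : polyMu f = 0 ↔ ¬ Squarefree f := by
  rw [polyMu, mul_eq_zero, or_iff_right (pow_ne_zero _ (by norm_num)), qchi_eq_zero_iff,
    ← PerfectField.separable_iff_squarefree, ← isUnit_dsc_iff hf, isUnit_iff_ne_zero, not_not]

lemma abs_polyMu_le (f : F[X]) : |polyMu f| ≤ 1 := by
  rw [polyMu, abs_mul, abs_pow, abs_neg, abs_one, one_pow, one_mul]
  exact abs_qchi_le _

lemma polyMu_sq {f : F[X]} (hf : f.Monic) (hs : Squarefree f) : polyMu f ^ 2 = 1 := by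
  have h : dsc f.natDegree f ≠ 0 := by
    rw [← isUnit_iff_ne_zero, isUnit_dsc_iff hf]
    exact PerfectField.separable_iff_squarefree.mpr hs
  rw [polyMu, mul_pow, qchi_sq h, ← pow_mul, mul_one]
  exact Even.neg_one_pow ⟨f.natDegree, by ring⟩

end Moebius

section Dual

variable {E : Type} [Field E]

lemma monic_dual {g B : E[X]} (hg : g.Monic) (hB : B.degree < g.degree) :
    (g.map (TrivSqZeroExt.inlHom E E) + C (DualNumber.eps : DualNumber E) *
      B.map (TrivSqZeroExt.inlHom E E)).Monic ∧
    (g.map (TrivSqZeroExt.inlHom E E) + C (DualNumber.eps : DualNumber E) *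
      B.map (TrivSqZeroExt.inlHom E E)).natDegree = g.natDegree := by
  have h1 : (C (DualNumber.eps : DualNumber E) * B.map (TrivSqZeroExt.inlHom E E)).degree <
      (g.map (TrivSqZeroExt.inlHom E E)).degree := by
    rw [hg.degree_map]
    refine lt_of_le_of_lt ?_ hB
    refine (degree_mul_le _ _).trans ?_
    calc _ ≤ 0 + B.degree := add_le_add degree_C_le degree_map_le
      _ = _ := zero_add _
  exact ⟨(hg.map _).add_of_left h1, by
    rw [natDegree_add_eq_left_of_degree_lt h1, hg.natDegree_map]⟩

lemma dsc_dual (h2 : (2 : E) ≠ 0) {h D : E[X]} {c : E} {m : ℕ} (hh : h.Monic)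
    (hm : h.natDegree = m) (hs : h.Separable) (hc : h.eval c ≠ 0) (hD : D.degree < (m + 2 : ℕ))
    (hDc : D.eval c ≠ 0) :
    ∃ z : E, z ≠ 0 ∧ dsc (m + 2) (((X - C c) ^ 2 * h).map (TrivSqZeroExt.inlHom E E) +
      C (DualNumber.eps : DualNumber E) * D.map (TrivSqZeroExt.inlHom E E)) =
        TrivSqZeroExt.inr z := by
  set s : E[X] := (X - C c) ^ 2 with hsdef
  have hsm : s.Monic := (monic_X_sub_C c).pow 2
  have hsd : s.natDegree = 2 := by rw [hsdef, natDegree_pow, natDegree_X_sub_C]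
  have hcop : IsCoprime h s := by
    refine IsCoprime.pow_right (IsCoprime.symm ?_)
    refine ((irreducible_X_sub_C c).coprime_iff_not_dvd).mpr ?_
    rwa [dvd_iff_isRoot]
  obtain ⟨u, v, huv⟩ := hcop
  set A := (D * u) %ₘ s with hA
  set γ := (D * u) /ₘ s * h + D * v with hγ
  have hAd : A.degree < s.degree := degree_modByMonic_lt _ hsm
  have hDe : D = A * h + s * γ := by
    have := modByMonic_add_div (D * u) s
    rw [hγ]
    linear_combination -D * huv - h * this
  have hγd : γ.degree < h.degree := by
    by_contra! hcon
    have h1 : (s * γ).degree = (D - A * h).degree := by rw [hDe]; congr 1; ring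
    have hhd : h.degree = m := by rw [degree_eq_natDegree hh.ne_zero, hm]
    have hsd' : s.degree = 2 := by rw [degree_eq_natDegree hsm.ne_zero, hsd]; rfl
    have h2 : (A * h).degree < (m + 2 : ℕ) := by
      rw [hsd'] at hAd
      rw [degree_mul, hhd, Nat.cast_add, add_comm]
      exact WithBot.add_lt_add_left (WithBot.natCast_ne_bot m) hAd
    have h3 : (D - A * h).degree < (m + 2 : ℕ) :=
      lt_of_le_of_lt (degree_sub_le _ _) (max_lt hD h2)
    rw [← h1, degree_mul, hsd'] at h3
    rw [hhd] at hcon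
    refine absurd h3 (not_lt.mpr ?_)
    rw [Nat.cast_add, add_comm]
    exact add_le_add_right hcon 2
  have hfac : (s * h).map (TrivSqZeroExt.inlHom E E) +
      C (DualNumber.eps : DualNumber E) * D.map (TrivSqZeroExt.inlHom E E) =
      (s.map (TrivSqZeroExt.inlHom E E) + C (DualNumber.eps : DualNumber E) *
        A.map (TrivSqZeroExt.inlHom E E)) *
      (h.map (TrivSqZeroExt.inlHom E E) + C (DualNumber.eps : DualNumber E) *
        γ.map (TrivSqZeroExt.inlHom E E)) := by
    have he : C (DualNumber.eps : DualNumber E) * C (DualNumber.eps : DualNumber E) = 0 := by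
      rw [← C_mul, DualNumber.eps_mul_eps, C_0]
    rw [hDe]
    simp only [Polynomial.map_mul, Polynomial.map_add]
    linear_combination -(A.map (TrivSqZeroExt.inlHom E E)) * γ.map (TrivSqZeroExt.inlHom E E) * he
  obtain ⟨m1, d1⟩ := monic_dual hsm hAd
  obtain ⟨m2, d2⟩ := monic_dual hh hγd
  have key := dsc_mul m1 m2
  rw [← hfac, d1, d2, hm, hsd, add_comm 2 m] at key
  have hfst : ∀ g B : E[X], (g.map (TrivSqZeroExt.inlHom E E) +
      C (DualNumber.eps : DualNumber E) * B.map (TrivSqZeroExt.inlHom E E)).map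
      (TrivSqZeroExt.fstHom E E E : DualNumber E →+* E) = g := by
    intro g B
    ext k
    simp [coeff_map]
  set G := h.map (TrivSqZeroExt.inlHom E E) + C (DualNumber.eps : DualNumber E) *
        γ.map (TrivSqZeroExt.inlHom E E) with hG
  set S := s.map (TrivSqZeroExt.inlHom E E) + C (DualNumber.eps : DualNumber E) *
        A.map (TrivSqZeroExt.inlHom E E) with hS
  have hu1 : (TrivSqZeroExt.fstHom E E E : DualNumber E →+* E) (dsc m G) ≠ 0 := by
    rw [map_dsc, hfst, ← hm, ← isUnit_iff_ne_zero, isUnit_dsc_iff hh]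
    exact hs
  have hu2 : (TrivSqZeroExt.fstHom E E E : DualNumber E →+* E) (resultant S G) ≠ 0 := by
    rw [← resultant_map_map, hfst, hfst, d1, d2]
    exact resultant_ne_zero _ _ (IsCoprime.symm ⟨u, v, huv⟩)
  rw [d1, d2, hm, hsd] at hu2
  have hAc : A.eval c ≠ 0 := by
    intro h0
    apply hDc
    rw [hDe, eval_add, eval_mul, eval_mul, h0, hsdef]
    simp
  have hS2 : dsc 2 S = TrivSqZeroExt.inr (-4 * A.eval c) := by
    have hAe : A.eval c = A.coeff 0 + A.coeff 1 * c := by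
      have : A.natDegree < 2 := by
        rw [← hsd]
        exact natDegree_modByMonic_lt _ hsm (fun h => by rw [h, natDegree_one] at hsd; omega)
      rw [eval_eq_sum_range' this]
      simp [Finset.sum_range_succ]
    rw [dsc_two m1 (d1.trans hsd), hAe]
    have hsc0 : s.coeff 0 = c ^ 2 := by simp [hsdef, coeff_zero_eq_eval_zero]
    have hsc1 : s.coeff 1 = - 2 * c := by
      have : s = X ^ 2 + C (-2 * c) * X + C (c ^ 2) := by
        rw [hsdef]
        simp only [C_mul, C_neg, C_pow, C_ofNat]
        ring
      rw [this]
      simp [coeff_X_pow, -map_pow, coeff_C]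
    have h4 : (4 : DualNumber E) = TrivSqZeroExt.inl 4 :=
      (map_ofNat (TrivSqZeroExt.inlHom E E) 4).symm
    rw [hS, h4]
    simp only [coeff_add, coeff_map, coeff_C_mul, hsc0, hsc1]
    ext
    · simp; ring
    · simp; ring
  refine ⟨-4 * A.eval c * (TrivSqZeroExt.fstHom E E E : DualNumber E →+* E) (dsc m G) *
    (TrivSqZeroExt.fstHom E E E : DualNumber E →+* E) (resultant S G 2 m) ^ 2, ?_, ?_⟩
  · refine mul_ne_zero (mul_ne_zero (mul_ne_zero ?_ hAc) hu1) (pow_ne_zero _ hu2)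
    have : (4 : E) = 2 * 2 := by norm_num
    rw [neg_ne_zero, this]
    exact mul_ne_zero h2 h2
  · rw [key, hS2]
    ext
    · simp
    · simp [pow_two]; ring

end Dual

section Gmon

variable {R S : Type*} [CommRing R] [CommRing S]

/-- The monic polynomial of degree `n` with lower-order coefficients `a`, over any ring. -/
noncomputable def gmon (n : ℕ) (a : Fin n → R) : R[X] :=
  X ^ n + ∑ i : Fin n, C (a i) * X ^ (i : ℕ)

lemma degree_lower_lt (n : ℕ) (a : Fin n → R) :
    (∑ i : Fin n, C (a i) * X ^ (i : ℕ)).degree < (n : WithBot ℕ) := by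
  refine (degree_sum_le _ _).trans_lt ?_
  refine (Finset.sup_lt_iff (WithBot.bot_lt_coe n)).mpr ?_
  intro i _
  exact (degree_C_mul_X_pow_le _ _).trans_lt (WithBot.coe_lt_coe.mpr i.2)

lemma coeff_lower (n : ℕ) (a : Fin n → R) (i : Fin n) :
    (∑ i : Fin n, C (a i) * X ^ (i : ℕ)).coeff i = a i := by
  simp only [finsetSum_coeff, coeff_C_mul_X_pow]
  rw [Finset.sum_eq_single i]
  · simp
  · intro j _ hj
    rw [if_neg fun h => hj (Fin.ext h).symm]
  · simp

lemma monic_gmon (n : ℕ) (a : Fin n → R) : (gmon n a).Monic :=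
  monic_X_pow_add (degree_lower_lt n a)

lemma natDegree_gmon [Nontrivial R] (n : ℕ) (a : Fin n → R) : (gmon n a).natDegree = n := by
  rw [gmon, natDegree_add_eq_left_of_degree_lt, natDegree_X_pow]
  rw [degree_X_pow]
  exact degree_lower_lt n a

lemma coeff_gmon (n : ℕ) (a : Fin n → R) (i : Fin n) : (gmon n a).coeff i = a i := by
  rw [gmon, coeff_add, coeff_lower, coeff_X_pow, if_neg i.2.ne, zero_add]

lemma gmon_injective (n : ℕ) : Function.Injective (gmon n : (Fin n → R) → R[X]) := by
  intro a b h
  ext i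
  rw [← coeff_gmon n a, h, coeff_gmon]

lemma map_gmon (φ : R →+* S) (n : ℕ) (a : Fin n → R) :
    (gmon n a).map φ = gmon n fun i => φ (a i) := by
  simp [gmon, Polynomial.map_sum]

lemma lower_eq_of_degree_lt {n : ℕ} {f : R[X]} (h : f.degree < (n : WithBot ℕ)) :
    ∑ i : Fin n, C (f.coeff i) * X ^ (i : ℕ) = f := by
  ext k
  rcases lt_or_ge k n with hk | hk
  · exact coeff_lower n (fun i => f.coeff i) ⟨k, hk⟩
  · rw [coeff_eq_zero_of_degree_lt, coeff_eq_zero_of_degree_lt]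
    · exact h.trans_le (WithBot.coe_le_coe.mpr hk)
    · exact (degree_lower_lt n _).trans_le (WithBot.coe_le_coe.mpr hk)

lemma gmon_coeff {f : R[X]} (hf : f.Monic) {n : ℕ} (hn : f.natDegree = n) :
    gmon n (fun i => f.coeff i) = f := by
  subst hn
  rw [gmon, Fin.sum_univ_eq_sum_range (fun i => C (f.coeff i) * X ^ i)]
  exact hf.as_sum.symm

end Gmon

section Divisors

variable {F : Type} [Field F] [Fintype F]

open Classical in
/-- The monic divisors of a polynomial. -/
noncomputable def mdiv (f : F[X]) : Finset F[X] :=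
  ((Finset.range (f.natDegree + 1)).biUnion fun i =>
    Finset.univ.image (gmon i : (Fin i → F) → F[X])).filter (· ∣ f)

lemma mem_mdiv {f d : F[X]} (hf : f ≠ 0) : d ∈ mdiv f ↔ d.Monic ∧ d ∣ f := by
  simp only [mdiv, Finset.mem_filter, Finset.mem_biUnion, Finset.mem_range, Finset.mem_image,
    Finset.mem_univ, true_and]
  constructor
  · rintro ⟨⟨i, -, a, rfl⟩, h⟩
    exact ⟨monic_gmon _ _, h⟩
  · rintro ⟨h1, h2⟩
    exact ⟨⟨d.natDegree, Nat.lt_succ_of_le (natDegree_le_of_dvd h2 hf), _, gmon_coeff h1 rfl⟩, h2⟩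

open Classical in
lemma sum_mdiv_eq {f : F[X]} (hf : f ≠ 0) (w : ℕ → ℝ) (u : F[X] → ℝ) {s : Finset ℕ}
    (hs : ∀ i, w i ≠ 0 → i ≤ f.natDegree → i ∈ s) :
    ∑ d ∈ mdiv f, w d.natDegree * u d =
      ∑ i ∈ s, w i * ∑ a : Fin i → F, if gmon i a ∣ f then u (gmon i a) else 0 := by
  have hd : ∀ i : ℕ, (∑ a : Fin i → F, if gmon i a ∣ f then u (gmon i a) else 0) =
      ∑ d ∈ mdiv f with d.natDegree = i, u d := by
    intro i
    rw [← Finset.sum_filter]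
    refine Finset.sum_bij (fun a _ => gmon i a) ?_ ?_ ?_ ?_
    · intro a ha
      rw [Finset.mem_filter, mem_mdiv hf]
      exact ⟨⟨monic_gmon _ _, (Finset.mem_filter.mp ha).2⟩, natDegree_gmon _ _⟩
    · intro a _ b _ h
      exact gmon_injective i h
    · intro d hd
      rw [Finset.mem_filter, mem_mdiv hf] at hd
      have := gmon_coeff hd.1.1 hd.2
      exact ⟨_, Finset.mem_filter.mpr ⟨Finset.mem_univ _, by rw [this]; exact hd.1.2⟩, this⟩
    · intro _ _; rfl
  simp_rw [hd]
  rw [← Finset.sum_filter_add_sum_filter_not (mdiv f) (fun d => d.natDegree ∈ s),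
    Finset.sum_eq_zero (s := (mdiv f).filter fun d => ¬ d.natDegree ∈ s), add_zero,
    ← Finset.sum_fiberwise_of_maps_to (t := s) (g := fun d => d.natDegree)]
  · refine Finset.sum_congr rfl fun i hi => ?_
    rw [Finset.mul_sum, Finset.filter_filter]
    refine Finset.sum_congr ?_ ?_
    · ext d
      simp only [Finset.mem_filter]
      constructor
      · rintro ⟨a, -, c⟩; exact ⟨a, c⟩
      · rintro ⟨a, c⟩; exact ⟨a, c ▸ hi, c⟩
    · intro d hd
      rw [(Finset.mem_filter.mp hd).2]
  · intro d hd; exact (Finset.mem_filter.mp hd).2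
  · intro d hd
    obtain ⟨h1, h2⟩ := Finset.mem_filter.mp hd
    by_contra hne
    exact h2 (hs _ (left_ne_zero_of_mul hne)
      (natDegree_le_of_dvd ((mem_mdiv hf).mp h1).2 hf))

lemma mdiv_one : mdiv (1 : F[X]) = {1} := by
  ext d
  rw [mem_mdiv one_ne_zero, Finset.mem_singleton]
  constructor
  · rintro ⟨h, h'⟩
    exact h.eq_one_of_isUnit (isUnit_of_dvd_one h')
  · rintro rfl
    exact ⟨monic_one, dvd_rfl⟩

lemma sum_mdiv_prime_mul {P g : F[X]} (hP : P.Monic) (hi : Irreducible P) (hg : g.Monic)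
    (hPg : ¬ P ∣ g) (u : F[X] → ℝ) :
    ∑ d ∈ mdiv (P * g), u d = ∑ d ∈ mdiv g, (u d + u (P * d)) := by
  classical
  have h0 : P * g ≠ 0 := (hP.mul hg).ne_zero
  have : mdiv (P * g) = mdiv g ∪ (mdiv g).image (P * ·) := by
    ext d
    rw [Finset.mem_union, Finset.mem_image, mem_mdiv h0, mem_mdiv hg.ne_zero]
    constructor
    · rintro ⟨h1, h2⟩
      by_cases hPd : P ∣ d
      · right
        obtain ⟨e, rfl⟩ := hPd
        refine ⟨e, (mem_mdiv hg.ne_zero).mpr ⟨hP.of_mul_monic_left h1, ?_⟩, rfl⟩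
        exact (mul_dvd_mul_iff_left hP.ne_zero).mp h2
      · left
        exact ⟨h1, ((hi.coprime_iff_not_dvd.mpr hPd).symm).dvd_of_dvd_mul_left h2⟩
    · rintro (⟨h1, h2⟩ | ⟨e, he, rfl⟩)
      · exact ⟨h1, h2.mul_left _⟩
      · obtain ⟨h1, h2⟩ := (mem_mdiv hg.ne_zero).mp he
        exact ⟨hP.mul h1, mul_dvd_mul_left _ h2⟩
  rw [this, Finset.sum_union, Finset.sum_image, ← Finset.sum_add_distrib]
  · intro x _ y _ h
    exact mul_left_cancel₀ hP.ne_zero h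
  · rw [Finset.disjoint_left]
    intro d hd hd'
    obtain ⟨e, he, rfl⟩ := Finset.mem_image.mp hd'
    exact hPg ((dvd_mul_right P e).trans ((mem_mdiv hg.ne_zero).mp hd).2)

omit [Fintype F] in
lemma exists_prime_mul {f : F[X]} (hf : f.Monic) (hs : Squarefree f) (h1 : f ≠ 1) :
    ∃ P g : F[X], P.Monic ∧ Irreducible P ∧ g.Monic ∧ Squarefree g ∧ ¬ P ∣ g ∧ f = P * g := by
  obtain ⟨P, hP, hi, g, rfl⟩ := exists_monic_irreducible_factor f (fun h => h1 (hf.eq_one_of_isUnit h))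
  refine ⟨P, g, hP, hi, hP.of_mul_monic_left hf, hs.squarefree_of_dvd (dvd_mul_left g P), ?_, rfl⟩
  intro h
  exact hi.not_isUnit (hs P (mul_dvd_mul_left _ h))

variable (hodd : Odd (Fintype.card F))
include hodd

lemma sum_polyMu_mdiv {f : F[X]} (hf : f.Monic) (hs : Squarefree f) (h1 : f ≠ 1) :
    ∑ d ∈ mdiv f, polyMu d = 0 := by
  obtain ⟨P, g, hP, hi, hg, hgs, hPg, rfl⟩ := exists_prime_mul hf hs h1
  rw [sum_mdiv_prime_mul hP hi hg hPg]
  refine Finset.sum_eq_zero fun d hd => ?_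
  obtain ⟨hd1, hd2⟩ := (mem_mdiv hg.ne_zero).mp hd
  rw [polyMu_mul hP hd1 (hi.coprime_iff_not_dvd.mpr fun h => hPg (h.trans hd2)),
    polyMu_irreducible hodd hP hi]
  ring

lemma sum_polyMu_mul_natDegree_mdiv {f : F[X]} (hf : f.Monic) (hs : Squarefree f) :
    ∑ d ∈ mdiv f, polyMu d * d.natDegree = -Lam f := by
  classical
  by_cases h1 : f = 1
  · rw [h1, mdiv_one, Finset.sum_singleton, natDegree_one, Nat.cast_zero, mul_zero, Lam, dif_neg,
      neg_zero]
    rintro ⟨P, -, hi, k, hk, h⟩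
    exact hi.not_isUnit (isUnit_of_dvd_one (h ▸ dvd_pow_self P (by omega)))
  obtain ⟨P, g, hP, hi, hg, hgs, hPg, rfl⟩ := exists_prime_mul hf hs h1
  have hL : Lam (P * g) = if g = 1 then (P.natDegree : ℝ) else 0 := by
    have key : ∀ Q : F[X], Q.Monic → Irreducible Q → ∀ k : ℕ, 1 ≤ k → P * g = Q ^ k →
        g = 1 ∧ P = Q := by
      intro Q hQ hQi k hk h
      have hk1 : k = 1 := by
        by_contra hne
        refine hQi.not_isUnit (hs Q ?_)
        rw [h, ← pow_two]
        exact pow_dvd_pow _ (by omega)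
      rw [hk1, pow_one] at h
      have hg1 : g = 1 := by
        rw [← h] at hQi
        exact hg.eq_one_of_isUnit ((hQi.isUnit_or_isUnit rfl).resolve_left hi.not_isUnit)
      exact ⟨hg1, by rw [← h, hg1, mul_one]⟩
    rw [Lam]
    split_ifs with h hg1 hg1
    · exact congrArg (fun Q : F[X] => (Q.natDegree : ℝ)) (key _ h.choose_spec.1 h.choose_spec.2.1 _
        h.choose_spec.2.2.choose_spec.1 h.choose_spec.2.2.choose_spec.2).2.symm
    · exact absurd (key _ h.choose_spec.1 h.choose_spec.2.1 _
        h.choose_spec.2.2.choose_spec.1 h.choose_spec.2.2.choose_spec.2).1 hg1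
    · exact absurd ⟨P, hP, hi, 1, le_rfl, by rw [hg1, mul_one, pow_one]⟩ h
    · rfl
  have hsum : ∑ d ∈ mdiv g, polyMu d = if g = 1 then 1 else 0 := by
    split_ifs with hg1
    · rw [hg1, mdiv_one, Finset.sum_singleton, polyMu_one]
    · exact sum_polyMu_mdiv hodd hg hgs hg1
  rw [sum_mdiv_prime_mul hP hi hg hPg, hL]
  have : ∀ d ∈ mdiv g, polyMu d * d.natDegree + polyMu (P * d) * (P * d).natDegree =
      -P.natDegree * polyMu d := by
    intro d hd
    obtain ⟨hd1, hd2⟩ := (mem_mdiv hg.ne_zero).mp hd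
    rw [polyMu_mul hP hd1 (hi.coprime_iff_not_dvd.mpr fun h => hPg (h.trans hd2)),
      polyMu_irreducible hodd hP hi, hP.natDegree_mul hd1]
    push_cast
    ring
  rw [Finset.sum_congr rfl this, ← Finset.mul_sum, hsum]
  split_ifs <;> ring

omit hodd in
lemma sum_mdiv_reflect {f : F[X]} (hf : f.Monic) (hs : Squarefree f) (v : ℕ → ℝ) :
    ∑ d ∈ mdiv f, v d.natDegree * polyMu d =
      polyMu f * ∑ d ∈ mdiv f, v (f.natDegree - d.natDegree) * polyMu d := by
  have h0 := hf.ne_zero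
  rw [Finset.mul_sum]
  have hmod : ∀ d ∈ mdiv f, ∃ e, e.Monic ∧ f = d * e ∧ d.Monic ∧ f /ₘ d = e := by
    intro d hd
    obtain ⟨h1, e, rfl⟩ := (mem_mdiv h0).mp hd
    exact ⟨e, h1.of_mul_monic_left hf, rfl, h1, mul_divByMonic_cancel_left _ h1⟩
  refine Finset.sum_bij' (fun d _ => f /ₘ d) (fun d _ => f /ₘ d) ?_ ?_ ?_ ?_ ?_
  · intro d hd
    obtain ⟨e, he, hf', hd', h⟩ := hmod d hd
    rw [h, mem_mdiv h0]
    exact ⟨he, Dvd.intro_left _ hf'.symm⟩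
  · intro d hd
    obtain ⟨e, he, hf', hd', h⟩ := hmod d hd
    rw [h, mem_mdiv h0]
    exact ⟨he, Dvd.intro_left _ hf'.symm⟩
  · intro d hd
    obtain ⟨e, he, hf', hd', h⟩ := hmod d hd
    rw [h, hf', mul_comm, mul_divByMonic_cancel_left _ he]
  · intro d hd
    obtain ⟨e, he, hf', hd', h⟩ := hmod d hd
    rw [h, hf', mul_comm, mul_divByMonic_cancel_left _ he]
  · intro d hd
    obtain ⟨e, he, hf', hd', h⟩ := hmod d hd
    rw [h]
    have hc : IsCoprime d e := by
      rw [hf'] at hs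
      exact (squarefree_mul_iff.mp hs).1.isCoprime
    have hes : Squarefree e := hs.squarefree_of_dvd (Dvd.intro_left _ hf'.symm)
    have := polyMu_sq he hes
    rw [hf', hd'.natDegree_mul he, polyMu_mul hd' he hc, Nat.add_sub_cancel]
    linear_combination -(v d.natDegree) * polyMu d * this

open Classical in
lemma Lam_eq_mul_sum {f : F[X]} (hf : f.Monic) (hs : Squarefree f) (h1 : f ≠ 1) :
    Lam f = (1 - polyMu f) * ∑ i ∈ (Finset.range f.natDegree).filter fun i => 2 * i < f.natDegree,
      ((f.natDegree : ℝ) / 2 - i) *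
        ∑ a : Fin i → F, if gmon i a ∣ f then polyMu (gmon i a) else 0 := by
  set n := f.natDegree with hn
  rw [show (∑ i ∈ (Finset.range n).filter fun i => 2 * i < n, ((n : ℝ) / 2 - i) *
        ∑ a : Fin i → F, if gmon i a ∣ f then polyMu (gmon i a) else 0) =
      ∑ i ∈ (Finset.range n).filter fun i => 2 * i < n,
        (if 2 * i < n then ((n : ℝ) / 2 - i) else 0) *
        ∑ a : Fin i → F, if gmon i a ∣ f then polyMu (gmon i a) else 0 from
    Finset.sum_congr rfl fun i hi => by rw [if_pos (Finset.mem_filter.mp hi).2],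
    ← sum_mdiv_eq hf.ne_zero (fun i => if 2 * i < n then ((n : ℝ) / 2 - i) else 0) polyMu]
  · have h2 := sum_polyMu_mul_natDegree_mdiv hodd hf hs
    have h3 := sum_polyMu_mdiv hodd hf hs h1
    have h4 := sum_mdiv_reflect hf hs fun i => if 2 * i < n then ((n : ℝ) / 2 - i) else 0
    have h5 : Lam f = ∑ d ∈ mdiv f, ((n : ℝ) / 2 - d.natDegree) * polyMu d := by
      simp only [sub_mul, Finset.sum_sub_distrib]
      rw [← Finset.mul_sum, h3, mul_zero, zero_sub, ← neg_eq_iff_eq_neg.mpr h2]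
      simp_rw [mul_comm]
    have h6 := polyMu_sq hf hs
    rw [sub_mul, one_mul, h5, h4, ← mul_assoc, ← pow_two, h6, one_mul, ← h4,
      ← Finset.sum_sub_distrib]
    refine Finset.sum_congr rfl fun d hd => ?_
    have hle : d.natDegree ≤ n := natDegree_le_of_dvd ((mem_mdiv hf.ne_zero).mp hd).2 hf.ne_zero
    rw [← sub_mul]
    congr 1
    simp only [← hn, Nat.cast_sub hle]
    rcases lt_trichotomy (2 * d.natDegree) n with h | h | h
    · rw [if_pos h, if_neg (by omega)]; ring
    · rw [if_neg (by omega), if_neg (by omega), ← h]; push_cast; ring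
    · rw [if_neg (by omega), if_pos (by omega)]; ring
  · intro i hi _
    have : 2 * i < n := by
      by_contra h
      exact hi (if_neg h)
    rw [Finset.mem_filter, Finset.mem_range]
    omega

end Divisors

section Universal

/-- The polynomial of degree less than `n` with coefficients `k`. -/
noncomputable def lowp {S : Type*} [CommRing S] (n : ℕ) (k : Fin n → S) : S[X] :=
  ∑ l : Fin n, C (k l) * X ^ (l : ℕ)

lemma map_lowp {R S : Type*} [CommRing R] [CommRing S] (φ : R →+* S) (n : ℕ) (k : Fin n → R) :
    (lowp n k).map φ = lowp n fun i => φ (k i) := by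
  simp [lowp, Polynomial.map_sum]

/-- The values of the variables of the universal ring. -/
def vars {S : Type*} {i j m n : ℕ} (a : Fin i → S) (b : Fin j → S) (g : Fin m → S)
    (k : Fin n → S) : (Fin i ⊕ Fin j ⊕ Fin m) ⊕ Fin n → S :=
  Sum.elim (Sum.elim a (Sum.elim b g)) k

lemma exists_bezout_gmon {R : Type*} [CommRing R] [Nontrivial R] (i j : ℕ) (a : Fin i → R)
    (b : Fin j → R) :
    ∃ U V : R[X], gmon i a * U + gmon j b * V = C (resultant (gmon i a) (gmon j b) i j) := by
  by_cases h : i ≠ 0 ∨ j ≠ 0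
  · obtain ⟨U, V, -, -, e⟩ := exists_mul_add_mul_eq_C_resultant (gmon i a) (gmon j b)
      (natDegree_gmon i a).le (natDegree_gmon j b).le h
    exact ⟨U, V, e⟩
  · push Not at h
    obtain ⟨rfl, rfl⟩ := h
    exact ⟨1, 0, by simp [gmon]⟩

lemma exists_universal (i j m n : ℕ) (ε ε' : ℕ) :
    ∃ (W : (MvPolynomial ((Fin i ⊕ Fin j ⊕ Fin m) ⊕ Fin n) ℤ)[X])
      (H : (MvPolynomial ((Fin i ⊕ Fin j ⊕ Fin m) ⊕ Fin n) ℤ)[X]),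
      ∀ (S : Type) [CommRing S] [Nontrivial S] (a : Fin i → S) (b : Fin j → S) (g : Fin m → S)
        (k : Fin n → S) (t : S) (w : S[X]) (r : S),
        w = W.map (MvPolynomial.aeval (vars a b g k) : _ →ₐ[ℤ] S).toRingHom →
        r = resultant (gmon i a) (gmon j b) i j →
        gmon i a ∣ w ∧ gmon j b ∣ w + C r * lowp n k ∧ w.degree < ((i + j : ℕ) : WithBot ℕ) ∧
        spec (vars a b g k) t H =
          r ^ 2 * dsc i (gmon i a) * dsc j (gmon j b) *
          (r * dsc n (w + C r * (gmon i a * gmon j b) *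
            gmon (m + 1) (Fin.cons t g : Fin (m + 1) → S))) ^ ε *
          (r * dsc n (w + C r * (gmon i a * gmon j b) *
            gmon (m + 1) (Fin.cons t g : Fin (m + 1) → S) + C r * lowp n k)) ^ ε' := by
  let R₀ := MvPolynomial ((Fin i ⊕ Fin j ⊕ Fin m) ⊕ Fin n) ℤ
  let va : Fin i → R₀ := fun s => MvPolynomial.X (Sum.inl (Sum.inl s))
  let vb : Fin j → R₀ := fun s => MvPolynomial.X (Sum.inl (Sum.inr (Sum.inl s)))
  let vg : Fin m → R₀ := fun s => MvPolynomial.X (Sum.inl (Sum.inr (Sum.inr s)))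
  let vk : Fin n → R₀ := fun s => MvPolynomial.X (Sum.inr s)
  let r₀ : R₀ := resultant (gmon i va) (gmon j vb) i j
  obtain ⟨U, V, hUV⟩ := exists_bezout_gmon i j va vb
  let W : R₀[X] := (-(lowp n vk) * U * gmon i va) %ₘ (gmon i va * gmon j vb)
  have hmon : (gmon i va * gmon j vb).Monic := (monic_gmon i va).mul (monic_gmon j vb)
  have hW : W + (gmon i va * gmon j vb) * ((-(lowp n vk) * U * gmon i va) /ₘ (gmon i va * gmon j vb)) =
    -(lowp n vk) * U * gmon i va := modByMonic_add_div _ _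
  have hW1 : gmon i va ∣ W :=
    ⟨-(lowp n vk) * U - gmon j vb * ((-(lowp n vk) * U * gmon i va) /ₘ (gmon i va * gmon j vb)), by
      linear_combination hW⟩
  have hW2 : gmon j vb ∣ W + C r₀ * lowp n vk :=
    ⟨lowp n vk * V - gmon i va * ((-(lowp n vk) * U * gmon i va) /ₘ (gmon i va * gmon j vb)), by
      linear_combination hW - lowp n vk * hUV⟩
  let Φ : R₀[X][X] := W.map C + C (C r₀) * ((gmon i va * gmon j vb).map C) *
    gmon (m + 1) (Fin.cons X (fun s => C (vg s)) : Fin (m + 1) → R₀[X])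
  let H : R₀[X] := C (r₀ ^ 2 * dsc i (gmon i va) * dsc j (gmon j vb)) * (C r₀ * dsc n Φ) ^ ε *
    (C r₀ * dsc n (Φ + C (C r₀) * (lowp n vk).map C)) ^ ε'
  refine ⟨W, H, fun S _ _ a b g k t w r hw hr => ?_⟩
  let φ : R₀ →+* S := (MvPolynomial.aeval (vars a b g k) : _ →ₐ[ℤ] S).toRingHom
  have hw' : w = W.map φ := hw
  have hφX : ∀ v, φ (MvPolynomial.X v) = vars a b g k v := fun v => MvPolynomial.aeval_X _ v
  have ha : (gmon i va).map φ = gmon i a := by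
    rw [map_gmon]; congr 1; ext s; exact hφX _
  have hb : (gmon j vb).map φ = gmon j b := by
    rw [map_gmon]; congr 1; ext s; exact hφX _
  have hk : (lowp n vk).map φ = lowp n k := by
    rw [map_lowp]; congr 1; ext s; exact hφX _
  have hr' : φ r₀ = r := by
    rw [hr, ← ha, ← hb, resultant_map_map]
  refine ⟨?_, ?_, ?_, ?_⟩
  · rw [hw', ← ha]; exact Polynomial.map_dvd φ hW1
  · rw [hw', ← hb, ← hk, ← hr', ← map_C, ← Polynomial.map_mul, ← Polynomial.map_add]
    exact Polynomial.map_dvd φ hW2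
  · rw [hw']
    refine degree_map_le.trans_lt ((degree_modByMonic_lt _ hmon).trans_le ?_)
    rw [degree_eq_natDegree hmon.ne_zero, (monic_gmon i va).natDegree_mul (monic_gmon j vb),
      natDegree_gmon, natDegree_gmon]
  · have hspecC : (spec (vars a b g k) t).comp C = φ := by
      ext s <;> simp [spec, φ]
    have hspecC' : ∀ s, spec (vars a b g k) t (C s) = φ s := fun s => by rw [← hspecC]; rfl
    have hX : spec (vars a b g k) t X = t := by simp [spec]
    have hg : (gmon (m + 1) (Fin.cons X (fun s => C (vg s)) : Fin (m + 1) → R₀[X])).map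
        (spec (vars a b g k) t) = gmon (m + 1) (Fin.cons t g : Fin (m + 1) → S) := by
      rw [map_gmon]; congr 1; ext s
      refine Fin.cases ?_ (fun s => ?_) s
      · simp [hX]
      · exact (hspecC' _).trans (hφX _)
    have hΦ : Φ.map (spec (vars a b g k) t) = w + C r * (gmon i a * gmon j b) *
            gmon (m + 1) (Fin.cons t g : Fin (m + 1) → S) := by
      simp only [Φ, Polynomial.map_add, Polynomial.map_mul, Polynomial.map_map, hspecC, map_C, hg,
        hspecC', ha, hb, hr', hw']
    simp only [H, map_mul, map_pow, hspecC', map_dsc, Polynomial.map_add, hΦ, Polynomial.map_mul,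
      Polynomial.map_map, hspecC, map_C, hk, hr', ha, hb]

end Universal

section Example

variable {E : Type} [Field E] [IsAlgClosed E]

lemma isCoprime_iff_forall_eval (f g : E[X]) :
    IsCoprime f g ↔ ∀ x, f.eval x ≠ 0 ∨ g.eval x ≠ 0 := by
  rw [isCoprime_iff_aeval_ne_zero_of_isAlgClosed E E]
  simp [coe_aeval_eq_eval]

lemma exists_monic_dvd_natDegree_eq {p : E[X]} (hp : p.Monic) {i : ℕ} (hi : i ≤ p.natDegree) :
    ∃ d : E[X], d.Monic ∧ d.natDegree = i ∧ d ∣ p := by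
  induction i with
  | zero => exact ⟨1, monic_one, natDegree_one, one_dvd _⟩
  | succ i ih =>
    obtain ⟨d, hd, hdi, e, rfl⟩ := ih (by omega)
    have he := hd.of_mul_monic_left hp
    rw [hd.natDegree_mul he] at hi
    obtain ⟨x, hx⟩ := IsAlgClosed.exists_root e (by
      rw [degree_eq_natDegree he.ne_zero]
      exact_mod_cast (by omega : e.natDegree ≠ 0))
    refine ⟨d * (X - C x), hd.mul (monic_X_sub_C x), ?_, mul_dvd_mul_left _ (dvd_iff_isRoot.mpr hx)⟩
    rw [hd.natDegree_mul (monic_X_sub_C x), natDegree_X_sub_C, hdi]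

/-- Coprime pencils with nonzero Wronskian are separable outside a finite set. -/
lemma finite_not_separable_pencil {A B : E[X]} (hAB : IsCoprime A B)
    (hw : derivative A * B - A * derivative B ≠ 0) :
    {s : E | ¬ (A + C s * B).Separable}.Finite := by
  classical
  refine ((derivative A * B - A * derivative B).roots.toFinset.image
    fun x => -A.eval x / B.eval x).finite_toSet.subset ?_
  intro s hs
  rw [Set.mem_ofPred_eq, separable_def, isCoprime_iff_forall_eval] at hs
  push Not at hs
  obtain ⟨x, h1, h2⟩ := hs
  rw [eval_add, eval_mul, eval_C] at h1
  rw [derivative_add, derivative_C_mul, eval_add, eval_mul, eval_C] at h2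
  have hB : B.eval x ≠ 0 := by
    intro hB
    rw [hB, mul_zero, add_zero] at h1
    rcases (isCoprime_iff_forall_eval A B).mp hAB x with h | h
    · exact h h1
    · exact h hB
  rw [Finset.coe_image]
  refine ⟨x, ?_, ?_⟩
  · rw [Finset.mem_coe, Multiset.mem_toFinset, mem_roots hw, IsRoot, eval_sub, eval_mul, eval_mul]
    linear_combination B.eval x * h2 - (derivative B).eval x * h1
  · rw [div_eq_iff hB]
    linear_combination -h1

lemma finite_not_coprime_pencil {A B : E[X]} (hB : B ≠ 0) :
    {s : E | ¬ IsCoprime (A + C s) B}.Finite := by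
  classical
  refine (B.roots.toFinset.image fun x => -A.eval x).finite_toSet.subset ?_
  intro s hs
  rw [Set.mem_ofPred_eq, isCoprime_iff_forall_eval] at hs
  push Not at hs
  obtain ⟨x, h1, h2⟩ := hs
  rw [Finset.coe_image]
  refine ⟨x, ?_, ?_⟩
  · rw [Finset.mem_coe, Multiset.mem_toFinset, mem_roots hB]
    exact h2
  · rw [eval_add, eval_C] at h1
    linear_combination -h1

lemma exists_eval_ne_zero_of_finite {K : E[X]} (hK : K ≠ 0) {s : Set E} (hs : s.Finite) :
    ∃ c, K.eval c ≠ 0 ∧ c ∉ s := by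
  classical
  obtain ⟨c, hc⟩ := (hs.union K.roots.toFinset.finite_toSet).infinite_compl.nonempty
  refine ⟨c, fun h => hc (Or.inr ?_), fun h => hc (Or.inl h)⟩
  rw [Finset.mem_coe, Multiset.mem_toFinset, mem_roots hK]
  exact h

lemma exists_special_pair (h2 : (2 : E) ≠ 0) {n : ℕ} (hn : 2 ≤ n) {K : E[X]} (hK : K ≠ 0)
    (hKn : K.degree < (n : WithBot ℕ)) :
    ∃ (c : E) (h : E[X]), h.Monic ∧ h.natDegree + 2 = n ∧ h.Separable ∧ h.eval c ≠ 0 ∧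
      K.eval c ≠ 0 ∧ IsCoprime ((X - C c) ^ 2 * h) K ∧ ((X - C c) ^ 2 * h + K).Separable := by
  classical
  obtain ⟨m, rfl⟩ := Nat.exists_eq_add_of_le' hn
  rcases Nat.eq_zero_or_pos m with rfl | hm
  · set k0 := K.coeff 0 with hk0
    set k1 := K.coeff 1 with hk1
    have hKe : K = C k1 * X + C k0 := by
      exact eq_X_add_C_of_degree_le_one (Order.le_of_lt_succ hKn)
    have hQ : C (k1 ^ 2 - 4 * k0) - C (4 * k1) * X ≠ (0 : E[X]) := by
      intro h
      have h0 := congrArg (coeff · 0) h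
      have h1 := congrArg (coeff · 1) h
      have h4 : (4 : E) ≠ 0 := by
        have : (4 : E) = 2 * 2 := by norm_num
        rw [this]; exact mul_ne_zero h2 h2
      simp [coeff_C, -map_pow, -map_sub, -map_mul] at h0 h1
      have h1' := h1.resolve_left h4
      rw [h1'] at h0
      have h0' : k0 = 0 := by simpa [h4] using h0
      exact hK (by rw [hKe, h1', h0']; simp)
    obtain ⟨c, hc, hc'⟩ := exists_eval_ne_zero_of_finite hK
      (C (k1 ^ 2 - 4 * k0) - C (4 * k1) * X : E[X]).roots.toFinset.finite_toSet
    refine ⟨c, 1, monic_one, by simp, separable_one, by simp, hc, ?_, ?_⟩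
    · rw [mul_one]
      exact IsCoprime.pow_left ((irreducible_X_sub_C c).coprime_iff_not_dvd.mpr
        fun h => hc (dvd_iff_isRoot.mp h))
    · have hm : ((X - C c) ^ 2 * 1 + K).Monic := by
        rw [mul_one]
        refine ((monic_X_sub_C c).pow 2).add_of_left ?_
        rw [degree_pow, degree_X_sub_C]; exact hKn
      have hd : ((X - C c) ^ 2 * 1 + K).natDegree = 2 := by
        rw [mul_one, natDegree_add_eq_left_of_degree_lt, natDegree_pow, natDegree_X_sub_C]
        rw [degree_pow, degree_X_sub_C]; exact hKn
      rw [← isUnit_dsc_iff hm, hd, dsc_two hm hd, isUnit_iff_ne_zero]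
      intro h0
      apply hc'
      rw [Finset.mem_coe, Multiset.mem_toFinset, mem_roots hQ, IsRoot, ← h0]
      have : (X - C c) ^ 2 * 1 + K = X ^ 2 + C (k1 - 2 * c) * X + C (c ^ 2 + k0) := by
        rw [hKe]
        simp only [C_mul, C_add, C_sub, C_pow, C_ofNat]
        ring
      rw [this]
      simp [coeff_X_pow, -map_pow, coeff_C]
      ring
  · obtain ⟨c, hc, -⟩ := exists_eval_ne_zero_of_finite hK Set.finite_empty
    let h0 : E[X] := X ^ m + if m = 1 then 0 else X
    have hh0 : ∀ s, (h0 + C s).Monic ∧ (h0 + C s).natDegree = m := by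
      intro s
      have hd : ((if m = 1 then 0 else X : E[X]) + C s).degree < (m : WithBot ℕ) := by
        refine (degree_add_le _ _).trans_lt (max_lt ?_ (degree_C_le.trans_lt (by exact_mod_cast hm)))
        split_ifs with h
        · rw [degree_zero]; exact WithBot.bot_lt_coe m
        · rw [degree_X]; exact_mod_cast (by omega : 1 < m)
      have e : h0 + C s = X ^ m + ((if m = 1 then 0 else X : E[X]) + C s) := add_assoc _ _ _
      rw [e]
      refine ⟨monic_X_pow_add hd, ?_⟩
      rw [natDegree_add_eq_left_of_degree_lt, natDegree_X_pow]
      rw [degree_X_pow]; exact hd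
    have hder : derivative h0 ≠ 0 := by
      intro h
      have h := congrArg (eval 0) h
      by_cases h1 : m = 1
      · subst h1
        simp [h0] at h
      · have : m - 1 ≠ 0 := by omega
        simp [h0, h1, this, derivative_X_pow] at h
    have f1 : {s : E | ¬ (h0 + C s * 1).Separable}.Finite :=
      finite_not_separable_pencil isCoprime_one_right (by simpa using hder)
    have f2 : {s : E | ¬ IsCoprime (h0 + C s) ((X - C c) * K)}.Finite :=
      finite_not_coprime_pencil (mul_ne_zero (X_sub_C_ne_zero c) hK)
    have hcK : IsCoprime (X - C c) K := ((irreducible_X_sub_C c).coprime_iff_not_dvd.mpr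
        fun h => hc (dvd_iff_isRoot.mp h))
    have f3 : {s : E | ¬ (((X - C c) ^ 2 * h0 + K) + C s * (X - C c) ^ 2).Separable}.Finite := by
      refine finite_not_separable_pencil ?_ ?_
      · rw [add_comm, IsCoprime.add_mul_left_left_iff]
        exact hcK.symm.pow_right
      · intro h
        have hfac : (X - C c) * (derivative ((X - C c) ^ 2 * h0 + K) * (X - C c) -
            2 * ((X - C c) ^ 2 * h0 + K)) = 0 := by
          rw [← h]
          have h2C : (C 2 : E[X]) = 2 := map_ofNat C 2
          rw [derivative_X_sub_C_sq, h2C]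
          ring
        have := (mul_eq_zero.mp hfac).resolve_left (X_sub_C_ne_zero c)
        have := congrArg (eval c) this
        simp at this
        exact this.elim h2 hc
    obtain ⟨s, hs⟩ := (f1.union (f2.union f3)).infinite_compl.nonempty
    simp only [Set.mem_compl_iff, Set.mem_union, Set.mem_ofPred_eq, not_or, not_not, mul_one] at hs
    obtain ⟨s1, s2, s3⟩ := hs
    refine ⟨c, h0 + C s, (hh0 s).1, by rw [(hh0 s).2], s1, ?_, hc, ?_, ?_⟩
    · intro h
      have := (isCoprime_iff_forall_eval _ _).mp s2 c
      simp [h] at this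
    · exact IsCoprime.mul_left hcK.pow_left (s2.of_isCoprime_of_dvd_right (dvd_mul_left _ _))
    · convert s3 using 1
      ring

end Example

section Pencil

lemma mul_dsc_C_mul {R : Type*} [CommRing R] {n : ℕ} (hn : n ≠ 0) (r : R) (f : R[X]) :
    r * dsc n (C r * f) = (r ^ n) ^ 2 * dsc n f := by
  obtain ⟨n, rfl⟩ := Nat.exists_eq_succ_of_ne_zero hn
  rw [dsc, dsc, derivative_C_mul, resultant_C_mul_left, resultant_C_mul_right]
  simp only [Nat.succ_eq_add_one, Nat.add_sub_cancel]
  ring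

variable {F : Type} [Field F]

lemma lowp_coeff {n : ℕ} {K : F[X]} (hK : K.degree < (n : WithBot ℕ)) :
    lowp n (fun l : Fin n => K.coeff l) = K :=
  lower_eq_of_degree_lt hK

lemma resultant_gmon_ne_zero_iff {i j : ℕ} (a : Fin i → F) (b : Fin j → F) :
    resultant (gmon i a) (gmon j b) i j ≠ 0 ↔ IsCoprime (gmon i a) (gmon j b) := by
  have h := resultant_eq_zero_iff (f := gmon i a) (g := gmon j b)
  rw [natDegree_gmon, natDegree_gmon] at h
  rw [ne_eq, h]
  simp [(monic_gmon i a).ne_zero]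

open Classical in
lemma sum_add_mul_gmon [Fintype F] {D v : F[X]} {e M n : ℕ} (hD : D.Monic) (he : D.natDegree = e)
    (hn : n = e + M) (hv : v.degree < (n : WithBot ℕ)) (G : F[X] → ℝ) :
    ∑ h : Fin M → F, G (v + D * gmon M h) =
      ∑ c : Fin n → F, if D ∣ gmon n c - v then G (gmon n c) else 0 := by
  have key : ∀ h : Fin M → F, (D * gmon M h).Monic ∧ (D * gmon M h).natDegree = n := fun h =>
    ⟨hD.mul (monic_gmon M h), by
      rw [hD.natDegree_mul (monic_gmon M h), natDegree_gmon, he, hn]⟩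
  have key2 : ∀ h : Fin M → F, (v + D * gmon M h).Monic ∧ (v + D * gmon M h).natDegree = n := by
    intro h
    obtain ⟨h1, h2⟩ := key h
    have hd : v.degree < (D * gmon M h).degree := by
      rw [degree_eq_natDegree h1.ne_zero, h2]; exact hv
    exact ⟨h1.add_of_right hd, by rw [natDegree_add_eq_right_of_degree_lt hd, h2]⟩
  rw [← Finset.sum_filter]
  refine Finset.sum_bij (fun h _ l => (v + D * gmon M h).coeff l) ?_ ?_ ?_ ?_
  · intro h _
    rw [Finset.mem_filter, gmon_coeff (key2 h).1 (key2 h).2]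
    exact ⟨Finset.mem_univ _, by rw [add_sub_cancel_left]; exact dvd_mul_right _ _⟩
  · intro h _ h' _ e
    have e' := congrArg (gmon n) e
    rw [gmon_coeff (key2 h).1 (key2 h).2, gmon_coeff (key2 h').1 (key2 h').2] at e'
    exact gmon_injective M (mul_left_cancel₀ hD.ne_zero (add_left_cancel e'))
  · intro c hc
    rw [Finset.mem_filter] at hc
    obtain ⟨p, hp⟩ := hc.2
    have hd : v.degree < (gmon n c).degree := by
      rw [degree_eq_natDegree (monic_gmon n c).ne_zero, natDegree_gmon]; exact hv
    have hm : (D * p).Monic := by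
      rw [← hp]
      exact (monic_gmon n c).sub_of_left hd
    have hpm : p.Monic := hD.of_mul_monic_left hm
    have hpd : p.natDegree = M := by
      have : (D * p).natDegree = n := by
        rw [← hp, natDegree_eq_of_degree_eq (degree_sub_eq_left_of_degree_lt hd), natDegree_gmon]
      rw [hD.natDegree_mul hpm] at this
      omega
    refine ⟨fun l => p.coeff l, Finset.mem_univ _, ?_⟩
    apply gmon_injective n
    rw [gmon_coeff (key2 _).1 (key2 _).2, gmon_coeff hpm hpd, ← hp]
    ring
  · intro h _
    rw [gmon_coeff (key2 h).1 (key2 h).2]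

lemma mul_dvd_sub_iff {d₁ d₂ v K : F[X]} (hc : IsCoprime d₁ d₂) (h1 : d₁ ∣ v) (h2 : d₂ ∣ v + K)
    (f : F[X]) : d₁ * d₂ ∣ f - v ↔ d₁ ∣ f ∧ d₂ ∣ f + K := by
  have e : f - v = f + K - (v + K) := by ring
  constructor
  · intro h
    refine ⟨(dvd_sub_left h1).mp ((dvd_mul_right _ _).trans h), (dvd_sub_left h2).mp ?_⟩
    rw [← e]
    exact (dvd_mul_left _ _).trans h
  · rintro ⟨h3, h4⟩
    refine hc.mul_dvd (dvd_sub h3 h1) ?_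
    rw [e]
    exact dvd_sub h4 h2

/-- The universal property satisfied by the polynomials of `exists_universal`. -/
def IsUniversal {i j m n : ℕ} (ε δ : ℕ)
    (W H : (MvPolynomial ((Fin i ⊕ Fin j ⊕ Fin m) ⊕ Fin n) ℤ)[X]) : Prop :=
  ∀ (S : Type) [CommRing S] [Nontrivial S] (a : Fin i → S) (b : Fin j → S) (g : Fin m → S)
    (k : Fin n → S) (t : S) (w : S[X]) (r : S),
    w = W.map (MvPolynomial.aeval (vars a b g k) : _ →ₐ[ℤ] S).toRingHom →
    r = resultant (gmon i a) (gmon j b) i j →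
    gmon i a ∣ w ∧ gmon j b ∣ w + C r * lowp n k ∧ w.degree < ((i + j : ℕ) : WithBot ℕ) ∧
    spec (vars a b g k) t H =
      r ^ 2 * dsc i (gmon i a) * dsc j (gmon j b) *
      (r * dsc n (w + C r * (gmon i a * gmon j b) *
        gmon (m + 1) (Fin.cons t g : Fin (m + 1) → S))) ^ ε *
      (r * dsc n (w + C r * (gmon i a * gmon j b) *
        gmon (m + 1) (Fin.cons t g : Fin (m + 1) → S) + C r * lowp n k)) ^ δ

/-- The specialization of `W` does not depend on the third group of variables. -/
lemma IsUniversal.map_eq {i j m n ε ε' : ℕ}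
    {W H : (MvPolynomial ((Fin i ⊕ Fin j ⊕ Fin m) ⊕ Fin n) ℤ)[X]} (hH : IsUniversal ε ε' W H)
    (a : Fin i → F) (b : Fin j → F) (g g' : Fin m → F) (k : Fin n → F)
    (hab : IsCoprime (gmon i a) (gmon j b)) :
    W.map (MvPolynomial.aeval (vars a b g k) : _ →ₐ[ℤ] F).toRingHom =
      W.map (MvPolynomial.aeval (vars a b g' k) : _ →ₐ[ℤ] F).toRingHom := by
  obtain ⟨p1, p2, p3, -⟩ := hH F a b g' k 0 _ _ rfl rfl
  obtain ⟨q1, q2, q3, -⟩ := hH F a b g k 0 _ _ rfl rfl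
  refine sub_eq_zero.mp (eq_zero_of_dvd_of_degree_lt
    ((mul_dvd_sub_iff hab p1 p2 _).mpr ⟨q1, q2⟩) ?_)
  rw [degree_eq_natDegree ((monic_gmon i a).mul (monic_gmon j b)).ne_zero,
    (monic_gmon i a).natDegree_mul (monic_gmon j b), natDegree_gmon, natDegree_gmon]
  exact (degree_sub_le _ _).trans_lt (max_lt q3 p3)

omit [Field F] in
lemma sum_sum_cons [Fintype F] (m : ℕ) (G : (Fin (m + 1) → F) → ℝ) :
    ∑ g : Fin m → F, ∑ t : F, G (Fin.cons t g) = ∑ h : Fin (m + 1) → F, G h := by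
  rw [Finset.sum_comm, ← Fintype.sum_prod_type']
  exact Fintype.sum_equiv (Fin.consEquiv fun _ => F) _ _ fun _ => rfl

open Classical in
lemma sum_qchi_spec [Fintype F] {i j m n ε ε' : ℕ} (hn : n = i + j + m + 1)
    {W H : (MvPolynomial ((Fin i ⊕ Fin j ⊕ Fin m) ⊕ Fin n) ℤ)[X]} (hH : IsUniversal ε ε' W H)
    (a : Fin i → F) (b : Fin j → F) {K : F[X]} (hK : K.degree < (n : WithBot ℕ))
    (hab : IsCoprime (gmon i a) (gmon j b)) :
    ∑ c : Fin n → F, (if gmon i a ∣ gmon n c ∧ gmon j b ∣ gmon n c + K then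
      polyMu (gmon i a) * polyMu (gmon j b) * polyMu (gmon n c) ^ ε * polyMu (gmon n c + K) ^ ε'
      else 0) = (-1) ^ (i + j + n * ε + n * ε') *
    ∑ g : Fin m → F, ∑ t : F, qchi (spec (vars a b g fun l => K.coeff l) t H) := by
  set r := resultant (gmon i a) (gmon j b) i j with hr
  have hr0 : r ≠ 0 := (resultant_gmon_ne_zero_iff a b).mpr hab
  have hrr : C r * C r⁻¹ = (1 : F[X]) := by rw [← C_mul, mul_inv_cancel₀ hr0, C_1]
  have hmuf : ∀ f : F[X], f.Monic → f.natDegree = n → polyMu f = (-1) ^ n * qchi (dsc n f) := by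
    intro f _ hf
    rw [polyMu, hf]
  have hKc : ∀ c : Fin n → F, (gmon n c + K).Monic ∧ (gmon n c + K).natDegree = n := by
    intro c
    have hd : K.degree < (gmon n c).degree := by
      rw [degree_eq_natDegree (monic_gmon n c).ne_zero, natDegree_gmon]; exact hK
    exact ⟨(monic_gmon n c).add_of_left hd, by
      rw [natDegree_add_eq_left_of_degree_lt hd, natDegree_gmon]⟩
  set w₀ := W.map (MvPolynomial.aeval (vars a b (fun _ : Fin m => (0 : F)) fun l => K.coeff l) :
    _ →ₐ[ℤ] F).toRingHom with hw₀
  obtain ⟨p1, p2, p3, -⟩ := hH F a b (fun _ => 0) (fun l => K.coeff l) 0 w₀ r hw₀ hr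
  rw [lowp_coeff hK] at p2
  set D := gmon i a * gmon j b with hD
  have hDm : D.Monic := (monic_gmon i a).mul (monic_gmon j b)
  have hDd : D.natDegree = i + j := by
    rw [hD, (monic_gmon i a).natDegree_mul (monic_gmon j b), natDegree_gmon, natDegree_gmon]
  have hw : ∀ g : Fin m → F, W.map (MvPolynomial.aeval (vars a b g fun l => K.coeff l) :
      _ →ₐ[ℤ] F).toRingHom = w₀ :=
    fun g => hH.map_eq a b g _ _ hab
  set v := C r⁻¹ * w₀ with hv
  have hrv : C r * v = w₀ := by rw [hv, ← mul_assoc, hrr, one_mul]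
  have hvd : v.degree < (n : WithBot ℕ) := by
    rw [hv]
    refine (degree_C_mul_of_isUnit ?_ _).trans_lt (p3.trans_le ?_)
    · exact isUnit_iff_ne_zero.mpr (inv_ne_zero hr0)
    · exact_mod_cast (by omega : i + j ≤ n)
  have v1 : gmon i a ∣ v := p1.mul_left _
  have v2 : gmon j b ∣ v + K := by
    have : v + K = C r⁻¹ * (w₀ + C r * K) := by
      rw [hv]; linear_combination -K * hrr
    rw [this]
    exact p2.mul_left _
  have hterm : ∀ (g : Fin m → F) (t : F),
      qchi (spec (vars a b g fun l => K.coeff l) t H) =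
      qchi (dsc i (gmon i a)) * qchi (dsc j (gmon j b)) *
        qchi (dsc n (v + D * gmon (m + 1) (Fin.cons t g : Fin (m + 1) → F))) ^ ε *
        qchi (dsc n (v + D * gmon (m + 1) (Fin.cons t g : Fin (m + 1) → F) + K)) ^ ε' := by
    intro g t
    obtain ⟨-, -, -, h4⟩ := hH F a b g (fun l => K.coeff l) t w₀ r (hw g).symm hr
    have e1 : w₀ + C r * D * gmon (m + 1) (Fin.cons t g : Fin (m + 1) → F) =
        C r * (v + D * gmon (m + 1) (Fin.cons t g : Fin (m + 1) → F)) := by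
      rw [← hrv]; ring
    rw [h4, lowp_coeff hK, e1, ← mul_add, mul_dsc_C_mul (by omega), mul_dsc_C_mul (by omega)]
    simp only [qchi_mul, qchi_pow, mul_pow]
    have e2 : (qchi r ^ n) ^ 2 = 1 := by rw [← pow_mul, mul_comm, pow_mul, qchi_sq hr0, one_pow]
    rw [e2, qchi_sq hr0]
    simp only [one_pow, one_mul]
  have hsplit := sum_add_mul_gmon hDm hDd (M := m + 1) (by omega : n = i + j + (m + 1)) hvd
    (fun f => qchi (dsc i (gmon i a)) * qchi (dsc j (gmon j b)) *
        qchi (dsc n f) ^ ε * qchi (dsc n (f + K)) ^ ε')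
  simp only [hterm]
  rw [sum_sum_cons m (fun h => qchi (dsc i (gmon i a)) * qchi (dsc j (gmon j b)) *
        qchi (dsc n (v + D * gmon (m + 1) h)) ^ ε * qchi (dsc n (v + D * gmon (m + 1) h + K)) ^ ε'),
    hsplit, Finset.mul_sum]
  refine Finset.sum_congr rfl fun c _ => ?_
  have hiff : ∀ f, D ∣ f - v ↔ gmon i a ∣ f ∧ gmon j b ∣ f + K := mul_dvd_sub_iff hab v1 v2
  simp only [hiff]
  split_ifs
  · rw [hmuf _ (monic_gmon n c) (natDegree_gmon n c), hmuf _ (hKc c).1 (hKc c).2, polyMu, polyMu,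
      natDegree_gmon, natDegree_gmon]
    simp only [mul_pow, pow_add, ← pow_mul]
    ring
  · rw [mul_zero]

lemma spec_eq_zero [Fintype F] {i j m n ε ε' : ℕ}
    {W H : (MvPolynomial ((Fin i ⊕ Fin j ⊕ Fin m) ⊕ Fin n) ℤ)[X]} (hH : IsUniversal ε ε' W H)
    (a : Fin i → F) (b : Fin j → F) (g : Fin m → F) (k : Fin n → F) (t : F)
    (hab : ¬ IsCoprime (gmon i a) (gmon j b)) : spec (vars a b g k) t H = 0 := by
  have hr : (0 : F) = resultant (gmon i a) (gmon j b) i j := by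
    by_contra h
    exact hab ((resultant_gmon_ne_zero_iff a b).mp (Ne.symm h))
  rw [(hH F a b g k t _ 0 rfl hr).2.2.2]
  simp

open Classical in
/-- Away from pairs with a common factor, the sum over the family is a character sum. -/
lemma sum_pairs_eq [Fintype F] {i j m n ε ε' : ℕ} (hn : n = i + j + m + 1)
    {W H : (MvPolynomial ((Fin i ⊕ Fin j ⊕ Fin m) ⊕ Fin n) ℤ)[X]} (hH : IsUniversal ε ε' W H)
    {K : F[X]} (hK : K.degree < (n : WithBot ℕ)) :
    ∑ a : Fin i → F, ∑ b : Fin j → F, (if IsCoprime (gmon i a) (gmon j b) then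
      ∑ c : Fin n → F, (if gmon i a ∣ gmon n c ∧ gmon j b ∣ gmon n c + K then
        polyMu (gmon i a) * polyMu (gmon j b) * polyMu (gmon n c) ^ ε * polyMu (gmon n c + K) ^ ε'
        else 0) else 0) = (-1) ^ (i + j + n * ε + n * ε') *
    ∑ x : Fin i ⊕ Fin j ⊕ Fin m → F, ∑ t : F,
      qchi (spec (Sum.elim x fun l : Fin n => K.coeff l) t H) := by
  have e : ∑ x : Fin i ⊕ Fin j ⊕ Fin m → F, ∑ t : F,
      qchi (spec (Sum.elim x fun l : Fin n => K.coeff l) t H) =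
      ∑ a : Fin i → F, ∑ b : Fin j → F, ∑ g : Fin m → F, ∑ t : F,
        qchi (spec (vars a b g fun l => K.coeff l) t H) := by
    rw [← (Equiv.sumArrowEquivProdArrow (Fin i) (Fin j ⊕ Fin m) F).symm.sum_comp,
      Fintype.sum_prod_type]
    refine Finset.sum_congr rfl fun a _ => ?_
    rw [← (Equiv.sumArrowEquivProdArrow (Fin j) (Fin m) F).symm.sum_comp, Fintype.sum_prod_type]
    rfl
  rw [e, Finset.mul_sum]
  refine Finset.sum_congr rfl fun a _ => ?_
  rw [Finset.mul_sum]
  refine Finset.sum_congr rfl fun b _ => ?_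
  split_ifs with hab
  · exact sum_qchi_spec hn hH a b hK hab
  · simp [spec_eq_zero hH _ _ _ _ _ hab, qchi_zero]

end Pencil

section Special

variable {E : Type} [Field E]

/-- The value of the universal polynomial at a first-order deformation. -/
lemma spec_dual {i j m n ε ε' : ℕ} (hn : n = i + j + m + 1)
    {W H : (MvPolynomial ((Fin i ⊕ Fin j ⊕ Fin m) ⊕ Fin n) ℤ)[X]} (hH : IsUniversal ε ε' W H)
    {K f d₁ d₂ : E[X]} (hK : K.degree < (n : WithBot ℕ)) (hf : f.Monic) (hfn : f.natDegree = n)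
    (hd₁ : d₁.Monic) (hi : d₁.natDegree = i) (hd₂ : d₂.Monic) (hj : d₂.natDegree = j)
    (h1 : d₁ ∣ f) (h2 : d₂ ∣ f + K) (hc : IsCoprime d₁ d₂) (hs₁ : d₁.Separable)
    (hs₂ : d₂.Separable) :
    ∃ (a₀ : Fin i ⊕ Fin j ⊕ Fin m → E) (t₀ u v v' : E), u ≠ 0 ∧ v ≠ 0 ∧ v' ≠ 0 ∧
      spec (Sum.elim (fun i => TrivSqZeroExt.inl (a₀ i))
          fun i : Fin n => TrivSqZeroExt.inl (K.coeff i))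
        (TrivSqZeroExt.inl t₀ + DualNumber.eps : DualNumber E) H =
      TrivSqZeroExt.inl u *
      (TrivSqZeroExt.inl v * dsc n (f.map (TrivSqZeroExt.inlHom E E) + C (DualNumber.eps : DualNumber E) *
        (d₁ * d₂).map (TrivSqZeroExt.inlHom E E))) ^ ε *
      (TrivSqZeroExt.inl v' * dsc n ((f + K).map (TrivSqZeroExt.inlHom E E) +
        C (DualNumber.eps : DualNumber E) * (d₁ * d₂).map (TrivSqZeroExt.inlHom E E))) ^ ε' := by
  set ι := TrivSqZeroExt.inlHom E E with hι
  have hιa : ∀ x, ι x = TrivSqZeroExt.inl x := fun _ => rfl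
  let a : Fin i → E := fun l => d₁.coeff l
  let b : Fin j → E := fun l => d₂.coeff l
  let k : Fin n → E := fun l => K.coeff l
  have ha : gmon i a = d₁ := gmon_coeff hd₁ hi
  have hb : gmon j b = d₂ := gmon_coeff hd₂ hj
  set r := resultant (gmon i a) (gmon j b) i j with hr
  have hr0 : r ≠ 0 := (resultant_gmon_ne_zero_iff a b).mpr (by rwa [ha, hb])
  have hrr : C r * C r⁻¹ = (1 : E[X]) := by rw [← C_mul, mul_inv_cancel₀ hr0, C_1]
  have hkK : lowp n k = K := lowp_coeff hK
  set D := d₁ * d₂ with hD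
  have hDm : D.Monic := hd₁.mul hd₂
  have hDd : D.natDegree = i + j := by rw [hD, hd₁.natDegree_mul hd₂, hi, hj]
  have hex : ∀ w : E[X], d₁ ∣ w → d₂ ∣ w + C r * K → w.degree < ((i + j : ℕ) : WithBot ℕ) →
      ∃ p : E[X], p.Monic ∧ p.natDegree = m + 1 ∧ C r * f = w + C r * D * p := by
    intro w w1 w2 w3
    have q2 : d₂ ∣ C r * f + C r * K := by rw [← mul_add]; exact h2.mul_left _
    obtain ⟨p', hp'⟩ := (mul_dvd_sub_iff hc w1 w2 _).mpr ⟨h1.mul_left (C r), q2⟩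
    have e : f - C r⁻¹ * w = D * (C r⁻¹ * p') := by
      linear_combination C r⁻¹ * hp' - f * hrr
    have hdeg : (C r⁻¹ * w).degree < f.degree := by
      rw [degree_eq_natDegree hf.ne_zero, hfn,
        degree_C_mul_of_isUnit (isUnit_iff_ne_zero.mpr (inv_ne_zero hr0))]
      exact w3.trans_le (by exact_mod_cast (by omega : i + j ≤ n))
    have hm : (D * (C r⁻¹ * p')).Monic := by rw [← e]; exact hf.sub_of_left hdeg
    have hpm := hDm.of_mul_monic_left hm
    refine ⟨C r⁻¹ * p', hpm, ?_, ?_⟩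
    · have : (D * (C r⁻¹ * p')).natDegree = n := by
        rw [← e, natDegree_eq_of_degree_eq (degree_sub_eq_left_of_degree_lt hdeg), hfn]
      rw [hDm.natDegree_mul hpm] at this
      omega
    · linear_combination C r * e + w * hrr
  obtain ⟨w1, w2, w3, -⟩ := hH E a b (fun _ => 0) k 0 _ r rfl hr
  rw [ha] at w1
  rw [hb, hkK] at w2
  obtain ⟨p, hp, hpd, hpe⟩ := hex _ w1 w2 w3
  obtain ⟨t₀, g, hgm⟩ : ∃ (t₀ : E) (g : Fin m → E),
      gmon (m + 1) (Fin.cons t₀ g : Fin (m + 1) → E) = p := by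
    refine ⟨p.coeff 0, Fin.tail fun l : Fin (m + 1) => p.coeff l, ?_⟩
    refine Eq.trans ?_ (gmon_coeff hp hpd)
    congr 1
    exact Fin.cons_self_tail (fun l : Fin (m + 1) => p.coeff l)
  rw [hH.map_eq a b _ g k (by rwa [ha, hb])] at hpe
  set w := W.map (MvPolynomial.aeval (vars a b g k) : _ →ₐ[ℤ] E).toRingHom with hw
  have hvars : vars (fun l => ι (a l)) (fun l => ι (b l)) (fun l => ι (g l)) (fun l => ι (k l)) =
      fun l => ι (vars a b g k l) := by
    funext l
    rcases l with (l | l | l) | l <;> rfl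
  have hwι : w.map ι = W.map (MvPolynomial.aeval (vars (fun l => ι (a l)) (fun l => ι (b l))
      (fun l => ι (g l)) fun l => ι (k l)) : _ →ₐ[ℤ] DualNumber E).toRingHom := by
    rw [hw, Polynomial.map_map, hvars]
    congr 1
    ext <;> simp
  have hrι : ι r = resultant (gmon i fun l => ι (a l)) (gmon j fun l => ι (b l)) i j := by
    rw [hr, ← map_gmon, ← map_gmon, resultant_map_map]
  have key := (hH (DualNumber E) _ _ _ _ (ι t₀ + DualNumber.eps) _ _ hwι hrι).2.2.2
  rw [← map_gmon, ← map_gmon, ← map_lowp, ha, hb, hkK] at key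
  have hcons : gmon (m + 1) (Fin.cons (ι t₀ + DualNumber.eps) (fun l => ι (g l)) :
      Fin (m + 1) → DualNumber E) = p.map ι + C DualNumber.eps := by
    rw [← hgm, map_gmon, gmon, gmon, Fin.sum_univ_succ, Fin.sum_univ_succ]
    simp only [Fin.cons_zero, Fin.cons_succ, C_add, Fin.val_zero, pow_zero, mul_one]
    ring
  have hΦ : w.map ι + C (ι r) * (d₁.map ι * d₂.map ι) * (p.map ι + C DualNumber.eps) =
      C (ι r) * (f.map ι + C DualNumber.eps * D.map ι) := by
    have := congrArg (Polynomial.map ι) hpe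
    simp only [hD, Polynomial.map_add, Polynomial.map_mul, map_C] at this ⊢
    linear_combination -this
  have hΦ' : C (ι r) * (f.map ι + C DualNumber.eps * D.map ι) + C (ι r) * K.map ι =
      C (ι r) * ((f + K).map ι + C DualNumber.eps * D.map ι) := by
    rw [Polynomial.map_add]; ring
  have hn0 : n ≠ 0 := by omega
  rw [hcons, hΦ, hΦ', mul_dsc_C_mul hn0, mul_dsc_C_mul hn0, ← map_dsc, ← map_dsc, ← map_pow,
    ← map_pow, ← map_pow, ← map_mul, ← map_mul] at key
  refine ⟨Sum.elim a (Sum.elim b g), t₀, r ^ 2 * dsc i d₁ * dsc j d₂, (r ^ n) ^ 2, (r ^ n) ^ 2,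
    ?_, pow_ne_zero _ (pow_ne_zero _ hr0), pow_ne_zero _ (pow_ne_zero _ hr0), ?_⟩
  · refine mul_ne_zero (mul_ne_zero (pow_ne_zero _ hr0) ?_) ?_
    · rw [← isUnit_iff_ne_zero, ← hi, isUnit_dsc_iff hd₁]; exact hs₁
    · rw [← isUnit_iff_ne_zero, ← hj, isUnit_dsc_iff hd₂]; exact hs₂
  · rw [hvars] at key
    refine Eq.trans ?_ key
    congr 2
    funext l
    rcases l with (l | l | l) | l <;> rfl

lemma isUnit_dual_of_fst {x : DualNumber E} (hx : x.fst ≠ 0) (z : E) (hz : z ≠ 0) :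
    ∃ z', z' ≠ 0 ∧ x * TrivSqZeroExt.inr z = (TrivSqZeroExt.inr z' : DualNumber E) :=
  ⟨x.fst * z, mul_ne_zero hx hz, by ext <;> simp [mul_comm]⟩

lemma fst_dsc_ne_zero {f B : E[X]} {n : ℕ} (hf : f.Monic) (hn : f.natDegree = n)
    (hs : f.Separable) :
    (dsc n (f.map (TrivSqZeroExt.inlHom E E) + C (DualNumber.eps : DualNumber E) *
      B.map (TrivSqZeroExt.inlHom E E))).fst ≠ 0 := by
  have h := map_dsc (TrivSqZeroExt.fstHom E E E : DualNumber E →+* E) n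
    (f.map (TrivSqZeroExt.inlHom E E) + C (DualNumber.eps : DualNumber E) *
      B.map (TrivSqZeroExt.inlHom E E))
  have e : (f.map (TrivSqZeroExt.inlHom E E) + C (DualNumber.eps : DualNumber E) *
      B.map (TrivSqZeroExt.inlHom E E)).map
      (TrivSqZeroExt.fstHom E E E : DualNumber E →+* E) = f := by
    ext k
    simp [coeff_map]
  rw [e] at h
  refine (h.trans_ne ?_ :)
  rw [← isUnit_iff_ne_zero, ← hn, isUnit_dsc_iff hf]
  exact hs

/-- In the family there is a first-order deformation along which the discriminant product
vanishes to order exactly one. -/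
lemma exists_special_point [IsAlgClosed E] (h2 : (2 : E) ≠ 0) {i j m n ε ε' : ℕ}
    (hn : n = i + j + m + 1) (hn2 : 2 ≤ n) (hi : i + 2 ≤ n) (hj : j + 2 ≤ n)
    (hε : ε = 1 ∨ (ε = 0 ∧ ε' = 1))
    {W H : (MvPolynomial ((Fin i ⊕ Fin j ⊕ Fin m) ⊕ Fin n) ℤ)[X]} (hH : IsUniversal ε ε' W H)
    {K : E[X]} (hK0 : K ≠ 0) (hK : K.degree < (n : WithBot ℕ)) :
    ∃ (a₀ : Fin i ⊕ Fin j ⊕ Fin m → E) (t₀ z : E), z ≠ 0 ∧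
      spec (Sum.elim (fun i => TrivSqZeroExt.inl (a₀ i))
          fun i : Fin n => TrivSqZeroExt.inl (K.coeff i))
        (TrivSqZeroExt.inl t₀ + DualNumber.eps : DualNumber E) H = TrivSqZeroExt.inr z := by
  have hsq : ∀ (c : E) (h : E[X]), h.Monic → h.natDegree + 2 = n →
      ((X - C c) ^ 2 * h).Monic ∧ ((X - C c) ^ 2 * h).natDegree = n := by
    intro c h hh hhn
    have h1 := (monic_X_sub_C c).pow 2
    refine ⟨h1.mul hh, ?_⟩
    rw [h1.natDegree_mul hh, natDegree_pow, natDegree_X_sub_C]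
    omega
  have hadd : ∀ f g : E[X], f.Monic → f.natDegree = n → g.degree < (n : WithBot ℕ) →
      (f + g).Monic ∧ (f + g).natDegree = n := by
    intro f g hf hfn hg
    have hd : g.degree < f.degree := by rw [degree_eq_natDegree hf.ne_zero, hfn]; exact hg
    exact ⟨hf.add_of_left hd, by rw [natDegree_add_eq_left_of_degree_lt hd, hfn]⟩
  have hDd : ∀ d₁ d₂ : E[X], d₁.Monic → d₁.natDegree = i → d₂.Monic → d₂.natDegree = j →
      ∀ h : E[X], h.natDegree + 2 = n → (d₁ * d₂).degree < (h.natDegree + 2 : ℕ) := by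
    intro d₁ d₂ m1 e1 m2 e2 h hh
    rw [degree_eq_natDegree (m1.mul m2).ne_zero, m1.natDegree_mul m2, e1, e2, hh]
    exact_mod_cast (by omega : i + j < n)
  rcases hε with rfl | ⟨rfl, rfl⟩
  · obtain ⟨c, h, hm, hhn, hs, hc, hKc, hco, hs'⟩ := exists_special_pair h2 hn2 hK0 hK
    obtain ⟨fm, fd⟩ := hsq c h hm hhn
    obtain ⟨fm', fd'⟩ := hadd _ K fm fd hK
    obtain ⟨d₁, m1, e1, v1⟩ := exists_monic_dvd_natDegree_eq hm (by omega : i ≤ h.natDegree)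
    obtain ⟨d₂, m2, e2, v2⟩ := exists_monic_dvd_natDegree_eq fm' (by omega : j ≤ _)
    have hcc : IsCoprime ((X - C c) ^ 2 * h) ((X - C c) ^ 2 * h + K) := by
      rw [add_comm]; simpa using hco.add_mul_left_right 1
    obtain ⟨a₀, t₀, u, v, v', hu, hv, hv', e⟩ := spec_dual hn hH hK fm fd m1 e1 m2 e2
      (v1.mul_left _) v2
      ((hcc.of_isCoprime_of_dvd_left (v1.mul_left _)).of_isCoprime_of_dvd_right v2)
      (hs.of_dvd v1) (hs'.of_dvd v2)
    have hDc : (d₁ * d₂).eval c ≠ 0 := by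
      rw [eval_mul]
      refine mul_ne_zero (fun h0 => hc (eval_eq_zero_of_dvd_of_eval_eq_zero v1 h0))
        (fun h0 => hKc ?_)
      simpa using eval_eq_zero_of_dvd_of_eval_eq_zero v2 h0
    obtain ⟨z, hz, hze⟩ := dsc_dual h2 hm rfl hs hc (hDd d₁ d₂ m1 e1 m2 e2 h hhn) hDc
    rw [hhn] at hze
    rw [hze, pow_one] at e
    refine ⟨a₀, t₀, ?_⟩
    rw [e]
    obtain ⟨z', hz', hze'⟩ := isUnit_dual_of_fst (x := TrivSqZeroExt.inl u *
      TrivSqZeroExt.inl v * (TrivSqZeroExt.inl v' * dsc n (((X - C c) ^ 2 * h + K).map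
        (TrivSqZeroExt.inlHom E E) + C (DualNumber.eps : DualNumber E) *
        (d₁ * d₂).map (TrivSqZeroExt.inlHom E E))) ^ ε') (by
        simp only [TrivSqZeroExt.fst_mul, TrivSqZeroExt.fst_inl, TrivSqZeroExt.fst_pow]
        exact mul_ne_zero (mul_ne_zero hu hv) (pow_ne_zero _
          (mul_ne_zero hv' (fst_dsc_ne_zero fm' fd' hs')))) z hz
    exact ⟨z', hz', by rw [← hze']; ring⟩
  · have hK' : (-K).degree < (n : WithBot ℕ) := by rwa [degree_neg]
    obtain ⟨c, h, hm, hhn, hs, hc, hKc, hco, hs'⟩ := exists_special_pair h2 hn2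
      (neg_ne_zero.mpr hK0) hK'
    obtain ⟨fm, fd⟩ := hsq c h hm hhn
    obtain ⟨fm', fd'⟩ := hadd _ (-K) fm fd hK'
    obtain ⟨d₂, m2, e2, v2⟩ := exists_monic_dvd_natDegree_eq hm (by omega : j ≤ h.natDegree)
    obtain ⟨d₁, m1, e1, v1⟩ := exists_monic_dvd_natDegree_eq fm' (by omega : i ≤ _)
    have hcc : IsCoprime ((X - C c) ^ 2 * h) ((X - C c) ^ 2 * h + -K) := by
      rw [add_comm]; simpa using hco.add_mul_left_right 1
    have hback : (X - C c) ^ 2 * h + -K + K = (X - C c) ^ 2 * h := by ring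
    obtain ⟨a₀, t₀, u, v, v', hu, hv, hv', e⟩ := spec_dual hn hH hK fm' fd' m1 e1 m2 e2
      v1 (by rw [hback]; exact v2.mul_left _)
      ((hcc.symm.of_isCoprime_of_dvd_left v1).of_isCoprime_of_dvd_right (v2.mul_left _))
      (hs'.of_dvd v1) (hs.of_dvd v2)
    have hDc : (d₁ * d₂).eval c ≠ 0 := by
      rw [eval_mul]
      refine mul_ne_zero (fun h0 => hKc ?_)
        (fun h0 => hc (eval_eq_zero_of_dvd_of_eval_eq_zero v2 h0))
      simpa using eval_eq_zero_of_dvd_of_eval_eq_zero v1 h0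
    obtain ⟨z, hz, hze⟩ := dsc_dual h2 hm rfl hs hc (hDd d₁ d₂ m1 e1 m2 e2 h hhn) hDc
    rw [hhn] at hze
    rw [hback, hze, pow_zero, pow_one, mul_one] at e
    refine ⟨a₀, t₀, ?_⟩
    rw [e]
    obtain ⟨z', hz', hze'⟩ := isUnit_dual_of_fst (x := TrivSqZeroExt.inl u *
      TrivSqZeroExt.inl v') (by simpa using ⟨hu, hv'⟩) z hz
    exact ⟨z', hz', by rw [← hze']; ring⟩

end Special

section Key

open Classical in
theorem exists_abs_sum_pairs_le {n i j ε ε' : ℕ} (hn2 : 2 ≤ n) (hi : 2 * i < n) (hj : 2 * j < n)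
    (hε : ε = 1 ∨ (ε = 0 ∧ ε' = 1)) :
    ∃ B : ℝ, 0 ≤ B ∧ ∀ (F : Type) [Field F] [Fintype F], Odd (Fintype.card F) →
      ∀ K : F[X], K ≠ 0 → K.degree < (n : WithBot ℕ) →
      |∑ a : Fin i → F, ∑ b : Fin j → F, (if IsCoprime (gmon i a) (gmon j b) then
        ∑ c : Fin n → F, (if gmon i a ∣ gmon n c ∧ gmon j b ∣ gmon n c + K then
          polyMu (gmon i a) * polyMu (gmon j b) * polyMu (gmon n c) ^ ε *
            polyMu (gmon n c + K) ^ ε' else 0) else 0)| ≤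
        B * (Fintype.card F : ℝ) ^ (n - 1) * √(Fintype.card F) := by
  obtain ⟨m, hm⟩ := Nat.exists_eq_add_of_lt (by omega : i + j < n)
  obtain ⟨W, H, hH⟩ := exists_universal i j m n ε ε'
  obtain ⟨B, hB0, hB⟩ := exists_abs_sum_qchi_spec_le H
  refine ⟨B, hB0, fun F _ _ hodd K hK0 hK => ?_⟩
  rw [sum_pairs_eq hm hH hK, abs_mul, abs_pow, abs_neg, abs_one, one_pow, one_mul]
  have hcard : Fintype.card (Fin i ⊕ Fin j ⊕ Fin m) = n - 1 := by
    simp only [Fintype.card_sum, Fintype.card_fin]; omega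
  have h2 : (2 : AlgebraicClosure F) ≠ 0 := by
    intro h
    have h' : (2 : F) = 0 := by
      apply (algebraMap F (AlgebraicClosure F)).injective
      rw [map_ofNat, map_zero, h]
    exact neg_one_ne_one_of_odd_card hodd (by linear_combination -h')
  obtain ⟨a₀, t₀, z, hz, he⟩ := exists_special_point h2 hm hn2 (by omega) (by omega) hε hH
    (K := K.map (algebraMap F (AlgebraicClosure F)))
    (by rwa [Ne, Polynomial.map_eq_zero]) (by rwa [degree_map])
  simp only [coeff_map] at he
  have := hB F hodd (fun l => K.coeff l) (AlgebraicClosure F) a₀ t₀ z hz he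
  rwa [hcard] at this

end Key

section Counting

open Classical in
/-- Few members of a shifted family of monic polynomials fail to be squarefree. -/
lemma exists_card_polyMu_eq_zero_le {n : ℕ} (hn : 2 ≤ n) :
    ∃ B : ℕ, ∀ (F : Type) [Field F] [Fintype F], Odd (Fintype.card F) →
      ∀ K : F[X], K.degree < (n : WithBot ℕ) →
      (Finset.univ.filter fun c : Fin n → F => polyMu (gmon n c + K) = 0).card * Fintype.card F ≤
        B * Fintype.card F ^ n := by
  let P : MvPolynomial (Fin n ⊕ Fin n) ℤ :=
    dsc n (gmon n (fun l => MvPolynomial.X (Sum.inl l)) + lowp n fun l => MvPolynomial.X (Sum.inr l))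
  have hP : ∀ (S : Type) [CommRing S] (x y : Fin n → S),
      MvPolynomial.aeval (Sum.elim x y) P = dsc n (gmon n x + lowp n y) := by
    intro S _ x y
    refine (map_dsc (MvPolynomial.aeval (Sum.elim x y) : _ →ₐ[ℤ] S).toRingHom n _).trans ?_
    rw [Polynomial.map_add, map_gmon, map_lowp]
    simp
  obtain ⟨B, hB⟩ := exists_card_zeros_mul_le P
  refine ⟨B, fun F _ _ hodd K hK => ?_⟩
  have h2 : (2 : AlgebraicClosure F) ≠ 0 := by
    intro h
    have h' : (2 : F) = 0 := by
      apply (algebraMap F (AlgebraicClosure F)).injective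
      rw [map_ofNat, map_zero, h]
    exact neg_one_ne_one_of_odd_card hodd (by linear_combination -h')
  set ι := algebraMap F (AlgebraicClosure F) with hι
  obtain ⟨c, h, hm, hhn, -, -, -, -, hs⟩ := exists_special_pair (K := (1 : (AlgebraicClosure F)[X]))
    h2 hn one_ne_zero (by rw [degree_one]; exact_mod_cast (by omega : 0 < n))
  set s := (X - C c) ^ 2 * h with hsdef
  have hsm : s.Monic := ((monic_X_sub_C c).pow 2).mul hm
  have hsd : s.natDegree = n := by
    rw [hsdef, ((monic_X_sub_C c).pow 2).natDegree_mul hm, natDegree_pow, natDegree_X_sub_C]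
    omega
  have hadd : ∀ g : (AlgebraicClosure F)[X], g.degree < (n : WithBot ℕ) →
      (s + g).Monic ∧ (s + g).natDegree = n := by
    intro g hg
    have hd : g.degree < s.degree := by rw [degree_eq_natDegree hsm.ne_zero, hsd]; exact hg
    exact ⟨hsm.add_of_left hd, by rw [natDegree_add_eq_left_of_degree_lt hd, hsd]⟩
  have h1d : (1 : (AlgebraicClosure F)[X]).degree < (n : WithBot ℕ) := by
    rw [degree_one]; exact_mod_cast (by omega : 0 < n)
  have hKd : (K.map ι).degree < (n : WithBot ℕ) := by rwa [degree_map]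
  obtain ⟨a1, a2⟩ := hadd (1 - K.map ι) ((degree_sub_le _ _).trans_lt (max_lt h1d hKd))
  have hne := hB F (fun l => K.coeff l) (AlgebraicClosure F)
    (fun l => (s + (1 - K.map ι)).coeff l) (by
      have e : ∀ l : Fin n, algebraMap F (AlgebraicClosure F) (K.coeff l) = (K.map ι).coeff l :=
        fun l => by rw [coeff_map]
      simp only [e]
      rw [hP, gmon_coeff a1 a2, lowp_coeff hKd,
        show s + (1 - K.map ι) + K.map ι = s + 1 by ring, ← isUnit_iff_ne_zero]
      obtain ⟨b1, b2⟩ := hadd 1 h1d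
      nth_rw 1 [← b2]
      rw [isUnit_dsc_iff b1]
      exact hs)
  rw [Fintype.card_fin] at hne
  refine le_trans (le_of_eq ?_) hne
  congr 2
  refine Finset.filter_congr fun x _ => ?_
  rw [hP, lowp_coeff hK]
  have hd : K.degree < (gmon n x).degree := by
    rw [degree_eq_natDegree (monic_gmon n x).ne_zero, natDegree_gmon]; exact hK
  rw [polyMu, natDegree_add_eq_left_of_degree_lt hd, natDegree_gmon, mul_eq_zero,
    or_iff_right (pow_ne_zero _ (by norm_num)), qchi_eq_zero_iff]

open Classical in
/-- Few monic polynomials have a common factor with a given nonzero polynomial. -/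
lemma exists_card_not_isCoprime_le (n : ℕ) :
    ∃ B : ℕ, ∀ (F : Type) [Field F] [Fintype F],
      ∀ K : F[X], K ≠ 0 → K.degree < (n : WithBot ℕ) →
      (Finset.univ.filter fun c : Fin n → F => ¬ IsCoprime (gmon n c) K).card * Fintype.card F ≤
        B * Fintype.card F ^ n := by
  let P : MvPolynomial (Fin n ⊕ Fin n) ℤ :=
    resultant (gmon n (fun l => MvPolynomial.X (Sum.inl l)))
      (lowp n fun l => MvPolynomial.X (Sum.inr l)) n n
  have hP : ∀ (S : Type) [CommRing S] (x y : Fin n → S),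
      MvPolynomial.aeval (Sum.elim x y) P = resultant (gmon n x) (lowp n y) n n := by
    intro S _ x y
    refine (resultant_map_map _ _ _ _
      (MvPolynomial.aeval (Sum.elim x y) : _ →ₐ[ℤ] S).toRingHom).symm.trans ?_
    have e : ∀ v, (MvPolynomial.aeval (Sum.elim x y) : _ →ₐ[ℤ] S).toRingHom (MvPolynomial.X v) =
      Sum.elim x y v := fun v => MvPolynomial.aeval_X _ v
    rw [map_gmon, map_lowp, funext fun l => e (Sum.inl l), funext fun l => e (Sum.inr l)]
    rfl
  have hres : ∀ (E : Type) [Field E] (f g : E[X]), f.Monic → f.natDegree = n →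
      g.degree < (n : WithBot ℕ) → (resultant f g n n = 0 ↔ ¬ IsCoprime f g) := by
    intro E _ f g hf hfn hg
    have : resultant f g n n = resultant f g := by
      have := resultant_eq_of_natDegree_le hf (natDegree_le_of_degree_le hg.le)
      rw [hfn] at this
      rw [this, hfn]
    rw [this, resultant_eq_zero_iff]
    simp [hf.ne_zero]
  obtain ⟨B, hB⟩ := exists_card_zeros_mul_le P
  refine ⟨B, fun F _ _ K hK0 hK => ?_⟩
  set ι := algebraMap F (AlgebraicClosure F) with hι
  have hKd : (K.map ι).degree < (n : WithBot ℕ) := by rwa [degree_map]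
  obtain ⟨c, hc, -⟩ := exists_eval_ne_zero_of_finite (K := K.map ι)
    (by rwa [Ne, Polynomial.map_eq_zero]) Set.finite_empty
  have hsm : ((X - C c) ^ n).Monic := (monic_X_sub_C c).pow n
  have hsd : ((X - C c) ^ n).natDegree = n := by rw [natDegree_pow, natDegree_X_sub_C, mul_one]
  have hne := hB F (fun l => K.coeff l) (AlgebraicClosure F) (fun l => ((X - C c) ^ n).coeff l) (by
      have e : ∀ l : Fin n, algebraMap F (AlgebraicClosure F) (K.coeff l) = (K.map ι).coeff l :=
        fun l => by rw [coeff_map]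
      simp only [e]
      rw [hP, gmon_coeff hsm hsd, lowp_coeff hKd, Ne, hres _ _ _ hsm hsd hKd, not_not]
      exact IsCoprime.pow_left ((irreducible_X_sub_C c).coprime_iff_not_dvd.mpr
        fun h => hc (dvd_iff_isRoot.mp h)))
  rw [Fintype.card_fin] at hne
  refine le_trans (le_of_eq ?_) hne
  congr 2
  refine Finset.filter_congr fun x _ => ?_
  rw [hP, lowp_coeff hK, hres _ _ _ (monic_gmon n x) (natDegree_gmon n x) hK]

open Classical in
/-- Few pairs of monic polynomials have a common factor. -/
lemma exists_card_pairs_not_isCoprime_le (i j : ℕ) :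
    ∃ B : ℕ, ∀ (F : Type) [Field F] [Fintype F],
      (Finset.univ.filter fun x : (Fin i → F) × (Fin j → F) =>
        ¬ IsCoprime (gmon i x.1) (gmon j x.2)).card * Fintype.card F ≤
        B * Fintype.card F ^ (i + j) := by
  let P : MvPolynomial ((Fin i ⊕ Fin j) ⊕ Fin 0) ℤ :=
    resultant (gmon i fun l => MvPolynomial.X (Sum.inl (Sum.inl l)))
      (gmon j fun l => MvPolynomial.X (Sum.inl (Sum.inr l))) i j
  have hP : ∀ (S : Type) [CommRing S] (x : Fin i ⊕ Fin j → S) (y : Fin 0 → S),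
      MvPolynomial.aeval (Sum.elim x y) P = resultant (gmon i fun l => x (Sum.inl l))
        (gmon j fun l => x (Sum.inr l)) i j := by
    intro S _ x y
    refine (resultant_map_map _ _ _ _
      (MvPolynomial.aeval (Sum.elim x y) : _ →ₐ[ℤ] S).toRingHom).symm.trans ?_
    have e : ∀ v, (MvPolynomial.aeval (Sum.elim x y) : _ →ₐ[ℤ] S).toRingHom (MvPolynomial.X v) =
      Sum.elim x y v := fun v => MvPolynomial.aeval_X _ v
    rw [map_gmon, map_gmon, funext fun l => e (Sum.inl (Sum.inl l)),
      funext fun l => e (Sum.inl (Sum.inr l))]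
    rfl
  obtain ⟨B, hB⟩ := exists_card_zeros_mul_le P
  refine ⟨B, fun F _ _ => ?_⟩
  obtain ⟨g, hg, hgj, hcop⟩ : ∃ g : F[X], g.Monic ∧ g.natDegree = j ∧ IsCoprime (X ^ i) g := by
    rcases Nat.eq_zero_or_pos j with rfl | hj
    · exact ⟨1, monic_one, natDegree_one, isCoprime_one_right⟩
    · refine ⟨X ^ j + 1, monic_X_pow_add (by rw [degree_one]; exact_mod_cast hj), ?_, ?_⟩
      · exact natDegree_X_pow_add_C (r := (1 : F))
      · refine IsCoprime.pow_left ⟨-X ^ (j - 1), 1, ?_⟩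
        obtain ⟨j, rfl⟩ := Nat.exists_eq_succ_of_ne_zero hj.ne'
        simp only [Nat.succ_eq_add_one, Nat.add_sub_cancel]
        ring
  have hne := hB F (fun l => l.elim0) F
    (Sum.elim (fun l => (X ^ i : F[X]).coeff l) fun l => g.coeff l) (by
      rw [hP]
      simp only [Sum.elim_inl, Sum.elim_inr]
      rw [resultant_gmon_ne_zero_iff, gmon_coeff (monic_X_pow i) (natDegree_X_pow i),
        gmon_coeff hg hgj]
      exact hcop)
  rw [Fintype.card_sum, Fintype.card_fin, Fintype.card_fin] at hne
  refine le_trans (le_of_eq ?_) hne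
  congr 1
  refine Finset.card_equiv (Equiv.sumArrowEquivProdArrow (Fin i) (Fin j) F).symm ?_
  intro x
  rw [Finset.mem_filter, Finset.mem_filter, hP, ← not_iff_not, not_and, not_and,
    ← resultant_gmon_ne_zero_iff]
  simp [Equiv.sumArrowEquivProdArrow]

open Classical in
/-- Square-root cancellation for sums of the Möbius function in degree at least two. -/
lemma exists_abs_sum_polyMu_le {n : ℕ} (hn : 2 ≤ n) :
    ∃ B : ℝ, 0 ≤ B ∧ ∀ (F : Type) [Field F] [Fintype F], Odd (Fintype.card F) →
      |∑ c : Fin n → F, polyMu (gmon n c)| ≤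
        B * (Fintype.card F : ℝ) ^ (n - 1) * √(Fintype.card F) := by
  obtain ⟨B, hB0, hB⟩ := exists_abs_sum_pairs_le (i := 0) (j := 0) (ε := 1) (ε' := 0) hn
    (by omega) (by omega) (Or.inl rfl)
  refine ⟨B, hB0, fun F _ _ hodd => ?_⟩
  have := hB F hodd 1 one_ne_zero (by rw [degree_one]; exact_mod_cast (by omega : 0 < n))
  have h1 : ∀ a : Fin 0 → F, gmon 0 a = 1 := fun a => by simp [gmon]
  simpa [h1, polyMu_one, isCoprime_one_left] using this

lemma sum_polyMu_degree_one {F : Type} [Field F] [Fintype F] (hodd : Odd (Fintype.card F)) :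
    ∑ c : Fin 1 → F, polyMu (gmon 1 c) = -(Fintype.card F : ℝ) := by
  have : ∀ c : Fin 1 → F, polyMu (gmon 1 c) = -1 := fun c =>
    polyMu_irreducible hodd (monic_gmon 1 c) (irreducible_of_degree_eq_one (by
      rw [degree_eq_natDegree (monic_gmon 1 c).ne_zero, natDegree_gmon]; rfl))
  simp [this]

end Counting

section DivisorSums

variable {F : Type} [Field F] [Fintype F]

open Classical in
lemma card_gmon_dvd_le (i : ℕ) {f : F[X]} (hf : f.Monic) :
    (Finset.univ.filter fun a : Fin i → F => gmon i a ∣ f).card ≤ 2 ^ f.natDegree := by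
  let N := fun g : F[X] => UniqueFactorizationMonoid.normalizedFactors g
  have hprod : ∀ g : F[X], g.Monic → (N g).prod = g := fun g hg => by
    rw [UniqueFactorizationMonoid.prod_normalizedFactors_eq hg.ne_zero, hg.normalize_eq_self]
  have hNm : ∀ p ∈ N f, p.Monic := fun p hp => by
    rw [← UniqueFactorizationMonoid.normalize_normalized_factor p hp]
    exact monic_normalize (UniqueFactorizationMonoid.prime_of_normalized_factor p hp).ne_zero
  have hcard : Multiset.card (N f) ≤ f.natDegree := by
    conv_rhs => rw [← hprod f hf, natDegree_multiset_prod_of_monic _ hNm]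
    have := Multiset.card_nsmul_le_sum (s := (N f).map natDegree) (a := 1) (by
      intro x hx
      obtain ⟨p, hp, rfl⟩ := Multiset.mem_map.mp hx
      exact (UniqueFactorizationMonoid.irreducible_of_normalized_factor p hp).natDegree_pos)
    simpa using this
  calc _ ≤ (N f).powerset.toFinset.card := by
        refine Finset.card_le_card_of_injOn (fun a => N (gmon i a)) ?_ ?_
        · intro a ha
          simp only [Finset.coe_filter, Finset.mem_univ, true_and] at ha
          rw [Finset.mem_coe, Multiset.mem_toFinset, Multiset.mem_powerset]
          exact (UniqueFactorizationMonoid.dvd_iff_normalizedFactors_le_normalizedFactors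
            (monic_gmon i a).ne_zero hf.ne_zero).mp ha
        · intro a _ b _ h
          apply gmon_injective i
          rw [← hprod _ (monic_gmon i a), ← hprod _ (monic_gmon i b)]
          exact congrArg Multiset.prod h
    _ ≤ Multiset.card (N f).powerset := Multiset.toFinset_card_le _
    _ = 2 ^ Multiset.card (N f) := Multiset.card_powerset _
    _ ≤ _ := Nat.pow_le_pow_right (by norm_num) hcard

open Classical in
/-- The sum of the Möbius function over monic divisors of degree `i`. -/
noncomputable def msum (i : ℕ) (f : F[X]) : ℝ :=
  ∑ a : Fin i → F, if gmon i a ∣ f then polyMu (gmon i a) else 0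

lemma abs_msum_le (i : ℕ) {f : F[X]} (hf : f.Monic) : |msum i f| ≤ 2 ^ f.natDegree := by
  classical
  have h := card_gmon_dvd_le i hf
  calc |msum i f| ≤ ∑ a : Fin i → F, if gmon i a ∣ f then (1 : ℝ) else 0 := by
        refine (Finset.abs_sum_le_sum_abs _ _).trans (Finset.sum_le_sum fun a _ => ?_)
        split_ifs
        · exact abs_polyMu_le _
        · simp
    _ = ((Finset.univ.filter fun a : Fin i → F => gmon i a ∣ f).card : ℝ) := by
        rw [Finset.sum_boole]
    _ ≤ _ := by exact_mod_cast h

/-- The truncated divisor sum representing the von Mangoldt function. -/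
noncomputable def rsum (n : ℕ) (f : F[X]) : ℝ :=
  ∑ i ∈ (Finset.range n).filter fun i => 2 * i < n, ((n : ℝ) / 2 - i) * msum i f

lemma abs_rsum_le {n : ℕ} {f : F[X]} (hf : f.Monic) (hn : f.natDegree = n) :
    |rsum n f| ≤ n * (n * 2 ^ n) := by
  calc |rsum n f| ≤ ∑ i ∈ (Finset.range n).filter fun i => 2 * i < n, (n : ℝ) * 2 ^ n := by
        refine (Finset.abs_sum_le_sum_abs _ _).trans (Finset.sum_le_sum fun i hi => ?_)
        rw [abs_mul]
        have h1 := abs_msum_le i hf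
        rw [hn] at h1
        have hi' : 2 * (i : ℝ) < n := by exact_mod_cast (Finset.mem_filter.mp hi).2
        have h2 : |(n : ℝ) / 2 - i| ≤ n := by
          have : (0 : ℝ) ≤ i := by positivity
          rw [abs_le]; constructor <;> linarith
        exact mul_le_mul h2 h1 (abs_nonneg _) (by positivity)
    _ ≤ _ := by
        rw [Finset.sum_const, nsmul_eq_mul]
        refine mul_le_mul_of_nonneg_right ?_ (by positivity)
        exact_mod_cast (Finset.card_filter_le _ _).trans (Finset.card_range n).le

omit [Fintype F] in
lemma abs_Lam_le {f : F[X]} (hf : f.Monic) : |Lam f| ≤ f.natDegree := by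
  rw [Lam]
  split_ifs with h
  · obtain ⟨h1, h2, k, hk, hfk⟩ := h.choose_spec
    rw [Nat.abs_cast]
    have : h.choose ∣ f := by
      conv_rhs => rw [hfk]
      exact dvd_pow_self _ (by omega)
    exact_mod_cast natDegree_le_of_dvd this hf.ne_zero
  · simp

lemma abs_one_sub_polyMu_le (f : F[X]) : |1 - polyMu f| ≤ 2 := by
  have := abs_le.mp (abs_polyMu_le f)
  rw [abs_le]; constructor <;> linarith

lemma Lam_eq_rsum (hodd : Odd (Fintype.card F)) {n : ℕ} (hn : n ≠ 0) {f : F[X]} (hf : f.Monic)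
    (hfn : f.natDegree = n) (hs : polyMu f ≠ 0) : Lam f = (1 - polyMu f) * rsum n f := by
  have h1 : f ≠ 1 := by
    rintro rfl
    exact hn (by rw [← hfn, natDegree_one])
  rw [Ne, polyMu_eq_zero_iff hf, not_not] at hs
  rw [Lam_eq_mul_sum hodd hf hs h1, hfn]
  rfl

lemma abs_Lam_mul_Lam_sub_le (hodd : Odd (Fintype.card F)) {n : ℕ} (hn : n ≠ 0) {f g : F[X]}
    (hf : f.Monic) (hfn : f.natDegree = n) (hg : g.Monic) (hgn : g.natDegree = n) :
    |Lam f * Lam g - rsum n f * rsum n g * ((1 - polyMu f) * (1 - polyMu g))| ≤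
      (n ^ 2 + (n * (n * 2 ^ n)) ^ 2 * 4) *
        ((if polyMu f = 0 then 1 else 0) + if polyMu g = 0 then 1 else 0) := by
  by_cases h : polyMu f ≠ 0 ∧ polyMu g ≠ 0
  · rw [Lam_eq_rsum hodd hn hf hfn h.1, Lam_eq_rsum hodd hn hg hgn h.2, if_neg h.1, if_neg h.2]
    ring_nf
    simp
  · have h1 : (1 : ℝ) ≤ (if polyMu f = 0 then 1 else 0) + if polyMu g = 0 then 1 else 0 := by
      rw [not_and_or, not_not, not_not] at h
      rcases h with h | h <;> rw [if_pos h] <;> split_ifs <;> norm_num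
    refine le_trans ?_ (le_mul_of_one_le_right (by positivity) h1)
    refine (abs_sub _ _).trans (add_le_add ?_ ?_)
    · rw [abs_mul, sq]
      have e1 := abs_Lam_le hf
      have e2 := abs_Lam_le hg
      rw [hfn] at e1
      rw [hgn] at e2
      exact mul_le_mul e1 e2 (abs_nonneg _) (by positivity)
    · rw [abs_mul, abs_mul, abs_mul, sq, (by norm_num : (4 : ℝ) = 2 * 2)]
      exact mul_le_mul (mul_le_mul (abs_rsum_le hf hfn) (abs_rsum_le hg hgn) (abs_nonneg _)
        (by positivity)) (mul_le_mul (abs_one_sub_polyMu_le f) (abs_one_sub_polyMu_le g)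
        (abs_nonneg _) (by positivity)) (by positivity) (by positivity)

open Classical in
/-- The sum over coprime pairs of divisors. -/
noncomputable def tsumc (n i j ε ε' : ℕ) (K : F[X]) : ℝ :=
  ∑ a : Fin i → F, ∑ b : Fin j → F, (if IsCoprime (gmon i a) (gmon j b) then
    ∑ c : Fin n → F, (if gmon i a ∣ gmon n c ∧ gmon j b ∣ gmon n c + K then
      polyMu (gmon i a) * polyMu (gmon j b) * polyMu (gmon n c) ^ ε *
        polyMu (gmon n c + K) ^ ε' else 0) else 0)

omit [Fintype F] in
lemma gmon_add {n : ℕ} {K : F[X]} (hK : K.degree < (n : WithBot ℕ)) (c : Fin n → F) :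
    (gmon n c + K).Monic ∧ (gmon n c + K).natDegree = n := by
  have hd : K.degree < (gmon n c).degree := by
    rw [degree_eq_natDegree (monic_gmon n c).ne_zero, natDegree_gmon]; exact hK
  exact ⟨(monic_gmon n c).add_of_left hd, by
    rw [natDegree_add_eq_left_of_degree_lt hd, natDegree_gmon]⟩

open Classical in
lemma abs_sum_msum_sub_le (n i j : ℕ) {K : F[X]} (hK : K.degree < (n : WithBot ℕ)) :
    |∑ c : Fin n → F, msum i (gmon n c) * msum j (gmon n c + K) *
        ((1 - polyMu (gmon n c)) * (1 - polyMu (gmon n c + K))) -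
      (tsumc n i j 0 0 K - tsumc n i j 1 0 K - tsumc n i j 0 1 K + tsumc n i j 1 1 K)| ≤
    2 ^ n * 2 ^ n * 4 *
      ((Finset.univ.filter fun c : Fin n → F => ¬ IsCoprime (gmon n c) K).card : ℝ) := by
  let g : (Fin n → F) → (Fin i → F) → (Fin j → F) → ℝ := fun c a b =>
    if gmon i a ∣ gmon n c ∧ gmon j b ∣ gmon n c + K then
      polyMu (gmon i a) * polyMu (gmon j b) *
        ((1 - polyMu (gmon n c)) * (1 - polyMu (gmon n c + K))) else 0
  have e1 : tsumc n i j 0 0 K - tsumc n i j 1 0 K - tsumc n i j 0 1 K + tsumc n i j 1 1 K =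
      ∑ c : Fin n → F, ∑ a : Fin i → F, ∑ b : Fin j → F,
        if IsCoprime (gmon i a) (gmon j b) then g c a b else 0 := by
    rw [Finset.sum_comm]
    simp only [tsumc, ← Finset.sum_sub_distrib, ← Finset.sum_add_distrib]
    refine Finset.sum_congr rfl fun a _ => ?_
    rw [Finset.sum_comm]
    refine Finset.sum_congr rfl fun b _ => ?_
    split_ifs
    · rw [← Finset.sum_sub_distrib, ← Finset.sum_sub_distrib, ← Finset.sum_add_distrib]
      refine Finset.sum_congr rfl fun c _ => ?_
      simp only [g]
      split_ifs
      · ring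
      · ring
    · simp
  have e2 : ∀ c : Fin n → F, msum i (gmon n c) * msum j (gmon n c + K) *
        ((1 - polyMu (gmon n c)) * (1 - polyMu (gmon n c + K))) =
      ∑ a : Fin i → F, ∑ b : Fin j → F, g c a b := by
    intro c
    rw [msum, msum, Finset.sum_mul_sum, Finset.sum_mul]
    refine Finset.sum_congr rfl fun a _ => ?_
    rw [Finset.sum_mul]
    refine Finset.sum_congr rfl fun b _ => ?_
    simp only [g]
    split_ifs <;> simp_all
  rw [e1, Finset.sum_congr rfl fun c _ => e2 c, ← Finset.sum_sub_distrib, ← Finset.sum_boole,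
    Finset.mul_sum]
  refine (Finset.abs_sum_le_sum_abs _ _).trans (Finset.sum_le_sum fun c _ => ?_)
  have hcop : ∀ a b, IsCoprime (gmon n c) K → g c a b ≠ 0 →
      IsCoprime (gmon i a) (gmon j b) := by
    intro a b h hg
    have hd : gmon i a ∣ gmon n c ∧ gmon j b ∣ gmon n c + K := by
      by_contra hcon
      exact hg (if_neg hcon)
    have : IsCoprime (gmon n c) (gmon n c + K) := by
      rw [add_comm]; simpa using h.add_mul_left_right 1
    exact (this.of_isCoprime_of_dvd_left hd.1).of_isCoprime_of_dvd_right hd.2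
  by_cases hc : IsCoprime (gmon n c) K
  · rw [if_neg (not_not.mpr hc), mul_zero, abs_nonpos_iff, sub_eq_zero]
    refine Finset.sum_congr rfl fun a _ => Finset.sum_congr rfl fun b _ => ?_
    split_ifs with h
    · rfl
    · by_contra h0
      exact h (hcop a b hc h0)
  · rw [if_pos hc, mul_one]
    have hg : ∀ a b, |g c a b| ≤ (if gmon i a ∣ gmon n c then 1 else 0) *
        (if gmon j b ∣ gmon n c + K then 1 else 0) * 4 := by
      intro a b
      simp only [g]
      by_cases h1 : gmon i a ∣ gmon n c <;> by_cases h2 : gmon j b ∣ gmon n c + K <;>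
        simp [h1, h2]
      rw [(by norm_num : (4 : ℝ) = (1 * 1) * (2 * 2))]
      rw [← abs_mul, ← abs_mul, ← abs_mul, abs_mul, abs_mul, abs_mul]
      exact mul_le_mul (mul_le_mul (abs_polyMu_le _) (abs_polyMu_le _) (abs_nonneg _)
        (by positivity)) (mul_le_mul (abs_one_sub_polyMu_le _) (abs_one_sub_polyMu_le _)
        (abs_nonneg _) (by positivity)) (by positivity) (by positivity)
    rw [← Finset.sum_sub_distrib]
    calc _ ≤ ∑ a : Fin i → F, ∑ b : Fin j → F, (if gmon i a ∣ gmon n c then (1 : ℝ) else 0) *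
        (if gmon j b ∣ gmon n c + K then 1 else 0) * 4 := by
          refine (Finset.abs_sum_le_sum_abs _ _).trans (Finset.sum_le_sum fun a _ => ?_)
          rw [← Finset.sum_sub_distrib]
          refine (Finset.abs_sum_le_sum_abs _ _).trans (Finset.sum_le_sum fun b _ => ?_)
          refine le_trans ?_ (hg a b)
          split_ifs
          · simp
          · simp
      _ = ((Finset.univ.filter fun a : Fin i → F => gmon i a ∣ gmon n c).card : ℝ) *
          ((Finset.univ.filter fun b : Fin j → F => gmon j b ∣ gmon n c + K).card : ℝ) * 4 := by
          simp only [← Finset.sum_mul, ← Finset.mul_sum, Finset.sum_boole]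
      _ ≤ _ := by
          have h1 := card_gmon_dvd_le i (monic_gmon n c)
          have h2 := card_gmon_dvd_le j (gmon_add hK c).1
          rw [natDegree_gmon] at h1
          rw [(gmon_add hK c).2] at h2
          gcongr
          · exact_mod_cast h1
          · exact_mod_cast h2

end DivisorSums

section MainTerm

variable {F : Type} [Field F] [Fintype F]

/-- The sum of the Möbius function over monic polynomials of degree `i`. -/
noncomputable def mobSum (F : Type) [Field F] [Fintype F] (i : ℕ) : ℝ :=
  ∑ a : Fin i → F, polyMu (gmon i a)

open Classical in
lemma sum_dvd_const {n i j m : ℕ} (hn : n = i + j + m) (a : Fin i → F) (b : Fin j → F) {K : F[X]}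
    (hab : IsCoprime (gmon i a) (gmon j b)) (x : ℝ) :
    ∑ c : Fin n → F, (if gmon i a ∣ gmon n c ∧ gmon j b ∣ gmon n c + K then x else 0) =
      (Fintype.card F : ℝ) ^ m * x := by
  set D := gmon i a * gmon j b with hD
  have hDm : D.Monic := (monic_gmon i a).mul (monic_gmon j b)
  have hDd : D.natDegree = i + j := by
    rw [hD, (monic_gmon i a).natDegree_mul (monic_gmon j b), natDegree_gmon, natDegree_gmon]
  obtain ⟨u, v, huv⟩ := hab
  set w := (-K * u * gmon i a) %ₘ D with hw
  have hmod : w + D * ((-K * u * gmon i a) /ₘ D) = -K * u * gmon i a := modByMonic_add_div _ _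
  have w1 : gmon i a ∣ w :=
    ⟨-K * u - gmon j b * ((-K * u * gmon i a) /ₘ D), by linear_combination hmod⟩
  have w2 : gmon j b ∣ w + K :=
    ⟨K * v - gmon i a * ((-K * u * gmon i a) /ₘ D), by linear_combination hmod - K * huv⟩
  have wd : w.degree < (n : WithBot ℕ) := by
    refine (degree_modByMonic_lt _ hDm).trans_le ?_
    rw [degree_eq_natDegree hDm.ne_zero, hDd]
    exact_mod_cast (by omega : i + j ≤ n)
  have hiff : ∀ f, D ∣ f - w ↔ gmon i a ∣ f ∧ gmon j b ∣ f + K :=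
    mul_dvd_sub_iff ⟨u, v, huv⟩ w1 w2
  have := sum_add_mul_gmon hDm hDd hn wd (fun _ => x)
  simp only [hiff] at this
  rw [← this]
  simp

open Classical in
lemma abs_tsumc_zero_sub_le {n i j m : ℕ} (hn : n = i + j + m) (K : F[X]) :
    |tsumc n i j 0 0 K - (Fintype.card F : ℝ) ^ m * (mobSum F i * mobSum F j)| ≤
      (Fintype.card F : ℝ) ^ m *
        ((Finset.univ.filter fun x : (Fin i → F) × (Fin j → F) =>
          ¬ IsCoprime (gmon i x.1) (gmon j x.2)).card : ℝ) := by
  have e : tsumc n i j 0 0 K = (Fintype.card F : ℝ) ^ m * ∑ a : Fin i → F, ∑ b : Fin j → F,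
      if IsCoprime (gmon i a) (gmon j b) then polyMu (gmon i a) * polyMu (gmon j b) else 0 := by
    rw [tsumc, Finset.mul_sum]
    refine Finset.sum_congr rfl fun a _ => ?_
    rw [Finset.mul_sum]
    refine Finset.sum_congr rfl fun b _ => ?_
    simp only [pow_zero, mul_one]
    split_ifs with h
    · exact sum_dvd_const hn a b h _
    · rw [mul_zero]
  rw [e, ← mul_sub, abs_mul, abs_of_nonneg (by positivity : (0 : ℝ) ≤ (Fintype.card F : ℝ) ^ m)]
  refine mul_le_mul_of_nonneg_left ?_ (by positivity)
  rw [mobSum, mobSum, Finset.sum_mul_sum, ← Finset.sum_sub_distrib, ← Finset.sum_boole,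
    Fintype.sum_prod_type]
  refine (Finset.abs_sum_le_sum_abs _ _).trans (Finset.sum_le_sum fun a _ => ?_)
  rw [← Finset.sum_sub_distrib]
  refine (Finset.abs_sum_le_sum_abs _ _).trans (Finset.sum_le_sum fun b _ => ?_)
  split_ifs with h1
  · simp
  · rw [zero_sub, abs_neg, abs_mul]
    exact mul_le_one₀ (abs_polyMu_le _) (abs_nonneg _) (abs_polyMu_le _)

lemma one_le_sqrt_card : 1 ≤ √(Fintype.card F : ℝ) := by
  rw [Real.one_le_sqrt]
  exact_mod_cast Fintype.card_pos

lemma pow_pred_mul_sqrt {n : ℕ} (hn : n ≠ 0) : (Fintype.card F : ℝ) ^ (n - 1) * √(Fintype.card F) =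
    (Fintype.card F : ℝ) ^ n / √(Fintype.card F) := by
  have h1 : 1 ≤ √(Fintype.card F : ℝ) := one_le_sqrt_card
  obtain ⟨n, rfl⟩ := Nat.exists_eq_succ_of_ne_zero hn
  rw [eq_div_iff (by positivity), mul_assoc, Real.mul_self_sqrt (by positivity)]
  exact (pow_succ _ _).symm

lemma le_of_mul_card_le {x B n : ℕ} (h : x * Fintype.card F ≤ B * Fintype.card F ^ n) :
    (x : ℝ) ≤ B * ((Fintype.card F : ℝ) ^ n / √(Fintype.card F)) := by
  have h1 : 1 ≤ √(Fintype.card F : ℝ) := one_le_sqrt_card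
  have h' : (x : ℝ) * Fintype.card F ≤ B * (Fintype.card F : ℝ) ^ n := by exact_mod_cast h
  rw [← mul_div_assoc, le_div_iff₀ (by positivity)]
  refine le_trans ?_ h'
  refine mul_le_mul_of_nonneg_left ?_ (by positivity)
  nlinarith [Real.mul_self_sqrt (by positivity : (0 : ℝ) ≤ Fintype.card F)]

end MainTerm

section Asymptotics

lemma exists_abs_sum_msum_sub_le {n i j : ℕ} (hn : 2 ≤ n) (hi : 2 * i < n) (hj : 2 * j < n) :
    ∃ B : ℝ, 0 ≤ B ∧ ∀ (F : Type) [Field F] [Fintype F], Odd (Fintype.card F) →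
      ∀ K : F[X], K ≠ 0 → K.degree < (n : WithBot ℕ) →
      |∑ c : Fin n → F, msum i (gmon n c) * msum j (gmon n c + K) *
        ((1 - polyMu (gmon n c)) * (1 - polyMu (gmon n c + K))) -
        (Fintype.card F : ℝ) ^ n * (mobSum F i / (Fintype.card F : ℝ) ^ i *
          (mobSum F j / (Fintype.card F : ℝ) ^ j))| ≤
      B * ((Fintype.card F : ℝ) ^ n / √(Fintype.card F)) := by
  classical
  obtain ⟨B1, h1, hB1⟩ := exists_abs_sum_pairs_le hn hi hj (ε := 1) (ε' := 0) (by simp)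
  obtain ⟨B2, h2, hB2⟩ := exists_abs_sum_pairs_le hn hi hj (ε := 0) (ε' := 1) (by simp)
  obtain ⟨B3, h3, hB3⟩ := exists_abs_sum_pairs_le hn hi hj (ε := 1) (ε' := 1) (by simp)
  obtain ⟨B4, hB4⟩ := exists_card_not_isCoprime_le n
  obtain ⟨B5, hB5⟩ := exists_card_pairs_not_isCoprime_le i j
  refine ⟨2 ^ n * 2 ^ n * 4 * B4 + B5 + B1 + B2 + B3, by positivity, fun F _ _ hodd K hK0 hK => ?_⟩
  obtain ⟨m, hm⟩ := Nat.exists_eq_add_of_le (by omega : i + j ≤ n)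
  set q : ℝ := (Fintype.card F : ℝ) with hq
  have hq0 : 0 < q := by rw [hq]; exact_mod_cast Fintype.card_pos
  set u := q ^ n / √q with hu
  have e1 := hB1 F hodd K hK0 hK
  have e2 := hB2 F hodd K hK0 hK
  have e3 := hB3 F hodd K hK0 hK
  rw [mul_assoc, pow_pred_mul_sqrt (by omega)] at e1 e2 e3
  have e4 := le_of_mul_card_le (hB4 F K hK0 hK)
  have e5 := abs_tsumc_zero_sub_le hm K
  have e5' : q ^ m * ((Finset.univ.filter fun x : (Fin i → F) × (Fin j → F) =>
          ¬ IsCoprime (gmon i x.1) (gmon j x.2)).card : ℝ) ≤ B5 * u := by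
    have := mul_le_mul_of_nonneg_left (le_of_mul_card_le (hB5 F)) (by positivity : 0 ≤ q ^ m)
    refine this.trans (le_of_eq ?_)
    rw [hu, ← hq, hm, pow_add q (i + j) m]
    ring
  have e6 := abs_sum_msum_sub_le n i j hK
  have e4' := mul_le_mul_of_nonneg_left e4 (by positivity : (0 : ℝ) ≤ 2 ^ n * 2 ^ n * 4)
  have hT : q ^ n * (mobSum F i / q ^ i * (mobSum F j / q ^ j)) =
      q ^ m * (mobSum F i * mobSum F j) := by
    rw [hm, pow_add, pow_add]
    field_simp
  rw [hT]
  change |tsumc n i j 1 0 K| ≤ _ at e1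
  change |tsumc n i j 0 1 K| ≤ _ at e2
  change |tsumc n i j 1 1 K| ≤ _ at e3
  rw [abs_le] at *
  constructor <;> linarith [e1.1, e1.2, e2.1, e2.2, e3.1, e3.2, e5.1, e5.2, e6.1, e6.2]

lemma exists_abs_mobSum_div_sub_le (i : ℕ) :
    ∃ B : ℝ, 0 ≤ B ∧ ∀ (F : Type) [Field F] [Fintype F], Odd (Fintype.card F) →
      |mobSum F i / (Fintype.card F : ℝ) ^ i -
        ((if i = 0 then 1 else 0) - if i = 1 then 1 else 0)| ≤ B / √(Fintype.card F) := by
  have hq0 : ∀ (F : Type) [Field F] [Fintype F], (0 : ℝ) < Fintype.card F := fun F _ _ => by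
    exact_mod_cast Fintype.card_pos
  match i with
  | 0 =>
    refine ⟨0, le_rfl, fun F _ _ _ => ?_⟩
    simp [mobSum, gmon, polyMu_one]
  | 1 =>
    refine ⟨0, le_rfl, fun F _ _ hodd => ?_⟩
    rw [mobSum, sum_polyMu_degree_one hodd]
    have := (hq0 F).ne'
    simp [this]
  | i + 2 =>
    obtain ⟨B, hB0, hB⟩ := exists_abs_sum_polyMu_le (by omega : 2 ≤ i + 2)
    refine ⟨B, hB0, fun F _ _ hodd => ?_⟩
    have := hB F hodd
    rw [mul_assoc, pow_pred_mul_sqrt (by omega)] at this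
    have hp := pow_pos (hq0 F) (i + 2)
    rw [if_neg (by omega), if_neg (by omega), sub_zero, sub_zero, abs_div, abs_of_pos hp,
      div_le_iff₀ hp]
    refine this.trans (le_of_eq ?_)
    ring

lemma exists_abs_main_sub_one_le {n : ℕ} (hn : 2 ≤ n) :
    ∃ B : ℝ, 0 ≤ B ∧ ∀ (F : Type) [Field F] [Fintype F], Odd (Fintype.card F) →
      |∑ i ∈ (Finset.range n).filter (fun i => 2 * i < n), ((n : ℝ) / 2 - i) *
        (mobSum F i / (Fintype.card F : ℝ) ^ i) - 1| ≤ B / √(Fintype.card F) := by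
  choose B hB0 hB using exists_abs_mobSum_div_sub_le
  refine ⟨∑ i ∈ (Finset.range n).filter (fun i => 2 * i < n), |(n : ℝ) / 2 - i| * B i,
    Finset.sum_nonneg fun i _ => mul_nonneg (abs_nonneg _) (hB0 i), fun F _ _ hodd => ?_⟩
  have hone : (1 : ℝ) = ∑ i ∈ (Finset.range n).filter (fun i => 2 * i < n), ((n : ℝ) / 2 - i) *
      ((if i = 0 then 1 else 0) - if i = 1 then 1 else 0) := by
    simp only [mul_sub, mul_ite, mul_one, mul_zero, Finset.sum_sub_distrib, Finset.sum_ite_eq',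
      Finset.mem_filter, Finset.mem_range]
    rw [if_pos (by omega)]
    split_ifs with h
    · push_cast; ring
    · have : n = 2 := by omega
      subst this
      norm_num
  conv_lhs => rw [hone]
  rw [← Finset.sum_sub_distrib, Finset.sum_div]
  refine (Finset.abs_sum_le_sum_abs _ _).trans (Finset.sum_le_sum fun i _ => ?_)
  rw [← mul_sub, abs_mul, mul_div_assoc]
  exact mul_le_mul_of_nonneg_left (hB i F hodd) (abs_nonneg _)

lemma sum_rsum_eq {F : Type} [Field F] [Fintype F] (n : ℕ) (K : F[X]) :
    ∑ c : Fin n → F, rsum n (gmon n c) * rsum n (gmon n c + K) *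
      ((1 - polyMu (gmon n c)) * (1 - polyMu (gmon n c + K))) =
    ∑ i ∈ (Finset.range n).filter (fun i => 2 * i < n),
      ∑ j ∈ (Finset.range n).filter (fun i => 2 * i < n), ((n : ℝ) / 2 - i) * ((n : ℝ) / 2 - j) *
      ∑ c : Fin n → F, msum i (gmon n c) * msum j (gmon n c + K) *
        ((1 - polyMu (gmon n c)) * (1 - polyMu (gmon n c + K))) := by
  simp_rw [Finset.mul_sum]
  rw [Finset.sum_congr rfl fun i _ => Finset.sum_comm, Finset.sum_comm]
  refine Finset.sum_congr rfl fun c _ => ?_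
  rw [rsum, rsum, Finset.sum_mul_sum, Finset.sum_mul]
  refine Finset.sum_congr rfl fun i _ => ?_
  rw [Finset.sum_mul]
  refine Finset.sum_congr rfl fun j _ => ?_
  ring

lemma exists_abs_sum_rsum_sub_le {n : ℕ} (hn : 2 ≤ n) :
    ∃ B : ℝ, 0 ≤ B ∧ ∀ (F : Type) [Field F] [Fintype F], Odd (Fintype.card F) →
      ∀ K : F[X], K ≠ 0 → K.degree < (n : WithBot ℕ) →
      |∑ c : Fin n → F, rsum n (gmon n c) * rsum n (gmon n c + K) *
        ((1 - polyMu (gmon n c)) * (1 - polyMu (gmon n c + K))) - (Fintype.card F : ℝ) ^ n| ≤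
      B * ((Fintype.card F : ℝ) ^ n / √(Fintype.card F)) := by
  have hex : ∀ i j : ℕ, ∃ B : ℝ, 0 ≤ B ∧ (2 * i < n → 2 * j < n →
      ∀ (F : Type) [Field F] [Fintype F], Odd (Fintype.card F) →
      ∀ K : F[X], K ≠ 0 → K.degree < (n : WithBot ℕ) →
      |∑ c : Fin n → F, msum i (gmon n c) * msum j (gmon n c + K) *
        ((1 - polyMu (gmon n c)) * (1 - polyMu (gmon n c + K))) -
        (Fintype.card F : ℝ) ^ n * (mobSum F i / (Fintype.card F : ℝ) ^ i *
          (mobSum F j / (Fintype.card F : ℝ) ^ j))| ≤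
      B * ((Fintype.card F : ℝ) ^ n / √(Fintype.card F))) := by
    intro i j
    by_cases h : 2 * i < n ∧ 2 * j < n
    · obtain ⟨B, hB0, hB⟩ := exists_abs_sum_msum_sub_le hn h.1 h.2
      exact ⟨B, hB0, fun _ _ => hB⟩
    · exact ⟨0, le_rfl, fun h1 h2 => (h ⟨h1, h2⟩).elim⟩
  choose B hB0 hB using hex
  obtain ⟨B', hB'0, hB'⟩ := exists_abs_main_sub_one_le hn
  set I := (Finset.range n).filter (fun i => 2 * i < n) with hI
  have hB1 : 0 ≤ ∑ i ∈ I, ∑ j ∈ I, |((n : ℝ) / 2 - i) * ((n : ℝ) / 2 - j)| * B i j :=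
    Finset.sum_nonneg fun i _ => Finset.sum_nonneg fun j _ => mul_nonneg (abs_nonneg _) (hB0 i j)
  refine ⟨∑ i ∈ I, ∑ j ∈ I, |((n : ℝ) / 2 - i) * ((n : ℝ) / 2 - j)| * B i j + B' * (B' + 2),
    by positivity, fun F _ _ hodd K hK0 hK => ?_⟩
  have hs : 1 ≤ √(Fintype.card F : ℝ) := one_le_sqrt_card
  set q : ℝ := (Fintype.card F : ℝ) with hq
  have hq0 : 0 < q := by rw [hq]; exact_mod_cast Fintype.card_pos
  have hA := hB' F hodd
  set A := ∑ i ∈ I, ((n : ℝ) / 2 - i) * (mobSum F i / q ^ i) with hAdef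
  have hAA : q ^ n * (A * A) = ∑ i ∈ I, ∑ j ∈ I, ((n : ℝ) / 2 - i) * ((n : ℝ) / 2 - j) *
      (q ^ n * (mobSum F i / q ^ i * (mobSum F j / q ^ j))) := by
    rw [hAdef, Finset.sum_mul_sum, Finset.mul_sum]
    refine Finset.sum_congr rfl fun i _ => ?_
    rw [Finset.mul_sum]
    refine Finset.sum_congr rfl fun j _ => ?_
    ring
  have h1 : |∑ c : Fin n → F, rsum n (gmon n c) * rsum n (gmon n c + K) *
        ((1 - polyMu (gmon n c)) * (1 - polyMu (gmon n c + K))) - q ^ n * (A * A)| ≤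
      (∑ i ∈ I, ∑ j ∈ I, |((n : ℝ) / 2 - i) * ((n : ℝ) / 2 - j)| * B i j) * (q ^ n / √q) := by
    rw [sum_rsum_eq, hAA, ← Finset.sum_sub_distrib, Finset.sum_mul]
    refine (Finset.abs_sum_le_sum_abs _ _).trans (Finset.sum_le_sum fun i hi => ?_)
    rw [← Finset.sum_sub_distrib, Finset.sum_mul]
    refine (Finset.abs_sum_le_sum_abs _ _).trans (Finset.sum_le_sum fun j hj => ?_)
    rw [← mul_sub, abs_mul, mul_assoc]
    exact mul_le_mul_of_nonneg_left (hB i j (Finset.mem_filter.mp hi).2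
      (Finset.mem_filter.mp hj).2 F hodd K hK0 hK) (abs_nonneg _)
  have h2 : |q ^ n * (A * A) - q ^ n| ≤ B' * (B' + 2) * (q ^ n / √q) := by
    have e : q ^ n * (A * A) - q ^ n = q ^ n * ((A - 1) * (A + 1)) := by ring
    have hA2 : |A + 1| ≤ B' + 2 := by
      have : B' / √q ≤ B' := div_le_self hB'0 hs
      have := abs_le.mp (hA.trans this)
      rw [abs_le]; constructor <;> linarith
    rw [e, abs_mul, abs_mul, abs_of_pos (pow_pos hq0 n)]
    calc q ^ n * (|A - 1| * |A + 1|) ≤ q ^ n * (B' / √q * (B' + 2)) := by gcongr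
      _ = _ := by ring
  rw [add_mul]
  exact (abs_sub_le _ _ _).trans (add_le_add h1 h2)

theorem exists_abs_sum_Lam_sub_le {n : ℕ} (hn : 2 ≤ n) :
    ∃ B : ℝ, 0 ≤ B ∧ ∀ (F : Type) [Field F] [Fintype F], Odd (Fintype.card F) →
      ∀ K : F[X], K ≠ 0 → K.degree < (n : WithBot ℕ) →
      |∑ c : Fin n → F, Lam (gmon n c) * Lam (gmon n c + K) - (Fintype.card F : ℝ) ^ n| ≤
      B * ((Fintype.card F : ℝ) ^ n / √(Fintype.card F)) := by
  classical
  obtain ⟨B1, h1, hB1⟩ := exists_abs_sum_rsum_sub_le hn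
  obtain ⟨B2, hB2⟩ := exists_card_polyMu_eq_zero_le hn
  obtain ⟨M, hM0, hM⟩ : ∃ M : ℝ, 0 ≤ M ∧ M = n ^ 2 + (n * (n * 2 ^ n)) ^ 2 * 4 :=
    ⟨_, by positivity, rfl⟩
  refine ⟨M * (B2 + B2) + B1, by positivity, fun F _ _ hodd K hK0 hK => ?_⟩
  have e1 := hB1 F hodd K hK0 hK
  have e2 := le_of_mul_card_le (hB2 F hodd K hK)
  have e3 := le_of_mul_card_le (hB2 F hodd 0 (by rw [degree_zero]; exact WithBot.bot_lt_coe n))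
  simp only [add_zero] at e3
  have e4 : |∑ c : Fin n → F, Lam (gmon n c) * Lam (gmon n c + K) -
      ∑ c : Fin n → F, rsum n (gmon n c) * rsum n (gmon n c + K) *
        ((1 - polyMu (gmon n c)) * (1 - polyMu (gmon n c + K)))| ≤
      M * (B2 + B2) * ((Fintype.card F : ℝ) ^ n / √(Fintype.card F)) := by
    rw [← Finset.sum_sub_distrib, mul_assoc, add_mul]
    refine le_trans ?_ (mul_le_mul_of_nonneg_left (add_le_add e3 e2) hM0)
    rw [hM, ← Finset.sum_boole, ← Finset.sum_boole, ← Finset.sum_add_distrib, Finset.mul_sum]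
    refine (Finset.abs_sum_le_sum_abs _ _).trans (Finset.sum_le_sum fun c _ => ?_)
    exact abs_Lam_mul_Lam_sub_le hodd (by omega) (monic_gmon n c) (natDegree_gmon n c)
      (gmon_add hK c).1 (gmon_add hK c).2
  rw [add_mul]
  exact (abs_sub_le _ _ _).trans (add_le_add e4 e1)

end Asymptotics

/-- The function field Hardy–Littlewood asymptotic: for `n ≥ 2` there is `C = C(n) > 0`
such that for every odd prime power `q` and every nonzero `K` with `deg K < n`,
`|q⁻ⁿ ∑_{f ∈ Mₙ} Λ(f)Λ(f+K) − 1| ≤ C q^{−1/2}`. -/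
theorem hardy_littlewood_function_field (n : ℕ) (hn : 2 ≤ n) :
    ∃ C : ℝ, 0 < C ∧ ∀ (F : Type) [Field F] [Fintype F],
      Odd (Fintype.card F) →
      ∀ K : F[X], K ≠ 0 → K.natDegree < n →
      |((Fintype.card F : ℝ) ^ n)⁻¹ *
          (∑ a : Fin n → F, Lam (mon n a) * Lam (mon n a + K)) - 1| ≤
        C * (Fintype.card F : ℝ) ^ (-(1 / 2) : ℝ) := by
  obtain ⟨B, hB0, hB⟩ := exists_abs_sum_Lam_sub_le hn
  refine ⟨B + 1, by positivity, fun F _ _ hodd K hK0 hK => ?_⟩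
  have h := hB F hodd K hK0 ((natDegree_lt_iff_degree_lt hK0).mp hK)
  change |∑ c : Fin n → F, Lam (mon n c) * Lam (mon n c + K) - _| ≤ _ at h
  have hq0 : (0 : ℝ) < Fintype.card F := by exact_mod_cast Fintype.card_pos
  have hqn := pow_pos hq0 n
  rw [Real.rpow_neg hq0.le, ← Real.sqrt_eq_rpow]
  have hs : 0 ≤ (√(Fintype.card F : ℝ))⁻¹ := by positivity
  calc _ = ((Fintype.card F : ℝ) ^ n)⁻¹ *
        |∑ c : Fin n → F, Lam (mon n c) * Lam (mon n c + K) - (Fintype.card F : ℝ) ^ n| := by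
        conv_rhs => rw [← abs_of_pos (inv_pos.mpr hqn), ← abs_mul, mul_sub,
          inv_mul_cancel₀ hqn.ne']
    _ ≤ ((Fintype.card F : ℝ) ^ n)⁻¹ *
        (B * ((Fintype.card F : ℝ) ^ n / √(Fintype.card F))) := by gcongr
    _ = B * (√(Fintype.card F : ℝ))⁻¹ := by field_simp
    _ ≤ _ := by nlinarith
end
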